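/- Let q be a power of an odd prime, F_q a finite field with q elements, n ≥ 1, and let J ∈ M_{2n}(F_q) be an invertible symmetric matrix. Let G = GO°(J) = {g ∈ GL(2n, F_q) : gᵀ J g = μ(g) J for some μ(g) ∈ F_q^×, and det g = μ(g)^n}, and let R be a complete set of irreducible complex representations of G. Then Σ_{ρ ∈ R} dim ρ ≤ (q+1)^{n² + 1}. -/

import Mathlib

open Matrix CategoryTheory
open scoped Classical

noncomputable section

/-- The Frobenius–Schur indicator of a complex-valued function on a finite group. -/
def fsIndicator (G : Type*) [Group G] [Fintype G] (χ : G → ℂ) : ℂ :=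
  (Fintype.card G : ℂ)⁻¹ * ∑ g : G, χ (g * g)

/-- The twisted Frobenius–Schur indicator of a complex-valued function on a finite group,
with respect to a map `σ`. -/
def twistedFSIndicator (G : Type*) [Group G] [Fintype G] (σ : G → G) (χ : G → ℂ) : ℂ :=
  (Fintype.card G : ℂ)⁻¹ * ∑ g : G, χ (g * σ g)

/-- A complex-valued function is real-valued if all its values are real. -/
def IsRealValued {G : Type*} (χ : G → ℂ) : Prop := ∀ g : G, ∃ r : ℝ, χ g = (r : ℂ)

/-- The Gaussian binomial coefficient `binom(m,k)_q` as a real number. -/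
def gbinom (m k : ℕ) (q : ℝ) : ℝ := ∏ i ∈ Finset.Icc 1 k, (q ^ (m - k + i) - 1) / (q ^ i - 1)

section Groups

variable {N F : Type*} [Fintype N] [DecidableEq N] [Field F]

theorem sim_one (J : Matrix N N F) :
    ((1 : GL N F) : Matrix N N F)ᵀ * J * ((1 : GL N F) : Matrix N N F) = ((1 : Fˣ) : F) • J := by
  simp

theorem sim_mul {J : Matrix N N F} (a b : GL N F) (c d : Fˣ)
    (hc : (a : Matrix N N F)ᵀ * J * (a : Matrix N N F) = (c : F) • J)
    (hd : (b : Matrix N N F)ᵀ * J * (b : Matrix N N F) = (d : F) • J) :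
    ((a * b : GL N F) : Matrix N N F)ᵀ * J * ((a * b : GL N F) : Matrix N N F)
      = ((c * d : Fˣ) : F) • J := by
  calc ((a * b : GL N F) : Matrix N N F)ᵀ * J * ((a * b : GL N F) : Matrix N N F)
      = (b : Matrix N N F)ᵀ * ((a : Matrix N N F)ᵀ * J * (a : Matrix N N F)) *
          (b : Matrix N N F) := by
        rw [show ((a * b : GL N F) : Matrix N N F) = (a : Matrix N N F) * b from rfl,
          transpose_mul]
        simp only [Matrix.mul_assoc]
    _ = (b : Matrix N N F)ᵀ * ((c : F) • J) * (b : Matrix N N F) := by rw [hc]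
    _ = (c : F) • ((b : Matrix N N F)ᵀ * J * (b : Matrix N N F)) := by
        rw [Matrix.mul_smul, Matrix.smul_mul]
    _ = (c : F) • ((d : F) • J) := by rw [hd]
    _ = ((c * d : Fˣ) : F) • J := by rw [smul_smul, Units.val_mul]

theorem sim_inv {J : Matrix N N F} (a : GL N F) (c : Fˣ)
    (hc : (a : Matrix N N F)ᵀ * J * (a : Matrix N N F) = (c : F) • J) :
    ((a⁻¹ : GL N F) : Matrix N N F)ᵀ * J * ((a⁻¹ : GL N F) : Matrix N N F)
      = ((c⁻¹ : Fˣ) : F) • J := by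
  have ht : ((a⁻¹ : GL N F) : Matrix N N F)ᵀ * (a : Matrix N N F)ᵀ = 1 := by
    rw [← transpose_mul, a.mul_inv, transpose_one]
  have key : ((a⁻¹ : GL N F) : Matrix N N F)ᵀ * ((a : Matrix N N F)ᵀ * J * (a : Matrix N N F)) *
      ((a⁻¹ : GL N F) : Matrix N N F) = J := by
    calc ((a⁻¹ : GL N F) : Matrix N N F)ᵀ * ((a : Matrix N N F)ᵀ * J * (a : Matrix N N F)) *
        ((a⁻¹ : GL N F) : Matrix N N F)
        = (((a⁻¹ : GL N F) : Matrix N N F)ᵀ * (a : Matrix N N F)ᵀ) * J *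
          ((a : Matrix N N F) * ((a⁻¹ : GL N F) : Matrix N N F)) := by
          simp only [Matrix.mul_assoc]
      _ = J := by rw [ht, a.mul_inv, Matrix.one_mul, Matrix.mul_one]
  have key2 : ((a⁻¹ : GL N F) : Matrix N N F)ᵀ * ((c : F) • J) * ((a⁻¹ : GL N F) : Matrix N N F)
      = (c : F) • (((a⁻¹ : GL N F) : Matrix N N F)ᵀ * J * ((a⁻¹ : GL N F) : Matrix N N F)) := by
    rw [Matrix.mul_smul, Matrix.smul_mul]
  have h3 : (c : F) • (((a⁻¹ : GL N F) : Matrix N N F)ᵀ * J *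
      ((a⁻¹ : GL N F) : Matrix N N F)) = J := by rw [← key2, ← hc, key]
  calc ((a⁻¹ : GL N F) : Matrix N N F)ᵀ * J * ((a⁻¹ : GL N F) : Matrix N N F)
      = ((c⁻¹ : Fˣ) : F) • ((c : F) • (((a⁻¹ : GL N F) : Matrix N N F)ᵀ * J *
          ((a⁻¹ : GL N F) : Matrix N N F))) := by
        rw [smul_smul, ← Units.val_mul, inv_mul_cancel, Units.val_one, one_smul]
    _ = ((c⁻¹ : Fˣ) : F) • J := by rw [h3]

/-- The similitude group of the bilinear form given by the matrix `J`:  all invertible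
matrices `g` with `gᵀ * J * g = c • J` for some nonzero scalar `c` (the similitude of `g`). -/
def similitudeGroup (J : Matrix N N F) : Subgroup (GL N F) where
  carrier := {g | ∃ c : Fˣ, (g : Matrix N N F)ᵀ * J * (g : Matrix N N F) = (c : F) • J}
  one_mem' := ⟨1, sim_one J⟩
  mul_mem' := by rintro a b ⟨c, hc⟩ ⟨d, hd⟩; exact ⟨c * d, sim_mul a b c d hc hd⟩
  inv_mem' := by rintro a ⟨c, hc⟩; exact ⟨c⁻¹, sim_inv a c hc⟩

/-- The isometry group of the bilinear form given by the matrix `J`:  all invertible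
matrices `g` with `gᵀ * J * g = J`. -/
def fixGroup (J : Matrix N N F) : Subgroup (GL N F) where
  carrier := {g | (g : Matrix N N F)ᵀ * J * (g : Matrix N N F) = J}
  one_mem' := by simp
  mul_mem' := by
    intro a b ha hb
    have := sim_mul (J := J) a b 1 1 (by simpa using ha) (by simpa using hb)
    simpa using this
  inv_mem' := by
    intro a ha
    have := sim_inv (J := J) a 1 (by simpa using ha)
    simpa using this

/-- The group of isometries of determinant one of the bilinear form given by the matrix `J`. -/
def specialFixGroup (J : Matrix N N F) : Subgroup (GL N F) where
  carrier := {g | (g : Matrix N N F)ᵀ * J * (g : Matrix N N F) = J ∧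
    ((g : Matrix N N F)).det = 1}
  one_mem' := ⟨by simp, by simp⟩
  mul_mem' := by
    rintro a b ⟨ha1, ha2⟩ ⟨hb1, hb2⟩
    refine ⟨(fixGroup J).mul_mem ha1 hb1, ?_⟩
    rw [show ((a * b : GL N F) : Matrix N N F) = (a : Matrix N N F) * b from rfl,
      Matrix.det_mul, ha2, hb2, one_mul]
  inv_mem' := by
    rintro a ⟨ha1, ha2⟩
    refine ⟨(fixGroup J).inv_mem ha1, ?_⟩
    have h := congrArg Matrix.det a.mul_inv
    rw [Matrix.det_mul, ha2, one_mul, Matrix.det_one] at h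
    exact h

/-- The connected component of the similitude group of the symmetric bilinear form on a
`2 * m`-dimensional space given by the matrix `J`:  all similitudes `g`, with similitude
character `μ`, such that `det g = μ(g) ^ m`. -/
def connSimilitudeGroup (J : Matrix N N F) (m : ℕ) : Subgroup (GL N F) where
  carrier := {g | ∃ c : Fˣ, (g : Matrix N N F)ᵀ * J * (g : Matrix N N F) = (c : F) • J ∧
    ((g : Matrix N N F)).det = (c : F) ^ m}
  one_mem' := ⟨1, sim_one J, by simp⟩
  mul_mem' := by
    rintro a b ⟨c, hc1, hc2⟩ ⟨d, hd1, hd2⟩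
    refine ⟨c * d, sim_mul a b c d hc1 hd1, ?_⟩
    rw [show ((a * b : GL N F) : Matrix N N F) = (a : Matrix N N F) * b from rfl,
      Matrix.det_mul, hc2, hd2, Units.val_mul, mul_pow]
  inv_mem' := by
    rintro a ⟨c, hc1, hc2⟩
    refine ⟨c⁻¹, sim_inv a c hc1, ?_⟩
    have h := congrArg Matrix.det a.mul_inv
    rw [Matrix.det_mul, hc2, Matrix.det_one] at h
    have hc : ((c : F) ^ m)⁻¹ = ((c⁻¹ : Fˣ) : F) ^ m := by
      rw [← inv_pow]
      norm_cast
    rw [← hc]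
    exact (inv_eq_of_mul_eq_one_right h).symm

theorem neg_one_mem_similitudeGroup (J : Matrix N N F) : (-1 : GL N F) ∈ similitudeGroup J := by
  refine ⟨1, ?_⟩
  have h : ((-1 : GL N F) : Matrix N N F) = -1 := by simp
  rw [h]
  simp

/-- The standard symplectic form matrix `[[0, I], [-I, 0]]`. -/
def Jsp (n : ℕ) (F : Type*) [Field F] : Matrix (Fin n ⊕ Fin n) (Fin n ⊕ Fin n) F :=
  Matrix.fromBlocks 0 1 (-1) 0

/-- The standard split symmetric form matrix `[[0, I], [I, 0]]`. -/
def Jsplit (n : ℕ) (F : Type*) [Field F] : Matrix (Fin n ⊕ Fin n) (Fin n ⊕ Fin n) F :=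
  Matrix.fromBlocks 0 1 1 0

/-- A symmetric matrix `J` of size `2n` is split if it is congruent to `[[0, I], [I, 0]]`. -/
def IsSplit {n : ℕ} (J : Matrix (Fin n ⊕ Fin n) (Fin n ⊕ Fin n) F) : Prop :=
  ∃ P : GL (Fin n ⊕ Fin n) F,
    (P : Matrix (Fin n ⊕ Fin n) (Fin n ⊕ Fin n) F)ᵀ * J * P = Jsplit n F

/-- The symplectic similitude group `GSp(2n, F)`. -/
def GSp (n : ℕ) (F : Type*) [Field F] : Subgroup (GL (Fin n ⊕ Fin n) F) :=
  similitudeGroup (Jsp n F)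

/-- The symplectic group `Sp(2n, F)`. -/
def Sp (n : ℕ) (F : Type*) [Field F] : Subgroup (GL (Fin n ⊕ Fin n) F) :=
  fixGroup (Jsp n F)


/-- The underlying matrix of an element of a matrix subgroup. -/
def matOf {S : Subgroup (GL N F)} (g : ↥S) : Matrix N N F := ((g : GL N F) : Matrix N N F)

end Groups

noncomputable instance subgroupFintype {G : Type*} [Group G] [Finite G] (S : Subgroup G) :
    Fintype S := Fintype.ofFinite _

open scoped ComplexOrder in
theorem char_inv_eq_conj {G : Type} [Group G] [Fintype G] (V : FDRep ℂ G) (g : G) :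
    V.character g⁻¹ = (starRingEnd ℂ) (V.character g) := by
  set b := Module.finBasis ℂ V
  set A : G →* Matrix (Fin (Module.finrank ℂ V)) (Fin (Module.finrank ℂ V)) ℂ :=
    ((LinearMap.toMatrixAlgEquiv b).toAlgHom.toMonoidHom).comp V.ρ with hA
  have htr : ∀ x, V.character x = (A x).trace := fun x => by
    rw [FDRep.character, LinearMap.trace_eq_matrix_trace ℂ b]; rfl
  set P : Matrix _ _ ℂ := ∑ h : G, (A h)ᴴ * A h with hP
  have hinv : (A g)ᴴ * P * A g = P := by
    rw [hP, Finset.mul_sum, Finset.sum_mul]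
    refine Fintype.sum_bijective (fun h => h * g) (Group.mulRight_bijective g) _ _ fun h => ?_
    simp [Matrix.mul_assoc, conjTranspose_mul]
  have hpd : P.PosDef := by
    rw [hP, ← Finset.add_sum_erase _ _ (Finset.mem_univ (1 : G))]
    refine Matrix.PosDef.add_posSemidef (by simpa using Matrix.PosDef.one) ?_
    exact Matrix.posSemidef_sum _ fun h _ => Matrix.posSemidef_conjTranspose_mul_self _
  have hu := hpd.isUnit
  have hd : IsUnit P.det := (Matrix.isUnit_iff_isUnit_det _).1 hu
  have h1 : A g * A g⁻¹ = 1 := by rw [← map_mul]; simp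
  have h2 : A g⁻¹ = P⁻¹ * (A g)ᴴ * P := by
    have : (A g)ᴴ * P = P * A g⁻¹ := by
      conv_rhs => rw [← hinv]
      rw [Matrix.mul_assoc _ (A g), h1, Matrix.mul_one]
    rw [Matrix.mul_assoc, this, ← Matrix.mul_assoc, Matrix.nonsing_inv_mul _ hd, Matrix.one_mul]
  rw [htr, htr, h2, Matrix.mul_assoc, Matrix.trace_mul_comm, Matrix.mul_assoc,
    Matrix.mul_nonsing_inv _ hd, Matrix.mul_one, Matrix.trace_conjTranspose]
  rfl


theorem sum_char_mul_conj {G : Type} [Group G] [Fintype G] {ι : Type} (R : ι → FDRep ℂ G)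
    (hsimple : ∀ i, Simple (R i)) (hdistinct : ∀ i j : ι, Nonempty (R i ≅ R j) → i = j)
    (i j : ι) :
    ∑ g : G, (R i).character g * (starRingEnd ℂ) ((R j).character g) =
      if i = j then (Fintype.card G : ℂ) else 0 := by
  have := hsimple i
  have := hsimple j
  have : Invertible (Nat.card G : ℂ) := invertibleOfNonzero (by simp)
  have h := FDRep.char_orthonormal (R i) (R j)
  have hij : Nonempty (R i ≅ R j) ↔ i = j :=
      ⟨hdistinct i j, fun h => by subst h; exact ⟨Iso.refl _⟩⟩
  simp only [hij] at h
  have hc : (Nat.card G : ℂ) ≠ 0 := by simp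
  simp only [← char_inv_eq_conj]
  rw [inv_mul_eq_iff_eq_mul₀ hc] at h
  rw [h]
  split_ifs <;> simp

theorem sum_sq_finrank_le_card {G : Type} [Group G] [Fintype G] {ι : Type} [Fintype ι]
    (R : ι → FDRep ℂ G)
    (hsimple : ∀ i, Simple (R i)) (hdistinct : ∀ i j : ι, Nonempty (R i ≅ R j) → i = j) :
    ∑ i, (Module.finrank ℂ (R i) : ℝ) ^ 2 ≤ Fintype.card G := by
  set N : ℝ := (Fintype.card G : ℝ)
  have hN : 0 < N := by simp only [N]; exact_mod_cast Fintype.card_pos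
  set D := ∑ i, (Module.finrank ℂ (R i) : ℝ) ^ 2 with hD
  set f : G → ℂ := fun g => ∑ i, (Module.finrank ℂ (R i) : ℂ) * (R i).character g with hf
  have hf1 : f 1 = (D : ℂ) := by
    simp only [hf, hD, FDRep.char_one]; push_cast; simp [sq]
  have hff : ∑ g, f g * (starRingEnd ℂ) (f g) = ((N * D : ℝ) : ℂ) := by
    have e1 : ∀ g, f g * (starRingEnd ℂ) (f g) = ∑ i, ∑ j, (Module.finrank ℂ (R i) : ℂ) *
        (Module.finrank ℂ (R j) : ℂ) *
          ((R i).character g * (starRingEnd ℂ) ((R j).character g)) := by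
      intro g
      simp only [hf, map_sum, Finset.sum_mul_sum, map_mul, Complex.conj_natCast]
      refine Finset.sum_congr rfl fun i _ => Finset.sum_congr rfl fun j _ => by ring
    simp only [e1]
    rw [Finset.sum_comm]
    have e2 : ∀ i, ∑ g : G, ∑ j, (Module.finrank ℂ (R i) : ℂ) *
        (Module.finrank ℂ (R j) : ℂ) * ((R i).character g * (starRingEnd ℂ) ((R j).character g)) =
        (Module.finrank ℂ (R i) : ℂ) ^ 2 * N := by
      intro i
      rw [Finset.sum_comm]
      simp only [← Finset.mul_sum, sum_char_mul_conj R hsimple hdistinct]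
      simp [N, sq]
    simp only [e2, hD]
    push_cast
    rw [← Finset.sum_mul, mul_comm]
  have key : (0 : ℝ) ≤ ∑ g, Complex.normSq ((if g = 1 then (N : ℂ) else 0) - f g) :=
    Finset.sum_nonneg fun g _ => Complex.normSq_nonneg _
  have e3 : ((∑ g, Complex.normSq ((if g = 1 then (N : ℂ) else 0) - f g) : ℝ) : ℂ) =
      ((N * N - N * D : ℝ) : ℂ) := by
    push_cast
    have : ∀ g, ((Complex.normSq ((if g = 1 then (N : ℂ) else 0) - f g) : ℝ) : ℂ) =
        (if g = 1 then (N : ℂ) * N - N * (starRingEnd ℂ) (f 1) - N * f 1 else 0) +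
          f g * (starRingEnd ℂ) (f g) := by
      intro g
      rw [← Complex.mul_conj]
      by_cases h : g = 1
      · subst h; simp; ring
      · simp [h]
    simp only [this, Finset.sum_add_distrib, hff, hf1]
    simp
  have e4 := Complex.ofReal_injective e3
  rw [e4] at key
  nlinarith

theorem card_le_card_conjClasses {G : Type} [Group G] [Fintype G] {ι : Type} [Fintype ι]
    (R : ι → FDRep ℂ G)
    (hsimple : ∀ i, Simple (R i)) (hdistinct : ∀ i j : ι, Nonempty (R i ≅ R j) → i = j) :
    Fintype.card ι ≤ Fintype.card (ConjClasses G) := by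
  set χ : ι → ConjClasses G → ℂ := fun i c => Quotient.liftOn c (R i).character (by
    intro a b hab
    obtain ⟨c, hc⟩ := isConj_iff.1 hab
    rw [← hc, FDRep.char_conj]) with hχ
  have hχe : ∀ i g, χ i (ConjClasses.mk g) = (R i).character g := fun i g => rfl
  have : LinearIndependent ℂ χ := by
    rw [Fintype.linearIndependent_iff]
    intro a ha j
    have h1 : ∀ g : G, ∑ i, a i * (R i).character g = 0 := by
      intro g
      have := congrFun ha (ConjClasses.mk g)
      simpa [hχe] using this
    have h2 : ∑ g : G, (∑ i, a i * (R i).character g) *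
        (starRingEnd ℂ) ((R j).character g) = 0 := by
      simp [h1]
    simp only [Finset.sum_mul, mul_assoc] at h2
    rw [Finset.sum_comm] at h2
    simp only [← Finset.mul_sum, sum_char_mul_conj R hsimple hdistinct] at h2
    simpa using h2
  simpa using this.fintype_card_le_finrank

theorem sum_finrank_sq_le {G : Type} [Group G] [Fintype G] {ι : Type} [Fintype ι]
    (R : ι → FDRep ℂ G)
    (hsimple : ∀ i, Simple (R i)) (hdistinct : ∀ i j : ι, Nonempty (R i ≅ R j) → i = j) :
    (∑ i, (Module.finrank ℂ (R i) : ℝ)) ^ 2 ≤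
      Nat.card (ConjClasses G) * Fintype.card G := by
  rw [Nat.card_eq_fintype_card]
  calc _ ≤ (Fintype.card ι : ℝ) * ∑ i, (Module.finrank ℂ (R i) : ℝ) ^ 2 := by
        simpa using sq_sum_le_card_mul_sum_sq (s := Finset.univ)
          (f := fun i => (Module.finrank ℂ (R i) : ℝ))
    _ ≤ _ := by
        have h1 := sum_sq_finrank_le_card R hsimple hdistinct
        have h2 : (Fintype.card ι : ℝ) ≤ Fintype.card (ConjClasses G) := by
          exact_mod_cast card_le_card_conjClasses R hsimple hdistinct
        gcongr

section Counting
variable {F : Type} [Field F] [Fintype F]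

/-- The number of solutions of a diagonal quadratic equation. -/
def diagCount {N : ℕ} (d : Fin N → F) (c : F) : ℤ :=
  ∑ x : Fin N → F, if ∑ i, d i * x i ^ 2 = c then 1 else 0

theorem sum_ite_mul_sq_eq (hF : ringChar F ≠ 2) {a : F} (ha : a ≠ 0) (s : F) :
    ∑ x : F, (if a * x ^ 2 = s then (1 : ℤ) else 0) = 1 + quadraticChar F (a * s) := by
  have h := quadraticChar_card_sqrts hF (a⁻¹ * s)
  have h1 : quadraticChar F (a⁻¹ * s) = quadraticChar F (a * s) := by
    have : a * s = a ^ 2 * (a⁻¹ * s) := by field_simp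
    rw [this, map_mul (quadraticChar F) (a ^ 2), quadraticChar_sq_one' ha, one_mul]
  rw [← h1, add_comm, ← h, Finset.sum_boole]
  congr 2
  ext x
  simp [eq_inv_mul_iff_mul_eq₀ ha]

theorem sum_quadraticChar_mul_sub (hF : ringChar F ≠ 2) (t : F) :
    ∑ s : F, quadraticChar F (s * (t - s)) =
      quadraticChar F (-1) * (if t = 0 then (Fintype.card F : ℤ) - 1 else -1) := by
  have h0 : ∀ f : F → ℤ, f 0 = 0 → ∑ s, f s = ∑ s ∈ Finset.univ.erase 0, f s := by
    intro f hf
    rw [← Finset.add_sum_erase _ _ (Finset.mem_univ (0 : F)), hf, zero_add]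
  rw [h0 _ (by simp)]
  have h1 : ∀ s ∈ Finset.univ.erase (0 : F), quadraticChar F (s * (t - s)) =
      quadraticChar F (t * s⁻¹ - 1) := by
    intro s hs
    have hs : s ≠ 0 := by simpa using hs
    have : s * (t - s) = s ^ 2 * (t * s⁻¹ - 1) := by field_simp
    rw [this, map_mul (quadraticChar F) (s ^ 2), quadraticChar_sq_one' hs, one_mul]
  rw [Finset.sum_congr rfl h1]
  split_ifs with ht
  · subst ht
    simp [Finset.card_erase_of_mem, Nat.cast_sub Fintype.card_pos]
    exact mul_comm _ _
  · have : ∑ s ∈ Finset.univ.erase (0 : F), quadraticChar F (t * s⁻¹ - 1) =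
        ∑ u ∈ Finset.univ.erase (-1 : F), quadraticChar F u := by
      refine Finset.sum_bij' (fun s _ => t * s⁻¹ - 1) (fun u _ => t * (u + 1)⁻¹) ?_ ?_ ?_ ?_ ?_
      · intro s hs
        have hs : s ≠ 0 := by simpa using hs
        simp [sub_eq_iff_eq_add, ht, hs]
      · intro u hu
        have hu : u + 1 ≠ 0 := by
          rw [Ne, ← eq_neg_iff_add_eq_zero]; simpa using hu
        simp [ht, hu]
      · intro s hs
        have hs : s ≠ 0 := by simpa using hs
        simp only [sub_add_cancel]
        field_simp
      · intro u hu
        have hu : u + 1 ≠ 0 := by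
          rw [Ne, ← eq_neg_iff_add_eq_zero]; simpa using hu
        field_simp
        ring
      · intros; rfl
    rw [this, Finset.sum_erase_eq_sub (Finset.mem_univ _), quadraticChar_sum_zero hF]
    ring

theorem sum_binary_eq (hF : ringChar F ≠ 2) {a b : F} (ha : a ≠ 0) (hb : b ≠ 0) (t : F) :
    ∑ x : F, ∑ y : F, (if a * x ^ 2 + b * y ^ 2 = t then (1 : ℤ) else 0) =
      Fintype.card F - quadraticChar F (-(a * b)) +
        (if t = 0 then (Fintype.card F : ℤ) * quadraticChar F (-(a * b)) else 0) := by
  have h1 : ∀ x y : F, (if a * x ^ 2 + b * y ^ 2 = t then (1 : ℤ) else 0) =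
      ∑ s : F, (if a * x ^ 2 = s then (1 : ℤ) else 0) * (if b * y ^ 2 = t - s then 1 else 0) := by
    intro x y
    simp only [ite_mul, one_mul, zero_mul, Finset.sum_ite_eq, Finset.mem_univ, if_true]
    congr 1
    rw [eq_iff_iff, eq_sub_iff_add_eq, add_comm]
  simp only [h1]
  have h2 : ∀ x, ∑ y : F, ∑ s : F, (if a * x ^ 2 = s then (1 : ℤ) else 0) *
      (if b * y ^ 2 = t - s then 1 else 0) =
      ∑ s : F, (if a * x ^ 2 = s then (1 : ℤ) else 0) * (1 + quadraticChar F (b * (t - s))) := by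
    intro x
    rw [Finset.sum_comm]
    simp only [← Finset.mul_sum, sum_ite_mul_sq_eq hF hb]
  simp only [h2]
  rw [Finset.sum_comm]
  simp only [← Finset.sum_mul, sum_ite_mul_sq_eq hF ha]
  have h3 : ∀ s : F, (1 + quadraticChar F (a * s)) * (1 + quadraticChar F (b * (t - s))) =
      1 + quadraticChar F a * quadraticChar F s + quadraticChar F b * quadraticChar F (t - s) +
        quadraticChar F (a * b) * quadraticChar F (s * (t - s)) := by
    intro s; simp only [map_mul]; ring
  have h4 : ∑ s : F, quadraticChar F (t - s) = 0 := by
    rw [← quadraticChar_sum_zero hF]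
    exact Fintype.sum_equiv (Equiv.subLeft t) _ _ fun _ => rfl
  simp only [h3, Finset.sum_add_distrib, ← Finset.mul_sum, quadraticChar_sum_zero hF, h4,
    sum_quadraticChar_mul_sub hF]
  rw [show -(a * b) = (a * b) * (-1) by ring, map_mul (quadraticChar F) (a * b)]
  split_ifs <;> simp <;> ring

theorem diagCount_succ_succ (hF : ringChar F ≠ 2) {N : ℕ} (d : Fin (N + 2) → F)
    (hd : ∀ i, d i ≠ 0) (c : F) :
    diagCount d c = (Fintype.card F : ℤ) ^ N *
      (Fintype.card F - quadraticChar F (-(d 0 * d 1))) +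
      Fintype.card F * quadraticChar F (-(d 0 * d 1)) *
        diagCount (fun i : Fin N => d i.succ.succ) c := by
  unfold diagCount
  rw [← (Fin.consEquiv fun _ => F).sum_comp, Fintype.sum_prod_type]
  simp only [Fin.consEquiv_apply]
  simp_rw [← (Fin.consEquiv fun _ : Fin (N + 1) => F).sum_comp, Fintype.sum_prod_type]
  simp only [Fin.consEquiv_apply, Fin.sum_univ_succ (n := N + 1), Fin.sum_univ_succ (n := N),
    Fin.cons_zero, Fin.cons_succ, Fin.succ_zero_eq_one]
  rw [Finset.sum_congr rfl fun x _ => Finset.sum_comm, Finset.sum_comm]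
  have hx : ∀ u v w : F, u + (v + w) = c ↔ u + v = c - w := fun u v w => by
    rw [← add_assoc, eq_sub_iff_add_eq]
  simp only [hx]
  simp only [sum_binary_eq hF (hd 0) (hd 1), Finset.sum_add_distrib, sub_eq_zero, eq_comm (a := c)]
  simp only [Finset.sum_const, Finset.card_univ, Fintype.card_fun, Fintype.card_fin,
    Finset.mul_sum, mul_ite, mul_one, mul_zero]
  simp

theorem prod_fin_succ_succ {R : Type} [CommRing R] {N : ℕ} (d : Fin (N + 2) → R) :
    ∏ i, d i = d 0 * d 1 * ∏ i : Fin N, d i.succ.succ := by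
  rw [Fin.prod_univ_succ, Fin.prod_univ_succ, mul_assoc]
  rfl

theorem diagCount_even (hF : ringChar F ≠ 2) (m : ℕ) (d : Fin (2 * m) → F)
    (hd : ∀ i, d i ≠ 0) {c : F} (hc : c ≠ 0) :
    Fintype.card F * diagCount d c = (Fintype.card F : ℤ) ^ (2 * m) -
      quadraticChar F ((-1) ^ m * ∏ i, d i) * (Fintype.card F : ℤ) ^ m := by
  induction m with
  | zero => simp [diagCount, hc.symm]
  | succ m ih =>
    have := ih (fun i : Fin (2 * m) => d i.succ.succ) fun i => hd _
    rw [diagCount_succ_succ (N := 2 * m) hF d hd c]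
    rw [show (-1) ^ (m + 1) * ∏ i, d i =
      (-(d 0 * d 1)) * ((-1) ^ m * ∏ i : Fin (2 * m), d i.succ.succ) by
        rw [show ∏ i, d i = _ from prod_fin_succ_succ (N := 2 * m) d]; ring, map_mul]
    linear_combination (Fintype.card F : ℤ) * quadraticChar F (-(d 0 * d 1)) * this

theorem diagCount_odd (hF : ringChar F ≠ 2) (m : ℕ) (d : Fin (2 * m + 1) → F)
    (hd : ∀ i, d i ≠ 0) (c : F) :
    diagCount d c = (Fintype.card F : ℤ) ^ (2 * m) +
      quadraticChar F ((-1) ^ m * (c * ∏ i, d i)) * (Fintype.card F : ℤ) ^ m := by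
  induction m with
  | zero =>
    have := sum_ite_mul_sq_eq hF (hd 0) c
    unfold diagCount
    rw [← (Equiv.funUnique (Fin 1) F).symm.sum_comp]
    simpa [mul_comm] using this
  | succ m ih =>
    have := ih (fun i : Fin (2 * m + 1) => d i.succ.succ) fun i => hd _
    rw [diagCount_succ_succ (N := 2 * m + 1) hF d hd c]
    rw [show (-1) ^ (m + 1) * (c * ∏ i, d i) =
      (-(d 0 * d 1)) * ((-1) ^ m * (c * ∏ i : Fin (2 * m + 1), d i.succ.succ)) by
        rw [show ∏ i, d i = _ from prod_fin_succ_succ (N := 2 * m + 1) d]; ring, map_mul]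
    linear_combination (Fintype.card F : ℤ) * quadraticChar F (-(d 0 * d 1)) * this

end Counting

section OrthogonalOrder
variable {F : Type} [Field F]

theorem inv_mul_isometry {N : Type} [Fintype N] [DecidableEq N] {J A B : Matrix N N F}
    (hA : IsUnit A.det) (h : Aᵀ * J * A = J) (hB : Bᵀ * J * B = J) :
    (A⁻¹ * B)ᵀ * J * (A⁻¹ * B) = J := by
  have h1 : A⁻¹ᵀ * Aᵀ = 1 := by
    rw [← transpose_mul, mul_nonsing_inv _ hA, transpose_one]
  have hinv : A⁻¹ᵀ * J * A⁻¹ = J :=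
    calc A⁻¹ᵀ * J * A⁻¹ = A⁻¹ᵀ * (Aᵀ * J * A) * A⁻¹ := by rw [h]
      _ = (A⁻¹ᵀ * Aᵀ) * J * (A * A⁻¹) := by simp only [Matrix.mul_assoc]
      _ = J := by rw [h1, mul_nonsing_inv _ hA, Matrix.one_mul, Matrix.mul_one]
  rw [transpose_mul]
  calc Bᵀ * A⁻¹ᵀ * J * (A⁻¹ * B) = Bᵀ * (A⁻¹ᵀ * J * A⁻¹) * B := by simp only [Matrix.mul_assoc]
    _ = _ := by rw [hinv, hB]

theorem row_of_isometry_diagonal {N : ℕ} (d : Fin (N + 1) → F) (hd : d 0 ≠ 0)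
    {B : Matrix (Fin (N + 1)) (Fin (N + 1)) F} (h1 : Bᵀ * diagonal d * B = diagonal d)
    (h2 : ∀ i, B i 0 = (1 : Matrix (Fin (N + 1)) (Fin (N + 1)) F) i 0) (j : Fin (N + 1)) :
    B 0 j = (1 : Matrix (Fin (N + 1)) (Fin (N + 1)) F) 0 j := by
  have h3 := congrFun (congrFun h1 0) j
  rw [Matrix.mul_apply, Finset.sum_eq_single 0] at h3
  · rw [mul_diagonal, transpose_apply, h2 0, one_apply_eq, one_mul] at h3
    by_cases hj : j = 0
    · subst hj; exact h2 0
    · rw [diagonal_apply_ne' _ hj] at h3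
      rw [one_apply_ne' hj]
      exact (mul_eq_zero.1 h3).resolve_left hd
  · intro i _ hi
    rw [mul_diagonal, transpose_apply, h2 i, one_apply_ne hi]; simp
  · simp

theorem submatrix_isometry_diagonal {N : ℕ} (d : Fin (N + 1) → F)
    {B : Matrix (Fin (N + 1)) (Fin (N + 1)) F} (h1 : Bᵀ * diagonal d * B = diagonal d)
    (h3 : ∀ j, B 0 j = (1 : Matrix (Fin (N + 1)) (Fin (N + 1)) F) 0 j) :
    (B.submatrix Fin.succ Fin.succ)ᵀ * (diagonal fun i : Fin N => d i.succ) *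
      B.submatrix Fin.succ Fin.succ = diagonal fun i : Fin N => d i.succ := by
  ext i j
  have h4 := congrFun (congrFun h1 i.succ) j.succ
  rw [Matrix.mul_apply, Fin.sum_univ_succ] at h4
  simp only [mul_diagonal, transpose_apply, h3] at h4
  rw [one_apply_ne (Fin.succ_ne_zero _).symm, zero_mul, zero_mul, zero_add] at h4
  rw [Matrix.mul_apply]
  simp only [mul_diagonal, transpose_apply, submatrix_apply]
  rw [h4]
  simp [diagonal_apply, Fin.succ_inj]

variable [Fintype F]

/-- The finite set of matrices preserving the bilinear form with Gram matrix `J`. -/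
def isometries {N : Type} [Fintype N] (J : Matrix N N F) : Finset (Matrix N N F) :=
  Finset.univ.filter fun A => Aᵀ * J * A = J

theorem mem_isometries {N : Type} [Fintype N] {J A : Matrix N N F} :
    A ∈ isometries J ↔ Aᵀ * J * A = J := by simp [isometries]

theorem det_sq_of_mem_isometries {N : Type} [Fintype N] [DecidableEq N] {J A : Matrix N N F}
    (hJ : J.det ≠ 0)
    (hA : A ∈ isometries J) : A.det ^ 2 = 1 := by
  have := congrArg Matrix.det (mem_isometries.1 hA)
  rw [det_mul, det_mul, det_transpose] at this
  have h : J.det * (A.det ^ 2 - 1) = 0 := by linear_combination this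
  rcases mul_eq_zero.1 h with h | h
  · exact absurd h hJ
  · exact sub_eq_zero.1 h

theorem card_isometries_diagonal_succ {N : ℕ} (d : Fin (N + 1) → F) (hd : ∀ i, d i ≠ 0) :
    ((isometries (diagonal d)).card : ℤ) ≤
      diagCount d (d 0) * (isometries (diagonal fun i : Fin N => d i.succ)).card := by
  have hdet : (diagonal d).det ≠ 0 := by
    rw [det_diagonal]; exact Finset.prod_ne_zero_iff.2 fun i _ => hd i
  set S : Finset (Fin (N + 1) → F) := Finset.univ.filter fun x => ∑ i, d i * x i ^ 2 = d 0 with hS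
  have hcS : diagCount d (d 0) = S.card := by simp [diagCount, hS]
  have hmaps : ∀ A ∈ isometries (diagonal d), (fun i => A i 0) ∈ S := by
    intro A hA
    have := congrFun (congrFun (mem_isometries.1 hA) 0) 0
    simp only [hS, Finset.mem_filter, Finset.mem_univ, true_and]
    rw [Matrix.mul_apply, diagonal_apply_eq] at this
    rw [← this]
    refine Finset.sum_congr rfl fun i _ => ?_
    rw [mul_diagonal, transpose_apply]
    ring
  rw [hcS]
  have := Finset.card_le_mul_card_image_of_maps_to hmaps
    (isometries (diagonal fun i : Fin N => d i.succ)).card ?_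
  · rw [mul_comm]; exact_mod_cast this
  intro x hx
  rcases (Finset.filter (fun A => (fun i => A i 0) = x)
      (isometries (diagonal d))).eq_empty_or_nonempty
    with h | ⟨A₀, hA₀⟩
  · rw [h]; simp
  rw [Finset.mem_filter] at hA₀
  obtain ⟨hA₀, hx₀⟩ := hA₀
  have hu₀ : IsUnit A₀.det := by
    have := det_sq_of_mem_isometries hdet hA₀
    exact IsUnit.of_mul_eq_one A₀.det (by rw [← sq]; exact this)
  have hB : ∀ A ∈ (isometries (diagonal d)).filter fun A => (fun i => A i 0) = x,
      (A₀⁻¹ * A)ᵀ * diagonal d * (A₀⁻¹ * A) = diagonal d ∧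
      (∀ i, (A₀⁻¹ * A) i 0 = (1 : Matrix (Fin (N + 1)) (Fin (N + 1)) F) i 0) ∧
      (∀ j, (A₀⁻¹ * A) 0 j = (1 : Matrix (Fin (N + 1)) (Fin (N + 1)) F) 0 j) := by
    intro A hA
    rw [Finset.mem_filter] at hA
    have h1 : (A₀⁻¹ * A)ᵀ * diagonal d * (A₀⁻¹ * A) = diagonal d :=
      inv_mul_isometry hu₀ (mem_isometries.1 hA₀) (mem_isometries.1 hA.1)
    have h2 : ∀ i, (A₀⁻¹ * A) i 0 = (1 : Matrix (Fin (N + 1)) (Fin (N + 1)) F) i 0 := by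
      intro i
      rw [← nonsing_inv_mul _ hu₀, Matrix.mul_apply, Matrix.mul_apply]
      refine Finset.sum_congr rfl fun k _ => ?_
      have : A k 0 = A₀ k 0 := congrFun (hA.2.trans hx₀.symm) k
      rw [this]
    exact ⟨h1, h2, row_of_isometry_diagonal d (hd 0) h1 h2⟩
  refine Finset.card_le_card_of_injOn (fun A => (A₀⁻¹ * A).submatrix Fin.succ Fin.succ) ?_ ?_
  · intro A hA
    obtain ⟨h1, h2, h3⟩ := hB A hA
    exact mem_isometries.2 (submatrix_isometry_diagonal d h1 h3)
  · intro A hA A' hA' hAA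
    obtain ⟨-, h2, h3⟩ := hB A hA
    obtain ⟨-, h2', h3'⟩ := hB A' hA'
    have : A₀⁻¹ * A = A₀⁻¹ * A' := by
      ext i j
      refine Fin.cases ?_ (fun i => ?_) i
      · rw [h3, h3']
      · refine Fin.cases ?_ (fun j => ?_) j
        · rw [h2, h2']
        · exact congrFun (congrFun hAA i) j
    have h := congrArg (A₀ * ·) this
    simpa only [mul_nonsing_inv_cancel_left _ _ hu₀] using h

theorem card_isometries_diagonal_le (hF : ringChar F ≠ 2) (m : ℕ) (d : Fin (2 * (m + 1)) → F)
    (hd : ∀ i, d i ≠ 0) :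
    ((isometries (diagonal d)).card : ℤ) ≤ 2 * ((Fintype.card F : ℤ) ^ (m + 1) -
      quadraticChar F ((-1) ^ (m + 1) * ∏ i, d i)) *
      ∏ i ∈ Finset.range m, (Fintype.card F : ℤ) ^ (2 * (i + 1)) *
        ((Fintype.card F : ℤ) ^ (2 * (i + 1)) - 1) := by
  have hq : (0 : ℤ) < Fintype.card F := by exact_mod_cast Fintype.card_pos
  have hq1 : (1 : ℤ) ≤ Fintype.card F := hq
  have step : ∀ (m : ℕ) (d : Fin (2 * (m + 1)) → F), (∀ i, d i ≠ 0) →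
      ((isometries (diagonal d)).card : ℤ) ≤
        (Fintype.card F : ℤ) ^ m * ((Fintype.card F : ℤ) ^ (m + 1) -
          quadraticChar F ((-1) ^ (m + 1) * ∏ i, d i)) *
        ((Fintype.card F : ℤ) ^ m * ((Fintype.card F : ℤ) ^ m +
          quadraticChar F ((-1) ^ m * ∏ i : Fin (2 * m), d i.succ.succ)) *
        (isometries (diagonal fun i : Fin (2 * m) => d i.succ.succ)).card) := by
    intro m d hd
    have h1 := card_isometries_diagonal_succ (N := 2 * m + 1) d hd
    have h2 := card_isometries_diagonal_succ (N := 2 * m) (fun i => d i.succ) fun i => hd _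
    have h3 := diagCount_even hF (m + 1) d hd (hd 0)
    have h4 := diagCount_odd hF m (fun i => d i.succ) (fun i => hd _) (d (Fin.succ 0))
    rw [Fin.prod_univ_succ, show (-1) ^ m * (d (Fin.succ 0) * (d (Fin.succ 0) *
      ∏ i : Fin (2 * m), d i.succ.succ)) = (d (Fin.succ 0)) ^ 2 * ((-1) ^ m *
      ∏ i : Fin (2 * m), d i.succ.succ) by ring, map_mul (quadraticChar F) (_ ^ 2),
      quadraticChar_sq_one' (hd _), one_mul] at h4
    have h5 : diagCount d (d 0) = (Fintype.card F : ℤ) ^ m * ((Fintype.card F : ℤ) ^ (m + 1) -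
          quadraticChar F ((-1) ^ (m + 1) * ∏ i, d i)) := by
      apply mul_left_cancel₀ hq.ne'
      rw [show d 0 = d 0 from rfl] at h3
      refine h3.trans ?_
      ring
    have h6 : 0 ≤ diagCount d (d 0) := Finset.sum_nonneg fun x _ => by split_ifs <;> simp
    rw [← h5]
    refine h1.trans (mul_le_mul_of_nonneg_left ?_ h6)
    refine h2.trans (le_of_eq ?_)
    rw [h4]
    ring
  induction m with
  | zero =>
    refine (step 0 d hd).trans (le_of_eq ?_)
    have : (isometries (diagonal fun i : Fin (2 * 0) => d i.succ.succ)).card = 1 := by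
      rw [Finset.card_eq_one]
      refine ⟨1, Finset.eq_singleton_iff_unique_mem.2 ⟨mem_isometries.2 ?_, fun A _ => ?_⟩⟩ <;>
      · ext i; exact absurd i.2 (by simp)
    rw [this]
    simp
    ring
  | succ m ih =>
    refine (step (m + 1) d hd).trans ?_
    have h1 := ih (fun i => d i.succ.succ) fun i => hd _
    set e := quadraticChar F ((-1) ^ (m + 1) * ∏ i : Fin (2 * (m + 1)), d i.succ.succ) with he
    set e' := quadraticChar F ((-1) ^ (m + 1 + 1) * ∏ i, d i) with he'
    have hne : ((-1) ^ (m + 1) * ∏ i : Fin (2 * (m + 1)), d i.succ.succ) ≠ 0 :=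
      mul_ne_zero (by simp) (Finset.prod_ne_zero_iff.2 fun i _ => hd _)
    have hne' : ((-1) ^ (m + 1 + 1) * ∏ i, d i) ≠ 0 :=
      mul_ne_zero (by simp) (Finset.prod_ne_zero_iff.2 fun i _ => hd _)
    have hee : e ^ 2 = 1 := quadraticChar_sq_one hne
    have hee' : e' ^ 2 = 1 := quadraticChar_sq_one hne'
    have hb : -1 ≤ e ∧ e ≤ 1 := abs_le.1 (by rw [← sq_le_one_iff_abs_le_one]; exact hee.le)
    have hb' : -1 ≤ e' ∧ e' ≤ 1 := abs_le.1 (by rw [← sq_le_one_iff_abs_le_one]; exact hee'.le)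
    have hp1 : (1 : ℤ) ≤ (Fintype.card F : ℤ) ^ (m + 1) := one_le_pow₀ hq1
    have hp2 : (1 : ℤ) ≤ (Fintype.card F : ℤ) ^ (m + 1 + 1) := one_le_pow₀ hq1
    have hn1 : 0 ≤ (Fintype.card F : ℤ) ^ (m + 1 + 1) - e' := by linarith
    have hn2 : 0 ≤ (Fintype.card F : ℤ) ^ (m + 1) + e := by linarith
    calc _ ≤ (Fintype.card F : ℤ) ^ (m + 1) * ((Fintype.card F : ℤ) ^ (m + 1 + 1) - e') *
        ((Fintype.card F : ℤ) ^ (m + 1) * ((Fintype.card F : ℤ) ^ (m + 1) + e) *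
        (2 * ((Fintype.card F : ℤ) ^ (m + 1) - e) *
      ∏ i ∈ Finset.range m, (Fintype.card F : ℤ) ^ (2 * (i + 1)) *
        ((Fintype.card F : ℤ) ^ (2 * (i + 1)) - 1))) := by gcongr
      _ = _ := by
        rw [Finset.prod_range_succ]
        generalize (∏ i ∈ Finset.range m, (Fintype.card F : ℤ) ^ (2 * (i + 1)) *
          ((Fintype.card F : ℤ) ^ (2 * (i + 1)) - 1)) = P
        generalize (Fintype.card F : ℤ) = x
        linear_combination (-2) * x ^ (2 * (m + 1)) * (x ^ (m + 2) - e') * P * hee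

end OrthogonalOrder

section SimilitudeOrder
variable {F : Type} [Field F]

theorem exists_diagonalization (h2 : (2 : F) ≠ 0) {N : Type} [Fintype N] [DecidableEq N]
    (J : Matrix N N F) (hJ : IsUnit J) (hs : Jᵀ = J) :
    ∃ (d : Fin (Fintype.card N) → F) (P : Matrix N (Fin (Fintype.card N)) F)
      (Q : Matrix (Fin (Fintype.card N)) N F), P * Q = 1 ∧ Q * P = 1 ∧
      Pᵀ * J * P = diagonal d ∧ ∀ i, d i ≠ 0 := by
  have : Invertible (2 : F) := invertibleOfNonzero h2
  have hsym : LinearMap.IsSymm (Matrix.toBilin' J) := by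
    refine ⟨fun x y => ?_⟩
    simp only [RingHom.id_apply, Matrix.toBilin'_apply']
    rw [dotProduct_mulVec, ← mulVec_transpose, hs, dotProduct_comm]
  obtain ⟨v, hv⟩ := LinearMap.BilinForm.exists_orthogonal_basis hsym
  set w := v.reindex (finCongr (Module.finrank_fintype_fun_eq_card (η := N) F)) with hw
  have hort : ∀ i j, i ≠ j → Matrix.toBilin' J (w i) (w j) = 0 := by
    intro i j hij
    have := hv (i := (finCongr (Module.finrank_fintype_fun_eq_card (η := N) F)).symm i)
      (j := (finCongr (Module.finrank_fintype_fun_eq_card (η := N) F)).symm j)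
      (fun h => hij ((Equiv.injective _) h))
    simpa [hw] using this
  set P := (Pi.basisFun F N).toMatrix w with hP
  set Q := w.toMatrix (Pi.basisFun F N) with hQ
  have hPQ : P * Q = 1 := Module.Basis.toMatrix_mul_toMatrix_flip _ _
  have hQP : Q * P = 1 := Module.Basis.toMatrix_mul_toMatrix_flip _ _
  have hG : Pᵀ * J * P = diagonal fun i => Matrix.toBilin' J (w i) (w i) := by
    ext i j
    have : (Pᵀ * J * P) i j = Matrix.toBilin' J (w i) (w j) := by
      rw [Matrix.toBilin'_apply', dotProduct_mulVec]
      rfl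
    rw [this]
    by_cases hij : i = j
    · subst hij; simp
    · rw [diagonal_apply_ne _ hij, hort i j hij]
  refine ⟨_, P, Q, hPQ, hQP, hG, ?_⟩
  obtain ⟨K, hK, -⟩ := isUnit_iff_exists.1 hJ
  have hinv : (Pᵀ * J * P) * (Q * K * Qᵀ) = 1 := by
    have h1 : Pᵀ * Qᵀ = 1 := by rw [← transpose_mul, hQP, transpose_one]
    calc (Pᵀ * J * P) * (Q * K * Qᵀ) = Pᵀ * J * (P * Q) * K * Qᵀ := by
          simp only [Matrix.mul_assoc]
      _ = Pᵀ * (J * K) * Qᵀ := by rw [hPQ, Matrix.mul_one]; simp only [Matrix.mul_assoc]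
      _ = 1 := by rw [hK, Matrix.mul_one, h1]
  have hdet : (Pᵀ * J * P).det ≠ 0 := by
    intro h
    have := congrArg Matrix.det hinv
    rw [det_mul, h, zero_mul, det_one] at this
    exact zero_ne_one this
  rw [hG, det_diagonal] at hdet
  exact fun i => Finset.prod_ne_zero_iff.1 hdet i (Finset.mem_univ i)

theorem conj_isometry {N M : Type} [Fintype N] [DecidableEq N] [Fintype M] [DecidableEq M]
    {J : Matrix N N F} {D : Matrix M M F} {P : Matrix N M F} {Q : Matrix M N F} (hPQ : P * Q = 1)
    (hD : Pᵀ * J * P = D) {A : Matrix N N F} (hA : Aᵀ * J * A = J) :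
    (Q * A * P)ᵀ * D * (Q * A * P) = D := by
  have h1 : Qᵀ * Pᵀ = 1 := by rw [← transpose_mul, hPQ, transpose_one]
  rw [← hD, transpose_mul, transpose_mul]
  calc Pᵀ * (Aᵀ * Qᵀ) * (Pᵀ * J * P) * (Q * A * P)
      = Pᵀ * (Aᵀ * (Qᵀ * Pᵀ) * J * (P * Q) * A) * P := by simp only [Matrix.mul_assoc]
    _ = Pᵀ * J * P := by rw [h1, hPQ, Matrix.mul_one, Matrix.mul_one, hA]

theorem card_isometries_le_of_congr [Fintype F] {N M : Type} [Fintype N] [DecidableEq N] [Fintype M]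
    [DecidableEq M]
    {J : Matrix N N F} {D : Matrix M M F} {P : Matrix N M F} {Q : Matrix M N F} (hPQ : P * Q = 1)
    (hD : Pᵀ * J * P = D) : (isometries J).card ≤ (isometries D).card := by
  refine Finset.card_le_card_of_injOn (fun A => Q * A * P) ?_ ?_
  · intro A hA
    exact mem_isometries.2 (conj_isometry hPQ hD (mem_isometries.1 hA))
  · intro A _ B _ hAB
    have h := congrArg (fun X => P * X * Q) hAB
    have e : ∀ X : Matrix N N F, P * (Q * X * P) * Q = X := by
      intro X
      calc P * (Q * X * P) * Q = (P * Q) * X * (P * Q) := by simp only [Matrix.mul_assoc]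
        _ = X := by rw [hPQ, Matrix.mul_one, Matrix.one_mul]
    simpa only [e] using h

/-- Some isometry has determinant `-1`. -/
theorem exists_isometry_det_neg_one (h2 : (2 : F) ≠ 0) {N : Type} [Fintype N] [DecidableEq N]
    [Nonempty N]
    (J : Matrix N N F) (hJ : IsUnit J) (hs : Jᵀ = J) :
    ∃ A : Matrix N N F, Aᵀ * J * A = J ∧ A.det = -1 := by
  obtain ⟨d, P, Q, hPQ, hQP, hD, hd⟩ := exists_diagonalization h2 J hJ hs
  set i0 : Fin (Fintype.card N) := ⟨0, Fintype.card_pos⟩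
  set E : Matrix (Fin (Fintype.card N)) (Fin (Fintype.card N)) F :=
    diagonal fun i => if i = i0 then -1 else 1 with hE
  have hEi : Eᵀ * diagonal d * E = diagonal d := by
    rw [hE, diagonal_transpose, diagonal_mul_diagonal, diagonal_mul_diagonal]
    congr 1
    ext i
    split_ifs <;> simp
  have hDJ : Qᵀ * diagonal d * Q = J := by
    have h1 : Qᵀ * Pᵀ = 1 := by rw [← transpose_mul, hPQ, transpose_one]
    rw [← hD]
    calc Qᵀ * (Pᵀ * J * P) * Q = (Qᵀ * Pᵀ) * J * (P * Q) := by simp only [Matrix.mul_assoc]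
      _ = J := by rw [h1, hPQ, Matrix.mul_one, Matrix.one_mul]
  refine ⟨P * E * Q, conj_isometry hQP hDJ hEi, ?_⟩
  rw [Matrix.det_conj_of_mul_eq_one hPQ hQP, hE, det_diagonal, Finset.prod_ite_eq']
  simp

theorem card_isometries_le [Fintype F] (hF : ringChar F ≠ 2) (m : ℕ)
    {N : Type} [Fintype N] [DecidableEq N]
    (hN : Fintype.card N = 2 * (m + 1)) (J : Matrix N N F) (hJ : IsUnit J) (hs : Jᵀ = J) :
    ((isometries J).card : ℤ) ≤ 2 * ((Fintype.card F : ℤ) ^ (m + 1) + 1) *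
      ∏ i ∈ Finset.range m, (Fintype.card F : ℤ) ^ (2 * (i + 1)) *
        ((Fintype.card F : ℤ) ^ (2 * (i + 1)) - 1) := by
  obtain ⟨d, P, Q, hPQ, hQP, hD, hd⟩ :=
    exists_diagonalization (Ring.two_ne_zero hF) J hJ hs
  have h1 := card_isometries_le_of_congr hPQ hD
  generalize Fintype.card N = k at *
  subst hN
  have h2 := card_isometries_diagonal_le hF m d hd
  have hq : (1 : ℤ) ≤ Fintype.card F := by exact_mod_cast Fintype.card_pos (α := F)
  refine (Int.ofNat_le.2 h1).trans (h2.trans ?_)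
  refine mul_le_mul_of_nonneg_right ?_ (Finset.prod_nonneg fun i _ => ?_)
  · have hne : (-1 : F) ^ (m + 1) * ∏ i, d i ≠ 0 :=
      mul_ne_zero (by simp) (Finset.prod_ne_zero_iff.2 fun i _ => hd _)
    rcases quadraticChar_dichotomy hne with h | h <;> rw [h] <;> linarith
  · have : (1 : ℤ) ≤ (Fintype.card F : ℤ) ^ (2 * (i + 1)) := one_le_pow₀ hq
    exact mul_nonneg (by linarith) (by linarith)

theorem card_connSimilitudeGroup_le [Fintype F] {N : Type} [Fintype N] [DecidableEq N]
    (h2 : (2 : F) ≠ 0)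
    [Nonempty N]
    (J : Matrix N N F) (hJ : IsUnit J) (hs : Jᵀ = J) (m : ℕ) :
    2 * Fintype.card (connSimilitudeGroup J m) ≤ (Fintype.card F - 1) * (isometries J).card := by
  obtain ⟨E, hE, hEdet⟩ := exists_isometry_det_neg_one h2 J hJ hs
  set S1 := (isometries J).filter fun A => A.det = 1
  set S2 := (isometries J).filter fun A => ¬ A.det = 1
  have hJ0 : ∀ c d : F, c • J = d • J → c = d := by
    intro c d hcd
    obtain ⟨i⟩ := ‹Nonempty N›
    obtain ⟨K, hK, -⟩ := isUnit_iff_exists.1 hJ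
    have h : (c • J) * K = (d • J) * K := by rw [hcd]
    rw [Matrix.smul_mul, Matrix.smul_mul, hK] at h
    simpa using congrFun (congrFun h i) i
  have h12 : S1.card ≤ S2.card := by
    refine Finset.card_le_card_of_injOn (fun A => E * A) ?_ ?_
    · intro A hA
      obtain ⟨hA1, hA2⟩ := Finset.mem_filter.1 hA
      refine Finset.mem_filter.2 ⟨mem_isometries.2 ?_, ?_⟩
      · have hA1 := mem_isometries.1 hA1
        calc (E * A)ᵀ * J * (E * A) = Aᵀ * (Eᵀ * J * E) * A := by
              rw [transpose_mul]; simp only [Matrix.mul_assoc]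
          _ = J := by rw [hE, hA1]
      · rw [det_mul, hEdet, hA2, mul_one]
        intro h
        apply h2
        linear_combination -h
    · intro A _ B _ hAB
      have hu : IsUnit E := (Matrix.isUnit_iff_isUnit_det _).2 (by rw [hEdet]; simp)
      exact hu.mul_left_cancel hAB
  have h3 : S1.card + S2.card = (isometries J).card :=
    Finset.card_filter_add_card_filter_not _
  have hfib : ∀ c : Fˣ, (Finset.univ.filter fun g : connSimilitudeGroup J m =>
      (matOf g)ᵀ * J * matOf g = (c : F) • J).card ≤ S1.card := by
    intro c
    rcases Finset.eq_empty_or_nonempty (Finset.univ.filter fun g : connSimilitudeGroup J m =>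
      (matOf g)ᵀ * J * matOf g = (c : F) • J) with h | ⟨g0, hg0⟩
    · rw [h]; simp
    · have hg0 := (Finset.mem_filter.1 hg0).2
      have hdet : ∀ g : connSimilitudeGroup J m, (matOf g)ᵀ * J * matOf g = (c : F) • J →
          (matOf g).det = (c : F) ^ m := by
        intro g hg
        obtain ⟨d, hd1, hd2⟩ := g.2
        have : (c : F) = d := hJ0 _ _ (hg.symm.trans hd1)
        rw [this]; exact hd2
      refine Finset.card_le_card_of_injOn (fun g => matOf (g0⁻¹ * g)) ?_ ?_
      · intro g hg
        have hg := (Finset.mem_filter.1 hg).2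
        have h1 := sim_mul (J := J) ((g0⁻¹ : connSimilitudeGroup J m) : GL N F) g c⁻¹ c
          (sim_inv _ _ hg0) hg
        refine Finset.mem_filter.2 ⟨mem_isometries.2 ?_, ?_⟩
        · rwa [inv_mul_cancel, Units.val_one, one_smul] at h1
        · have e : matOf g0 * matOf (g0⁻¹ * g) = matOf g := by
            show ((g0 * (g0⁻¹ * g) : connSimilitudeGroup J m) : GL N F).val = _
            rw [mul_inv_cancel_left]; rfl
          have e := congrArg Matrix.det e
          rw [det_mul, hdet g0 hg0, hdet g hg] at e
          exact mul_left_cancel₀ (pow_ne_zero m c.ne_zero) (by rw [e, mul_one])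
      · intro g _ g' _ h
        have : g0⁻¹ * g = g0⁻¹ * g' := Subtype.ext (Units.ext h)
        exact mul_left_cancel this
  have htot : Fintype.card (connSimilitudeGroup J m) ≤ (Fintype.card F - 1) * S1.card := by
    have hc := Finset.card_eq_sum_card_fiberwise
      (s := (Finset.univ : Finset (connSimilitudeGroup J m))) (t := (Finset.univ : Finset Fˣ))
      (f := fun g => g.2.choose) (fun _ _ => Finset.mem_coe.2 (Finset.mem_univ _))
    rw [← Finset.card_univ, hc, ← Fintype.card_units, ← smul_eq_mul, ← Finset.card_univ]
    refine Finset.sum_le_card_nsmul _ _ _ fun c _ => ?_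
    refine (Finset.card_le_card ?_).trans (hfib c)
    intro g hg
    have := (Finset.mem_filter.1 hg).2
    refine Finset.mem_filter.2 ⟨Finset.mem_univ _, ?_⟩
    rw [← this]
    exact g.2.choose_spec.1
  calc 2 * Fintype.card (connSimilitudeGroup J m)
      ≤ 2 * ((Fintype.card F - 1) * S1.card) := Nat.mul_le_mul_left 2 htot
    _ = (Fintype.card F - 1) * (S1.card + S1.card) := by ring
    _ ≤ _ := by rw [← h3]; exact Nat.mul_le_mul_left _ (by omega)

end SimilitudeOrder

/-- A nondegenerate symmetric bilinear space with a self-adjoint operator `t` commuting with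
an anti-self-adjoint operator `y`. -/
structure FormSpace (K : Type) [Field K] where
  V : Type
  [grp : AddCommGroup V]
  [mod : Module K V]
  [fin : FiniteDimensional K V]
  J : V →ₗ[K] V →ₗ[K] K
  t : Module.End K V
  y : Module.End K V
  symm : ∀ v w, J v w = J w v
  nondeg : ∀ v, (∀ w, J v w = 0) → v = 0
  t_adj : ∀ v w, J (t v) w = J v (t w)
  y_adj : ∀ v w, J (y v) w = -J v (y w)
  comm : ∀ v, t (y v) = y (t v)

attribute [instance] FormSpace.grp FormSpace.mod FormSpace.fin

namespace FormSpace

variable {K : Type} [Field K]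

/-- Isometries intertwining the operators. -/
structure Iso (X Y : FormSpace K) where
  e : X.V ≃ₗ[K] Y.V
  map_J : ∀ v w, Y.J (e v) (e w) = X.J v w
  map_t : ∀ v, e (X.t v) = Y.t (e v)
  map_y : ∀ v, e (X.y v) = Y.y (e v)

/-- The identity isomorphism. -/
def Iso.refl (X : FormSpace K) : Iso X X :=
  ⟨LinearEquiv.refl K X.V, fun _ _ => rfl, fun _ => rfl, fun _ => rfl⟩

/-- The inverse isomorphism. -/
def Iso.symm {X Y : FormSpace K} (f : Iso X Y) : Iso Y X where
  e := f.e.symm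
  map_J v w := by rw [← f.map_J, f.e.apply_symm_apply, f.e.apply_symm_apply]
  map_t v := by rw [f.e.symm_apply_eq, f.map_t, f.e.apply_symm_apply]
  map_y v := by rw [f.e.symm_apply_eq, f.map_y, f.e.apply_symm_apply]

/-- The composite isomorphism. -/
def Iso.trans {X Y Z : FormSpace K} (f : Iso X Y) (g : Iso Y Z) : Iso X Z where
  e := f.e.trans g.e
  map_J v w := by simp [g.map_J, f.map_J]
  map_t v := by simp [g.map_t, f.map_t]
  map_y v := by simp [g.map_y, f.map_y]

instance isoSetoid (K : Type) [Field K] : Setoid (FormSpace K) where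
  r X Y := Nonempty (Iso X Y)
  iseqv := ⟨fun X => ⟨Iso.refl X⟩, fun ⟨f⟩ => ⟨f.symm⟩, fun ⟨f⟩ ⟨g⟩ => ⟨f.trans g⟩⟩

/-- Isomorphism classes. -/
def Cls (K : Type) [Field K] := Quotient (isoSetoid K)

/-- The class of a space. -/
def cls (X : FormSpace K) : Cls K := Quotient.mk _ X

theorem cls_eq {X Y : FormSpace K} (f : Iso X Y) : cls X = cls Y := Quotient.sound ⟨f⟩

theorem iso_of_cls_eq {X Y : FormSpace K} (h : cls X = cls Y) : Nonempty (Iso X Y) :=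
  Quotient.exact h

/-- The classes of the spaces with a given property. -/
def classes (P : FormSpace K → Prop) : Set (Cls K) := cls '' {X | P X}

theorem mem_classes {P : FormSpace K → Prop} {X : FormSpace K} (h : P X) : cls X ∈ classes P :=
  ⟨X, h, rfl⟩

theorem classes_mono {P P' : FormSpace K → Prop} (h : ∀ X, P X → P' X) :
    classes P ⊆ classes P' := Set.image_mono h

/-- Orthogonal sum. -/
abbrev sum (X Y : FormSpace K) : FormSpace K where
  V := X.V × Y.V
  J := X.J.compl₁₂ (LinearMap.fst K X.V Y.V) (LinearMap.fst K X.V Y.V) +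
    Y.J.compl₁₂ (LinearMap.snd K X.V Y.V) (LinearMap.snd K X.V Y.V)
  t := X.t.prodMap Y.t
  y := X.y.prodMap Y.y
  symm v w := by simp [X.symm v.1, Y.symm v.2]
  nondeg v h := by
    refine Prod.ext (X.nondeg _ fun w => ?_) (Y.nondeg _ fun w => ?_)
    · simpa using h (w, 0)
    · simpa using h (0, w)
  t_adj v w := by simp [X.t_adj, Y.t_adj]
  y_adj v w := by simp [X.y_adj, Y.y_adj, add_comm]
  comm v := by simp [X.comm, Y.comm]

theorem sum_J (X Y : FormSpace K) (v w : X.V × Y.V) :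
    (sum X Y).J v w = X.J v.1 w.1 + Y.J v.2 w.2 := rfl

/-- Functoriality of the orthogonal sum. -/
def Iso.sum {X Y X' Y' : FormSpace K} (f : Iso X X') (g : Iso Y Y') :
    Iso (X.sum Y) (X'.sum Y') where
  e := f.e.prodCongr g.e
  map_J v w := by
    change X'.J (f.e v.1) (f.e w.1) + Y'.J (g.e v.2) (g.e w.2) = X.J v.1 w.1 + Y.J v.2 w.2
    rw [f.map_J, g.map_J]
  map_t v := Prod.ext (f.map_t v.1) (g.map_t v.2)
  map_y v := Prod.ext (f.map_y v.1) (g.map_y v.2)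

instance : Add (Cls K) :=
  ⟨Quotient.map₂ sum fun _ _ ⟨f⟩ _ _ ⟨g⟩ => ⟨f.sum g⟩⟩

theorem cls_sum (X Y : FormSpace K) : cls (X.sum Y) = cls X + cls Y := rfl

/-- Nondegenerate subspaces stable under both operators. -/
structure IsBlock (X : FormSpace K) (C : Submodule K X.V) : Prop where
  t_mem : ∀ v ∈ C, X.t v ∈ C
  y_mem : ∀ v ∈ C, X.y v ∈ C
  nondeg : ∀ v ∈ C, (∀ w ∈ C, X.J v w = 0) → v = 0

/-- The space structure on a block. -/
abbrev sub (X : FormSpace K) (C : Submodule K X.V) (h : X.IsBlock C) : FormSpace K where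
  V := C
  J := X.J.compl₁₂ C.subtype C.subtype
  t := X.t.restrict h.t_mem
  y := X.y.restrict h.y_mem
  symm v w := X.symm v w
  nondeg v hv := Subtype.ext (h.nondeg v v.2 fun w hw => hv ⟨w, hw⟩)
  t_adj v w := X.t_adj v w
  y_adj v w := X.y_adj v w
  comm v := Subtype.ext (X.comm v)

/-- The inclusion of a block. -/
def incl (X : FormSpace K) (C : Submodule K X.V) (h : X.IsBlock C) : (X.sub C h).V →ₗ[K] X.V :=
  C.subtype

theorem incl_injective (X : FormSpace K) (C : Submodule K X.V) (h : X.IsBlock C) :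
    Function.Injective (X.incl C h) := C.subtype_injective

theorem incl_mem (X : FormSpace K) (C : Submodule K X.V) (h : X.IsBlock C) (v : (X.sub C h).V) :
    X.incl C h v ∈ C := v.2

theorem exists_incl (X : FormSpace K) (C : Submodule K X.V) (h : X.IsBlock C) {v : X.V}
    (hv : v ∈ C) : ∃ w, X.incl C h w = v := ⟨⟨v, hv⟩, rfl⟩

theorem incl_t (X : FormSpace K) (C : Submodule K X.V) (h : X.IsBlock C) (v : (X.sub C h).V) :
    X.incl C h ((X.sub C h).t v) = X.t (X.incl C h v) := rfl

theorem incl_y (X : FormSpace K) (C : Submodule K X.V) (h : X.IsBlock C) (v : (X.sub C h).V) :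
    X.incl C h ((X.sub C h).y v) = X.y (X.incl C h v) := rfl

theorem incl_J (X : FormSpace K) (C : Submodule K X.V) (h : X.IsBlock C) (v w : (X.sub C h).V) :
    X.J (X.incl C h v) (X.incl C h w) = (X.sub C h).J v w := rfl

/-- The orthogonal complement. -/
def perp (X : FormSpace K) (C : Submodule K X.V) : Submodule K X.V where
  carrier := {v | ∀ c ∈ C, X.J v c = 0}
  add_mem' ha hb c hc := by rw [map_add, LinearMap.add_apply, ha c hc, hb c hc, add_zero]
  zero_mem' c _ := by simp
  smul_mem' r v hv c hc := by rw [map_smul, LinearMap.smul_apply, hv c hc, smul_zero]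

theorem isCompl_perp (X : FormSpace K) {C : Submodule K X.V} (h : X.IsBlock C) :
    IsCompl C (X.perp C) := by
  have hrefl : LinearMap.BilinForm.IsRefl X.J := fun v w hvw => by rw [X.symm, hvw]
  have hnd : (LinearMap.BilinForm.restrict X.J C).Nondegenerate := by
    refine ⟨fun v hv => ?_, fun v hv => ?_⟩
    · exact Subtype.ext (h.nondeg v v.2 fun w hw => hv ⟨w, hw⟩)
    · exact Subtype.ext (h.nondeg v v.2 fun w hw => by rw [X.symm]; exact hv ⟨w, hw⟩)
  have := LinearMap.BilinForm.isCompl_orthogonal_of_restrict_nondegenerate hrefl hnd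
  convert this using 1
  ext v
  exact forall₂_congr fun c _ => by
    rw [X.symm]

theorem IsBlock.perp {X : FormSpace K} {C : Submodule K X.V} (h : X.IsBlock C) :
    X.IsBlock (X.perp C) where
  t_mem v hv c hc := by rw [X.t_adj]; exact hv _ (h.t_mem c hc)
  y_mem v hv c hc := by rw [X.y_adj, hv _ (h.y_mem c hc), neg_zero]
  nondeg v hv hw := by
    refine X.nondeg v fun w => ?_
    have : w ∈ C ⊔ X.perp C := by rw [(X.isCompl_perp h).sup_eq_top]; trivial
    obtain ⟨a, ha, b, hb, rfl⟩ := Submodule.mem_sup.1 this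
    rw [map_add, hv a ha, hw b hb, add_zero]

/-- A space is the orthogonal sum of a block and its complement. -/
def splitIso (X : FormSpace K) {C : Submodule K X.V} (h : X.IsBlock C) :
    Iso ((X.sub C h).sum (X.sub (X.perp C) h.perp)) X where
  e := Submodule.prodEquivOfIsCompl _ _ (X.isCompl_perp h)
  map_J v w := by
    obtain ⟨⟨a, ha⟩, ⟨b, hb⟩⟩ := v
    obtain ⟨⟨a', ha'⟩, ⟨b', hb'⟩⟩ := w
    have h1 : X.J b a' = 0 := hb a' ha'
    have h2 : X.J a b' = 0 := by rw [X.symm]; exact hb' a ha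
    change X.J (a + b) (a' + b') = X.J a a' + X.J b b'
    simp [h1, h2]
  map_t v := by
    change X.t v.1.1 + X.t v.2.1 = X.t (v.1.1 + v.2.1)
    rw [map_add]
  map_y v := by
    change X.y v.1.1 + X.y v.2.1 = X.y (v.1.1 + v.2.1)
    rw [map_add]

theorem cls_split (X : FormSpace K) {C : Submodule K X.V} (h : X.IsBlock C) :
    cls X = cls (X.sub C h) + cls (X.sub (X.perp C) h.perp) :=
  (cls_eq (X.splitIso h)).symm

/-- The dimension of a space. -/
def dim (X : FormSpace K) : ℕ := Module.finrank K X.V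

theorem Iso.dim_eq {X Y : FormSpace K} (f : Iso X Y) : X.dim = Y.dim := f.e.finrank_eq

theorem dim_sum (X Y : FormSpace K) : (X.sum Y).dim = X.dim + Y.dim := Module.finrank_prod

theorem dim_split (X : FormSpace K) {C : Submodule K X.V} (h : X.IsBlock C) :
    X.dim = (X.sub C h).dim + (X.sub (X.perp C) h.perp).dim := by
  rw [← dim_sum, (X.splitIso h).dim_eq]

open scoped Pointwise in
theorem encard_add_le (S T : Set (Cls K)) : (S + T).encard ≤ S.encard * T.encard := by
  rw [← Set.encard_prod, ← Set.add_image_prod]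
  exact Set.encard_image_le _ _

/-- Two cyclic presentations with the same Gram form have isomorphic images. -/
theorem cls_range_eq {X Y : FormSpace K} {M : Type} [AddCommGroup M] [Module K M]
    (p : M →ₗ[K] X.V) (r : M →ₗ[K] Y.V) (hX : X.IsBlock (LinearMap.range p))
    (hY : Y.IsBlock (LinearMap.range r)) (tM yM : M → M)
    (hpt : ∀ m, X.t (p m) = p (tM m)) (hpy : ∀ m, X.y (p m) = p (yM m))
    (hrt : ∀ m, Y.t (r m) = r (tM m)) (hry : ∀ m, Y.y (r m) = r (yM m))
    (hJ : ∀ a b, X.J (p a) (p b) = Y.J (r a) (r b)) :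
    cls (X.sub _ hX) = cls (Y.sub _ hY) := by
  have hker : LinearMap.ker p = LinearMap.ker r := by
    ext m
    constructor
    · intro hm
      refine hY.nondeg _ ⟨m, rfl⟩ ?_
      rintro _ ⟨b, rfl⟩
      rw [← hJ, LinearMap.mem_ker.1 hm]; simp
    · intro hm
      refine hX.nondeg _ ⟨m, rfl⟩ ?_
      rintro _ ⟨b, rfl⟩
      rw [hJ, LinearMap.mem_ker.1 hm]; simp
  let e : LinearMap.range p ≃ₗ[K] LinearMap.range r :=
    (p.quotKerEquivRange.symm.trans (Submodule.quotEquivOfEq _ _ hker)).trans r.quotKerEquivRange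
  have he : ∀ m, e ⟨p m, m, rfl⟩ = ⟨r m, m, rfl⟩ := by
    intro m
    have : p.quotKerEquivRange.symm ⟨p m, m, rfl⟩ = Submodule.Quotient.mk m := by
      rw [LinearEquiv.symm_apply_eq]; rfl
    change r.quotKerEquivRange (Submodule.quotEquivOfEq _ _ hker
      (p.quotKerEquivRange.symm ⟨p m, m, rfl⟩)) = _
    rw [this]; rfl
  refine cls_eq ⟨e, ?_, ?_, ?_⟩
  · rintro ⟨_, a, rfl⟩ ⟨_, b, rfl⟩
    change Y.J (e ⟨p a, a, rfl⟩).1 (e ⟨p b, b, rfl⟩).1 = X.J (p a) (p b)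
    rw [he, he, hJ]
  · rintro ⟨_, a, rfl⟩
    have : (X.sub _ hX).t ⟨p a, a, rfl⟩ = ⟨p (tM a), tM a, rfl⟩ := Subtype.ext (hpt a)
    rw [this]
    refine Subtype.ext ?_
    change (e ⟨p (tM a), tM a, rfl⟩).1 = Y.t (e ⟨p a, a, rfl⟩).1
    rw [he, he, hrt]
  · rintro ⟨_, a, rfl⟩
    have : (X.sub _ hX).y ⟨p a, a, rfl⟩ = ⟨p (yM a), yM a, rfl⟩ := Subtype.ext (hpy a)
    rw [this]
    refine Subtype.ext ?_
    change (e ⟨p (yM a), yM a, rfl⟩).1 = Y.y (e ⟨p a, a, rfl⟩).1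
    rw [he, he, hry]

open Polynomial

theorem isBlock_range {X : FormSpace K} {M : Type} [AddCommGroup M] [Module K M]
    (p : M →ₗ[K] X.V) (tM yM : M → M)
    (hpt : ∀ m, X.t (p m) = p (tM m)) (hpy : ∀ m, X.y (p m) = p (yM m))
    (hnd : ∀ m, (∀ m', X.J (p m) (p m') = 0) → p m = 0) : X.IsBlock (LinearMap.range p) where
  t_mem := by rintro _ ⟨m, rfl⟩; exact ⟨_, (hpt m).symm⟩
  y_mem := by rintro _ ⟨m, rfl⟩; exact ⟨_, (hpy m).symm⟩
  nondeg := by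
    rintro _ ⟨m, rfl⟩ h
    exact hnd m fun m' => h _ ⟨m', rfl⟩

theorem J_aeval_t (X : FormSpace K) (e : K[X]) (v w : X.V) :
    X.J (aeval X.t e v) w = X.J v (aeval X.t e w) := by
  induction e using Polynomial.induction_on' generalizing v w with
  | add a b ha hb => simp [ha, hb]
  | monomial n a =>
    simp only [aeval_monomial, Module.End.mul_apply, Module.algebraMap_end_apply, map_smul,
      LinearMap.smul_apply]
    congr 1
    induction n generalizing v w with
    | zero => simp
    | succ n ih => 
      rw [pow_succ, Module.End.mul_apply, ih, X.t_adj, ← Module.End.mul_apply, ← pow_succ',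
        pow_succ]

theorem J_y_pow (X : FormSpace K) (n : ℕ) (v w : X.V) :
    X.J ((X.y ^ n) v) w = (-1) ^ n * X.J v ((X.y ^ n) w) := by
  induction n generalizing v w with
  | zero => simp
  | succ n ih =>
    have h1 : (X.y ^ (n + 1)) v = X.y ((X.y ^ n) v) := by rw [pow_succ', Module.End.mul_apply]
    have h2 : (X.y ^ (n + 1)) w = (X.y ^ n) (X.y w) := by rw [pow_succ, Module.End.mul_apply]
    rw [h1, h2, X.y_adj, ih]
    ring

theorem J_aeval_y (X : FormSpace K) (e : K[X]) (v w : X.V) :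
    X.J v (aeval X.y e w) = X.J (aeval X.y (e.comp (-Polynomial.X)) v) w := by
  induction e using Polynomial.induction_on' with
  | add a b ha hb => simp [ha, hb]
  | monomial n a =>
    rw [monomial_comp, map_mul, aeval_C, map_pow, map_neg, aeval_X]
    simp only [aeval_monomial, Module.End.mul_apply, Module.algebraMap_end_apply, map_smul,
      LinearMap.smul_apply]
    congr 1
    rw [neg_pow, Module.End.mul_apply]
    have : ((-1 : Module.End K X.V) ^ n) ((X.y ^ n) v) = (-1 : K) ^ n • (X.y ^ n) v := by
      rcases Nat.even_or_odd n with h | h <;> simp [h.neg_one_pow]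
    rw [this, map_smul, LinearMap.smul_apply, J_y_pow, smul_eq_mul, ← mul_assoc, ← mul_pow]
    simp

theorem commute_aeval_of_commute {A : Type} [Ring A] [Algebra K A] {a b : A} (h : Commute a b)
    (e : K[X]) : Commute a (aeval b e) := by
  induction e using Polynomial.induction_on' with
  | add p q hp hq => rw [map_add]; exact hp.add_right hq
  | monomial n c =>
    rw [aeval_monomial]
    exact Commute.mul_right (Algebra.commutes c a).symm (h.pow_right n)

theorem t_aeval_y (X : FormSpace K) (e : K[X]) (v : X.V) :
    X.t (aeval X.y e v) = aeval X.y e (X.t v) := by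
  have h0 : Commute X.t X.y := LinearMap.ext fun v => X.comm v
  exact congrArg (fun f => f v) (commute_aeval_of_commute h0 e).eq

theorem y_aeval_t (X : FormSpace K) (e : K[X]) (v : X.V) :
    X.y (aeval X.t e v) = aeval X.t e (X.y v) := by
  have h0 : Commute X.y X.t := LinearMap.ext fun v => (X.comm v).symm
  exact congrArg (fun f => f v) (commute_aeval_of_commute h0 e).eq

/-- The image of a polynomial ring with kernel generated by a monic polynomial. -/
theorem finrank_range_of_ker {V : Type} [AddCommGroup V] [Module K V]
    (f : K[X] →ₗ[K] V) {h : K[X]} (hf : ∀ e, f e = 0 ↔ h ∣ e) :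
    Module.finrank K (LinearMap.range f) = h.natDegree := by
  rw [← f.quotKerEquivRange.finrank_eq, ← finrank_quotient_span_eq_natDegree]
  have hker : LinearMap.ker f =
      LinearMap.ker (Ideal.Quotient.mkₐ K (Ideal.span {h})).toLinearMap := by
    ext e
    rw [LinearMap.mem_ker, hf, LinearMap.mem_ker, AlgHom.toLinearMap_apply,
      Ideal.Quotient.mkₐ_eq_mk, Ideal.Quotient.eq_zero_iff_mem, Ideal.mem_span_singleton]
  rw [hker]
  exact (LinearMap.quotKerEquivOfSurjective _ (Ideal.Quotient.mkₐ_surjective K _)).finrank_eq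

theorem finrank_range_coprod {V : Type} [AddCommGroup V] [Module K V] [FiniteDimensional K V]
    (f g : K[X] →ₗ[K] V) {h : K[X]} (hf : ∀ e, f e = 0 ↔ h ∣ e)
    (hg : ∀ e, g e = 0 ↔ h ∣ e) (hfg : ∀ a b, f a + g b = 0 → f a = 0) :
    Module.finrank K (LinearMap.range (f.coprod g)) = 2 * h.natDegree := by
  rw [LinearMap.range_coprod]
  have hd : LinearMap.range f ⊓ LinearMap.range g = ⊥ := by
    rw [← disjoint_iff, Submodule.disjoint_def]
    rintro _ ⟨a, rfl⟩ ⟨b, hb⟩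
    exact hfg a (-b) (by rw [map_neg, hb, add_neg_cancel])
  have := Submodule.finrank_sup_add_finrank_inf_eq (LinearMap.range f) (LinearMap.range g)
  rw [hd, finrank_bot, finrank_range_of_ker f hf, finrank_range_of_ker g hg] at this
  omega

/-- The map `e ↦ e(f) v`. -/
def orb {V : Type} [AddCommGroup V] [Module K V] (f : Module.End K V) (v : V) : K[X] →ₗ[K] V :=
  (LinearMap.applyₗ v).comp (aeval f).toLinearMap

theorem orb_apply {V : Type} [AddCommGroup V] [Module K V] (f : Module.End K V) (v : V) (e : K[X]) :
    orb f v e = aeval f e v := rfl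

theorem apply_orb {V : Type} [AddCommGroup V] [Module K V] (f : Module.End K V) (v : V) (e : K[X]) :
    f (orb f v e) = orb f v (Polynomial.X * e) := by
  rw [orb_apply, orb_apply, map_mul, aeval_X, Module.End.mul_apply]

theorem J_pow_pow (X : FormSpace K) (i j : ℕ) (v w : X.V) :
    X.J ((X.y ^ i) v) ((X.y ^ j) w) = (-1) ^ j * X.J ((X.y ^ (i + j)) v) w := by
  have h : (X.y ^ (i + j)) v = (X.y ^ j) ((X.y ^ i) v) := by
    rw [add_comm, pow_add, Module.End.mul_apply]
  rw [h, J_y_pow X j, ← mul_assoc, ← mul_pow]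
  simp

theorem J_y_pow_odd_self (h2 : (2 : K) ≠ 0) (X : FormSpace K) {i : ℕ} (hi : Odd i) (v : X.V) :
    X.J ((X.y ^ i) v) v = 0 := by
  have h := J_y_pow X i v v
  rw [hi.neg_one_pow, X.symm v, neg_one_mul] at h
  have : (2 : K) * X.J ((X.y ^ i) v) v = 0 := by linear_combination h
  exact (mul_eq_zero.1 this).resolve_left h2

theorem y_pow_eq_zero_of_le {X : FormSpace K} {k i : ℕ} (hk : X.y ^ k = 0) (h : k ≤ i) (v : X.V) :
    (X.y ^ i) v = 0 := by
  rw [pow_eq_zero_of_le h hk]; rfl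

section OddLevel

theorem exists_odd_generator (h2 : (2 : K) ≠ 0) (X : FormSpace K) (j : ℕ)
    (hy : X.y ^ (2 * j + 1) = 0) (hne : X.y ^ (2 * j) ≠ 0) :
    ∃ v, X.J ((X.y ^ (2 * j)) v) v ≠ 0 ∧ ∀ i < j, X.J ((X.y ^ (2 * i)) v) v = 0 := by
  have hs : ∀ v w, X.J ((X.y ^ (2 * j)) v) w = X.J ((X.y ^ (2 * j)) w) v := by
    intro v w
    rw [J_y_pow, X.symm v]; simp
  have h0 : ∃ v, X.J ((X.y ^ (2 * j)) v) v ≠ 0 := by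
    by_contra! hcon
    refine hne (LinearMap.ext fun v => X.nondeg _ fun w => ?_)
    have := hcon (v + w)
    rw [map_add, map_add, map_add, LinearMap.add_apply, LinearMap.add_apply, hcon v, hcon w,
      hs w v] at this
    have : (2 : K) * X.J ((X.y ^ (2 * j)) v) w = 0 := by linear_combination this
    exact (mul_eq_zero.1 this).resolve_left h2
  have key : ∀ m ≤ j, ∃ v, X.J ((X.y ^ (2 * j)) v) v ≠ 0 ∧
      ∀ i < j, j - m ≤ i → X.J ((X.y ^ (2 * i)) v) v = 0 := by
    intro m
    induction m with
    | zero => intro _; obtain ⟨v, hv⟩ := h0; exact ⟨v, hv, fun i h1 h3 => by omega⟩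
    | succ m ih =>
      intro hm
      obtain ⟨v, hv, hv'⟩ := ih (by omega)
      set u := X.J ((X.y ^ (2 * j)) v) v with hu
      set l := m + 1 with hl
      set c := -X.J ((X.y ^ (2 * (j - l))) v) v / (2 * u) with hc
      have hexp : ∀ i, X.J ((X.y ^ (2 * i)) (v + c • (X.y ^ (2 * l)) v)) (v + c • (X.y ^ (2 * l)) v)
          = X.J ((X.y ^ (2 * i)) v) v + 2 * c * X.J ((X.y ^ (2 * i + 2 * l)) v) v +
            c ^ 2 * X.J ((X.y ^ (2 * i + 2 * l + 2 * l)) v) v := by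
        intro i
        have e : (X.y ^ (2 * i)) ((X.y ^ (2 * l)) v) = (X.y ^ (2 * i + 2 * l)) v := by
          rw [pow_add, Module.End.mul_apply]
        simp only [map_add, map_smul, LinearMap.add_apply, LinearMap.smul_apply, smul_eq_mul, e,
          J_pow_pow, (even_two_mul l).neg_one_pow]
        ring
      refine ⟨v + c • (X.y ^ (2 * l)) v, ?_, fun i hi hi' => ?_⟩
      · rw [hexp, y_pow_eq_zero_of_le hy (i := 2 * j + 2 * l) (by omega),
          y_pow_eq_zero_of_le hy (i := 2 * j + 2 * l + 2 * l) (by omega)]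
        simpa using hv
      · rw [hexp, y_pow_eq_zero_of_le hy (i := 2 * i + 2 * l + 2 * l) (by omega)]
        rcases Nat.lt_or_ge i (j - m) with h | h
        · have h1 : i = j - l := by omega
          have h3 : 2 * i + 2 * l = 2 * j := by omega
          rw [h3, ← hu, h1, hc]
          simp only [map_zero, LinearMap.zero_apply, mul_zero, add_zero]
          field_simp
          ring
        · rw [hv' i hi h, y_pow_eq_zero_of_le hy (by omega)]
          simp
  obtain ⟨v, hv, hv'⟩ := key j le_rfl
  exact ⟨v, hv, fun i hi => hv' i hi (by omega)⟩

/-- A normalized generator of odd level `2 * j + 1` and discriminant `u`. -/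
def OddGen (X : FormSpace K) (j : ℕ) (u : K) (v : X.V) : Prop :=
  X.y ^ (2 * j + 1) = 0 ∧ ∀ i, X.J ((X.y ^ i) v) v = if i = 2 * j then u else 0

theorem OddGen.J_aeval {X : FormSpace K} {j : ℕ} {u : K} {v : X.V} (h : OddGen X j u v) (e : K[X]) :
    X.J (aeval X.y e v) v = u * e.coeff (2 * j) := by
  induction e using Polynomial.induction_on' with
  | add a b ha hb => simp [ha, hb, mul_add]
  | monomial n a =>
    rw [aeval_monomial, Module.End.mul_apply, Module.algebraMap_end_apply, map_smul,
      LinearMap.smul_apply, h.2, coeff_monomial, smul_eq_mul]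
    split_ifs <;> ring

theorem OddGen.J_orb {X : FormSpace K} {j : ℕ} {u : K} {v : X.V} (h : OddGen X j u v) (a b : K[X]) :
    X.J (orb X.y v a) (orb X.y v b) = u * (a * b.comp (-Polynomial.X)).coeff (2 * j) := by
  rw [orb_apply, orb_apply, J_aeval_y, ← Module.End.mul_apply, ← map_mul, h.J_aeval, mul_comm a]

theorem OddGen.orb_eq_zero {X : FormSpace K} {j : ℕ} {u : K} (hu : u ≠ 0) {v : X.V}
    (h : OddGen X j u v)
    (e : K[X]) : orb X.y v e = 0 ↔ (Polynomial.X : K[X]) ^ (2 * j + 1) ∣ e := by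
  constructor
  · intro he
    rw [X_pow_dvd_iff]
    intro d hd
    have := h.J_aeval (Polynomial.X ^ (2 * j - d) * e)
    rw [map_mul, Module.End.mul_apply, ← orb_apply X.y v e, he, map_zero, map_zero,
      LinearMap.zero_apply, coeff_X_pow_mul', if_pos (by omega),
      show 2 * j - (2 * j - d) = d by omega] at this
    exact (mul_eq_zero.1 this.symm).resolve_left hu
  · rintro ⟨e', rfl⟩
    rw [orb_apply, mul_comm, map_mul, map_pow, aeval_X, h.1, mul_zero]; rfl

theorem OddGen.isBlock {X : FormSpace K} {a : K} (ht : ∀ v, X.t v = a • v) {j : ℕ} {u : K}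
    (hu : u ≠ 0) {v : X.V} (h : OddGen X j u v) :
    X.IsBlock (LinearMap.range (orb X.y v)) := by
  refine isBlock_range _ (fun e => a • e) (fun e => Polynomial.X * e)
    (fun m => by rw [ht, map_smul]) (fun m => apply_orb _ _ _) fun m hm => ?_
  rw [h.orb_eq_zero hu, X_pow_dvd_iff]
  intro d hd
  have := hm ((-Polynomial.X) ^ (2 * j - d))
  rw [h.J_orb, pow_comp, neg_comp, X_comp, neg_neg, coeff_mul_X_pow', if_pos (by omega),
      show 2 * j - (2 * j - d) = d by omega] at this
  exact (mul_eq_zero.1 this).resolve_left hu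

theorem OddGen.finrank {X : FormSpace K} {j : ℕ} {u : K}
    (hu : u ≠ 0) {v : X.V} (h : OddGen X j u v) :
    Module.finrank K (LinearMap.range (orb X.y v)) = 2 * j + 1 := by
  rw [finrank_range_of_ker _ (h.orb_eq_zero hu), natDegree_X_pow]

theorem OddGen.cls_eq {X Y : FormSpace K} {a : K} (hX : ∀ v, X.t v = a • v)
    (hY : ∀ v, Y.t v = a • v) {j : ℕ} {u : K}
    (hu : u ≠ 0) {v : X.V} {w : Y.V} (hv : OddGen X j u v) (hw : OddGen Y j u w) :
    cls (X.sub _ (hv.isBlock hX hu)) = cls (Y.sub _ (hw.isBlock hY hu)) := by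
  refine cls_range_eq _ _ _ _ (fun e => a • e) (fun e => Polynomial.X * e)
    (fun m => by rw [hX, map_smul]) (fun m => apply_orb _ _ _)
    (fun m => by rw [hY, map_smul]) (fun m => apply_orb _ _ _) fun b c => ?_
  rw [hv.J_orb, hw.J_orb]

theorem OddGen.smul {X : FormSpace K} {j : ℕ} {u : K} {v : X.V} (h : OddGen X j u v) (c : K) :
    OddGen X j (c ^ 2 * u) (c • v) := by
  refine ⟨h.1, fun i => ?_⟩
  simp only [map_smul, LinearMap.smul_apply, smul_eq_mul, h.2]
  split_ifs <;> ring

theorem exists_oddGen (h2 : (2 : K) ≠ 0) (X : FormSpace K) (j : ℕ)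
    (hy : X.y ^ (2 * j + 1) = 0) (hne : X.y ^ (2 * j) ≠ 0) :
    ∃ u v, u ≠ 0 ∧ OddGen X j u v := by
  obtain ⟨v, hv, hv'⟩ := exists_odd_generator h2 X j hy hne
  refine ⟨_, v, hv, hy, fun i => ?_⟩
  split_ifs with h
  · rw [h]
  · rcases Nat.even_or_odd' i with ⟨m, rfl | rfl⟩
    · rcases Nat.lt_or_ge m j with hm | hm
      · exact hv' m hm
      · rw [y_pow_eq_zero_of_le hy (by omega)]; simp
    · exact J_y_pow_odd_self h2 X (odd_two_mul_add_one m) v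

end OddLevel

section EvenLevel

theorem y_pow_pow (X : FormSpace K) (i j : ℕ) (v : X.V) :
    (X.y ^ i) ((X.y ^ j) v) = (X.y ^ (i + j)) v := by rw [pow_add, Module.End.mul_apply]

theorem J_y_pow_swap_odd (X : FormSpace K) {i : ℕ} (hi : Odd i) (v w : X.V) :
    X.J ((X.y ^ i) w) v = - X.J ((X.y ^ i) v) w := by
  rw [J_y_pow X i w, hi.neg_one_pow, X.symm w]; ring

/-- Adding an odd power translate. -/
theorem J_even_add_odd (X : FormSpace K) (i l : ℕ) (hl : Odd l) (c : K) (v w : X.V) :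
    X.J ((X.y ^ (2 * i)) (v + c • (X.y ^ l) w)) (v + c • (X.y ^ l) w) =
      X.J ((X.y ^ (2 * i)) v) v - 2 * c * X.J ((X.y ^ (2 * i + l)) v) w -
        c ^ 2 * X.J ((X.y ^ (2 * i + l + l)) w) w := by
  have h : X.J ((X.y ^ (2 * i + l)) w) v = - X.J ((X.y ^ (2 * i + l)) v) w :=
    J_y_pow_swap_odd X ((even_two_mul i).add_odd hl) v w
  simp only [map_add, map_smul, LinearMap.add_apply, LinearMap.smul_apply, smul_eq_mul, y_pow_pow,
    J_pow_pow, hl.neg_one_pow, h]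
  ring

theorem exists_isotropic_generator (h2 : (2 : K) ≠ 0) (X : FormSpace K) (j : ℕ)
    (hy : X.y ^ (2 * j + 2) = 0) (hne : X.y ^ (2 * j + 1) ≠ 0) :
    ∃ v w, X.J ((X.y ^ (2 * j + 1)) v) w ≠ 0 ∧ ∀ i, X.J ((X.y ^ i) v) v = 0 := by
  have h0 : ∃ v w, X.J ((X.y ^ (2 * j + 1)) v) w ≠ 0 := by
    by_contra! hcon
    exact hne (LinearMap.ext fun v => X.nondeg _ fun w => hcon v w)
  have key : ∀ m ≤ j + 1, ∃ v w, X.J ((X.y ^ (2 * j + 1)) v) w ≠ 0 ∧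
      ∀ i, j + 1 - m ≤ i → X.J ((X.y ^ (2 * i)) v) v = 0 := by
    intro m
    induction m with
    | zero =>
      intro _
      obtain ⟨v, w, hv⟩ := h0
      exact ⟨v, w, hv, fun i h1 => by rw [y_pow_eq_zero_of_le hy (by omega)]; simp⟩
    | succ m ih =>
      intro hm
      obtain ⟨v, w, hv, hv'⟩ := ih (by omega)
      set u := X.J ((X.y ^ (2 * j + 1)) v) w with hu
      have hl : Odd (2 * m + 1) := odd_two_mul_add_one m
      set c := X.J ((X.y ^ (2 * (j - m))) v) v / (2 * u) with hc
      refine ⟨v + c • (X.y ^ (2 * m + 1)) w, w, ?_, fun i hi' => ?_⟩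
      · rw [map_add, map_add, LinearMap.add_apply, map_smul, y_pow_pow,
          y_pow_eq_zero_of_le hy (i := 2 * j + 1 + (2 * m + 1)) (by omega)]
        simpa using hv
      · rw [J_even_add_odd X i _ hl,
          y_pow_eq_zero_of_le hy (i := 2 * i + (2 * m + 1) + (2 * m + 1)) (by omega)]
        rcases Nat.lt_or_ge i (j + 1 - m) with h | h
        · have h1 : i = j - m := by omega
          have h3 : 2 * i + (2 * m + 1) = 2 * j + 1 := by omega
          rw [h3, ← hu, h1, hc]
          simp only [map_zero, LinearMap.zero_apply, mul_zero, sub_zero]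
          field_simp
          ring
        · rw [hv' i h, y_pow_eq_zero_of_le hy (by omega)]
          simp
  obtain ⟨v, w, hv, hv'⟩ := key (j + 1) le_rfl
  refine ⟨v, w, hv, fun i => ?_⟩
  rcases Nat.even_or_odd' i with ⟨m, rfl | rfl⟩
  · exact hv' m (by omega)
  · exact J_y_pow_odd_self h2 X (odd_two_mul_add_one m) v

theorem exists_dual_generator (X : FormSpace K) (j : ℕ)
    (hy : X.y ^ (j + 1) = 0) (v w : X.V) (hvw : X.J ((X.y ^ j) v) w ≠ 0) :
    ∃ w, ∀ i, X.J ((X.y ^ i) v) w = if i = j then 1 else 0 := by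
  have key : ∀ m ≤ j, ∃ w, ∀ i, j - m ≤ i → X.J ((X.y ^ i) v) w = if i = j then 1 else 0 := by
    intro m
    induction m with
    | zero =>
      intro _
      refine ⟨(X.J ((X.y ^ j) v) w)⁻¹ • w, fun i h1 => ?_⟩
      split_ifs with h
      · rw [h, map_smul, smul_eq_mul, inv_mul_cancel₀ hvw]
      · rw [y_pow_eq_zero_of_le hy (by omega)]; simp
    | succ m ih =>
      intro hm
      obtain ⟨w, hw⟩ := ih (by omega)
      refine ⟨w - ((-1) ^ (m + 1) * X.J ((X.y ^ (j - (m + 1))) v) w) • (X.y ^ (m + 1)) w,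
        fun i hi => ?_⟩
      rw [map_sub, map_smul, J_pow_pow, smul_eq_mul]
      rcases Nat.lt_or_ge i (j - m) with h | h
      · have h1 : i = j - (m + 1) := by omega
        have h3 : i + (m + 1) = j := by omega
        rw [h3, hw j (by omega), if_pos rfl, ← h1, if_neg (by omega)]
        have : ((-1 : K) ^ (m + 1)) * (-1) ^ (m + 1) = 1 := by rw [← mul_pow]; simp
        linear_combination (-X.J ((X.y ^ i) v) w) * this
      · rw [hw i h, y_pow_eq_zero_of_le hy (i := i + (m + 1)) (by omega)]
        simp
  obtain ⟨w, hw⟩ := key j le_rfl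
  exact ⟨w, fun i => hw i (by omega)⟩

/-- A normalized hyperbolic pair of generators of even level `2 * j + 2`. -/
structure EvenGen (X : FormSpace K) (j : ℕ) (v w : X.V) : Prop where
  level : X.y ^ (2 * j + 2) = 0
  left : ∀ i, X.J ((X.y ^ i) v) v = 0
  right : ∀ i, X.J ((X.y ^ i) w) w = 0
  pair : ∀ i, X.J ((X.y ^ i) v) w = if i = 2 * j + 1 then 1 else 0

theorem exists_evenGen (h2 : (2 : K) ≠ 0) (X : FormSpace K) (j : ℕ)
    (hy : X.y ^ (2 * j + 2) = 0) (hne : X.y ^ (2 * j + 1) ≠ 0) :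
    ∃ v w, EvenGen X j v w := by
  obtain ⟨v, w, hvw, hv⟩ := exists_isotropic_generator h2 X j hy hne
  obtain ⟨w0, hw0⟩ := exists_dual_generator X (2 * j + 1) hy v w hvw
  have key : ∀ m ≤ j + 1, ∃ w, (∀ i, X.J ((X.y ^ i) v) w = if i = 2 * j + 1 then 1 else 0) ∧
      ∀ i, j + 1 - m ≤ i → X.J ((X.y ^ (2 * i)) w) w = 0 := by
    intro m
    induction m with
    | zero =>
      intro _
      exact ⟨w0, hw0, fun i h1 => by rw [y_pow_eq_zero_of_le hy (by omega)]; simp⟩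
    | succ m ih =>
      intro hm
      obtain ⟨w, hw, hw'⟩ := ih (by omega)
      have hl : Odd (2 * m + 1) := odd_two_mul_add_one m
      set c := -X.J ((X.y ^ (2 * (j - m))) w) w / 2 with hc
      refine ⟨w + c • (X.y ^ (2 * m + 1)) v, fun i => ?_, fun i hi' => ?_⟩
      · rw [map_add, map_smul, J_pow_pow, hv, hw]
        simp
      · rw [J_even_add_odd X i _ hl, hv, J_y_pow_swap_odd X ((even_two_mul i).add_odd hl), hw]
        rcases Nat.lt_or_ge i (j + 1 - m) with h | h
        · have h1 : i = j - m := by omega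
          have h3 : 2 * i + (2 * m + 1) = 2 * j + 1 := by omega
          rw [if_pos h3, h1, hc]
          field_simp
          ring
        · rw [hw' i h, if_neg (by omega)]
          simp
  obtain ⟨w, hw, hw'⟩ := key (j + 1) le_rfl
  refine ⟨v, w, hy, hv, fun i => ?_, hw⟩
  rcases Nat.even_or_odd' i with ⟨m, rfl | rfl⟩
  · exact hw' m (by omega)
  · exact J_y_pow_odd_self h2 X (odd_two_mul_add_one m) w

theorem J_aeval_eq_zero {X : FormSpace K} {v w : X.V} (h : ∀ i, X.J ((X.y ^ i) v) w = 0)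
    (e : K[X]) : X.J (aeval X.y e v) w = 0 := by
  induction e using Polynomial.induction_on' with
  | add a b ha hb => simp [ha, hb]
  | monomial n a =>
    rw [aeval_monomial, Module.End.mul_apply, Module.algebraMap_end_apply, map_smul,
      LinearMap.smul_apply, h, smul_zero]

theorem J_aeval_eq_coeff {X : FormSpace K} {v w : X.V} {k : ℕ}
    (h : ∀ i, X.J ((X.y ^ i) v) w = if i = k then 1 else 0)
    (e : K[X]) : X.J (aeval X.y e v) w = e.coeff k := by
  induction e using Polynomial.induction_on' with
  | add a b ha hb => simp [ha, hb]
  | monomial n a =>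
    rw [aeval_monomial, Module.End.mul_apply, Module.algebraMap_end_apply, map_smul,
      LinearMap.smul_apply, h, coeff_monomial, smul_eq_mul, mul_ite, mul_one, mul_zero]

variable {X : FormSpace K} {j : ℕ} {v w : X.V}

theorem J_orb_orb (v w : X.V) (a b : K[X]) :
    X.J (orb X.y v a) (orb X.y w b) = X.J (aeval X.y (a * b.comp (-Polynomial.X)) v) w := by
  rw [orb_apply, orb_apply, J_aeval_y, ← Module.End.mul_apply, ← map_mul, mul_comm a]

/-- The map spanning the block of a hyperbolic pair. -/
def pairMap (X : FormSpace K) (v w : X.V) : K[X] × K[X] →ₗ[K] X.V :=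
  (orb X.y v).coprod (orb X.y w)

theorem EvenGen.J_pairMap (h : EvenGen X j v w) (a b : K[X] × K[X]) :
    X.J (pairMap X v w a) (pairMap X v w b) =
      (a.1 * b.2.comp (-Polynomial.X)).coeff (2 * j + 1) +
      (b.1 * a.2.comp (-Polynomial.X)).coeff (2 * j + 1) := by
  simp only [pairMap, LinearMap.coprod_apply, map_add, LinearMap.add_apply]
  rw [X.symm (orb X.y w a.2) (orb X.y v b.1)]
  simp only [J_orb_orb]
  rw [J_aeval_eq_zero h.left, J_aeval_eq_zero h.right, J_aeval_eq_coeff h.pair,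
    J_aeval_eq_coeff h.pair]
  ring

theorem pairMap_y (v w : X.V) (a : K[X] × K[X]) :
    X.y (pairMap X v w a) = pairMap X v w (Polynomial.X * a.1, Polynomial.X * a.2) := by
  simp only [pairMap, LinearMap.coprod_apply, map_add, apply_orb]

theorem EvenGen.coeff_eq_zero (h : EvenGen X j v w) {a : K[X] × K[X]}
    (ha : ∀ b, X.J (pairMap X v w a) (pairMap X v w b) = 0) :
    (Polynomial.X : K[X]) ^ (2 * j + 2) ∣ a.1 ∧ (Polynomial.X : K[X]) ^ (2 * j + 2) ∣ a.2 := by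
  rw [X_pow_dvd_iff, X_pow_dvd_iff]
  constructor
  · intro d hd
    have := ha (0, (-Polynomial.X) ^ (2 * j + 1 - d))
    rw [h.J_pairMap] at this
    simp only [pow_comp, neg_comp, X_comp, neg_neg, zero_mul, coeff_zero, add_zero] at this
    rwa [coeff_mul_X_pow', if_pos (by omega),
      show 2 * j + 1 - (2 * j + 1 - d) = d by omega] at this
  · have key : (Polynomial.X : K[X]) ^ (2 * j + 2) ∣ a.2.comp (-Polynomial.X) := by
      rw [X_pow_dvd_iff]
      intro d hd
      have := ha ((Polynomial.X) ^ (2 * j + 1 - d), 0)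
      rw [h.J_pairMap] at this
      simp only [zero_comp, mul_zero, coeff_zero, zero_add] at this
      rwa [coeff_X_pow_mul', if_pos (by omega),
        show 2 * j + 1 - (2 * j + 1 - d) = d by omega] at this
    rw [← X_pow_dvd_iff]
    rw [dvd_comp_neg_X_iff, pow_comp, X_comp] at key
    exact (pow_dvd_pow_of_dvd (dvd_neg.2 dvd_rfl) _).trans key

theorem EvenGen.orb_eq_zero_of_dvd (h : EvenGen X j v w) (v' : X.V) {e : K[X]}
    (he : (Polynomial.X : K[X]) ^ (2 * j + 2) ∣ e) : orb X.y v' e = 0 := by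
  obtain ⟨e', rfl⟩ := he
  rw [orb_apply, mul_comm, map_mul, map_pow, aeval_X, h.level, mul_zero]; rfl

theorem EvenGen.dvd_of_pairMap (h : EvenGen X j v w) {a : K[X] × K[X]} (ha : pairMap X v w a = 0) :
    (Polynomial.X : K[X]) ^ (2 * j + 2) ∣ a.1 ∧ (Polynomial.X : K[X]) ^ (2 * j + 2) ∣ a.2 :=
  h.coeff_eq_zero fun b => by rw [ha]; simp

theorem EvenGen.isBlock {a : K} (ht : ∀ v, X.t v = a • v) (h : EvenGen X j v w) :
    X.IsBlock (LinearMap.range (pairMap X v w)) := by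
  refine isBlock_range _ (fun e => a • e) _
    (fun m => by rw [ht, map_smul]) (pairMap_y v w) fun m hm => ?_
  obtain ⟨h1, h2⟩ := h.coeff_eq_zero hm
  rw [pairMap, LinearMap.coprod_apply, h.orb_eq_zero_of_dvd _ h1, h.orb_eq_zero_of_dvd _ h2,
    add_zero]

theorem EvenGen.finrank (h : EvenGen X j v w) :
    Module.finrank K (LinearMap.range (pairMap X v w)) = 2 * (2 * j + 2) := by
  rw [pairMap, finrank_range_coprod (h := (Polynomial.X : K[X]) ^ (2 * j + 2)), natDegree_X_pow]
  · refine fun e => ⟨fun he => ?_, h.orb_eq_zero_of_dvd _⟩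
    exact (h.dvd_of_pairMap (a := (e, 0)) (by simp [pairMap, he])).1
  · refine fun e => ⟨fun he => ?_, h.orb_eq_zero_of_dvd _⟩
    exact (h.dvd_of_pairMap (a := (0, e)) (by simp [pairMap, he])).2
  · exact fun a b hab => h.orb_eq_zero_of_dvd _ (h.dvd_of_pairMap (a := (a, b)) hab).1

theorem EvenGen.cls_eq {Y : FormSpace K} {a : K} (hX : ∀ v, X.t v = a • v)
    (hY : ∀ v, Y.t v = a • v) {v' w' : Y.V} (h : EvenGen X j v w) (h' : EvenGen Y j v' w') :
    cls (X.sub _ (h.isBlock hX)) = cls (Y.sub _ (h'.isBlock hY)) := by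
  refine cls_range_eq _ _ _ _ (fun e => a • e) _
    (fun m => by rw [hX, map_smul]) (pairMap_y _ _)
    (fun m => by rw [hY, map_smul]) (pairMap_y _ _) fun b c => ?_
  rw [h.J_pairMap, h'.J_pairMap]

end EvenLevel

open scoped Pointwise

theorem incl_y_pow (X : FormSpace K) (C : Submodule K X.V) (h : X.IsBlock C) (i : ℕ)
    (v : (X.sub C h).V) : X.incl C h (((X.sub C h).y ^ i) v) = (X.y ^ i) (X.incl C h v) := by
  induction i generalizing v with
  | zero => rfl
  | succ i ih => rw [pow_succ, Module.End.mul_apply, ih, incl_y, pow_succ, Module.End.mul_apply]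

theorem sub_y_pow_eq_zero {X : FormSpace K} {C : Submodule K X.V} (h : X.IsBlock C) {k : ℕ}
    (hk : X.y ^ k = 0) : (X.sub C h).y ^ k = 0 :=
  LinearMap.ext fun v => X.incl_injective C h (by rw [incl_y_pow, hk]; simp)

/-- The spaces with scalar `t`, with `y ^ k = 0`, of dimension `d`. -/
structure IsNil (a : K) (k d : ℕ) (X : FormSpace K) : Prop where
  scalar : ∀ v, X.t v = a • v
  nil : X.y ^ k = 0
  dim_eq : X.dim = d

theorem IsNil.sub {a : K} {k d : ℕ} {X : FormSpace K} (hX : IsNil a k d X) {C : Submodule K X.V}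
    (h : X.IsBlock C) : IsNil a k (X.sub C h).dim (X.sub C h) :=
  ⟨fun v => X.incl_injective C h (by rw [incl_t, map_smul, hX.scalar]),
    sub_y_pow_eq_zero h hX.nil, rfl⟩

/-- An upper bound for the number of classes of spaces with scalar `t` and `y ^ k = 0`. -/
def nilBound : ℕ → ℕ → ℕ
  | 0, d => if d = 0 then 1 else 0
  | k + 1, d => nilBound k d + if Even (k + 1) then
      (if 2 * (k + 1) ≤ d then nilBound (k + 1) (d - 2 * (k + 1)) else 0) else
      (if k + 1 ≤ d then nilBound (k + 1) (d - (k + 1)) + nilBound k (d - (k + 1)) else 0)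
termination_by k d => (k, d)

theorem encard_classes_dim_zero (P : FormSpace K → Prop) (h : ∀ X, P X → Subsingleton X.V) :
    (classes P).encard ≤ 1 := by
  rw [Set.encard_le_one_iff]
  rintro _ _ ⟨X, hX, rfl⟩ ⟨Y, hY, rfl⟩
  have := h X hX
  have := h Y hY
  refine cls_eq ⟨⟨0, 0, fun _ => Subsingleton.elim _ _, fun _ => Subsingleton.elim _ _⟩, ?_, ?_, ?_⟩
  · intro v w
    rw [Subsingleton.elim v 0]; simp
  · intro v
    exact Subsingleton.elim _ _
  · intro v
    exact Subsingleton.elim _ _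

/-- The classes of the cyclic spaces of odd level. -/
def oddCls (a : K) (j : ℕ) (u : K) : Set (Cls K) :=
  {c | ∃ (X : FormSpace K) (hX : ∀ v, X.t v = a • v) (v : X.V) (hu : u ≠ 0)
    (hv : OddGen X j u v), c = cls (X.sub _ (hv.isBlock hX hu))}

theorem encard_oddCls_le (a : K) (j : ℕ) (u : K) : (oddCls a j u).encard ≤ 1 := by
  rw [Set.encard_le_one_iff]
  rintro _ _ ⟨X, hX, v, hu, hv, rfl⟩ ⟨Y, hY, w, _, hw, rfl⟩
  exact hv.cls_eq hX hY hu hw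

/-- The classes of the spaces spanned by hyperbolic pairs. -/
def evenCls (a : K) (j : ℕ) : Set (Cls K) :=
  {c | ∃ (X : FormSpace K) (hX : ∀ v, X.t v = a • v) (v w : X.V)
    (h : EvenGen X j v w), c = cls (X.sub _ (h.isBlock hX))}

theorem encard_evenCls_le (a : K) (j : ℕ) : (evenCls a j).encard ≤ 1 := by
  rw [Set.encard_le_one_iff]
  rintro _ _ ⟨X, hX, v, w, h, rfl⟩ ⟨Y, hY, v', w', h', rfl⟩
  exact h.cls_eq hX hY h'

theorem even_level_subset (hK : ringChar K ≠ 2) (a : K) (j d : ℕ) :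
    classes (IsNil a (2 * j + 2) d) ⊆ classes (IsNil a (2 * j + 1) d) ∪
      if 2 * (2 * j + 2) ≤ d then
        evenCls a j + classes (IsNil a (2 * j + 2) (d - 2 * (2 * j + 2))) else ∅ := by
  rintro _ ⟨X, hX, rfl⟩
  by_cases hy : X.y ^ (2 * j + 1) = 0
  · exact Or.inl (mem_classes ⟨hX.scalar, hy, hX.dim_eq⟩)
  · right
    obtain ⟨v, w, h⟩ := exists_evenGen (Ring.two_ne_zero hK) X j hX.nil hy
    have hd := X.dim_split (h.isBlock hX.scalar)
    have hd' : (X.sub _ (h.isBlock hX.scalar)).dim = 2 * (2 * j + 2) := h.finrank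
    rw [hd', hX.dim_eq] at hd
    rw [if_pos (by omega), X.cls_split (h.isBlock hX.scalar)]
    refine Set.add_mem_add ⟨X, hX.scalar, v, w, h, rfl⟩ (mem_classes ?_)
    have := hX.sub (h.isBlock hX.scalar).perp
    rwa [show (X.sub _ (h.isBlock hX.scalar).perp).dim = d - 2 * (2 * j + 2) by omega] at this

theorem exists_sq_mul_eq [Fintype K] {ν : K} (hν : ¬ IsSquare ν) {u : K}
    (hu : u ≠ 0) : ∃ s : K, s ^ 2 * u = 1 ∨ s ^ 2 * u = ν := by
  have hν0 : ν ≠ 0 := fun h => hν (h ▸ IsSquare.zero)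
  by_cases h : IsSquare u
  · obtain ⟨r, rfl⟩ := h
    have hr : r ≠ 0 := fun h => hu (by rw [h, mul_zero])
    exact ⟨r⁻¹, Or.inl (by field_simp)⟩
  · have h1 : IsSquare (u * ν) := by
      rw [← quadraticChar_one_iff_isSquare (mul_ne_zero hu hν0), map_mul,
        quadraticChar_neg_one_iff_not_isSquare.2 h, quadraticChar_neg_one_iff_not_isSquare.2 hν]
      norm_num
    obtain ⟨r, hr⟩ := h1
    have hr0 : r ≠ 0 := fun h => mul_ne_zero hu hν0 (by rw [hr, h, mul_zero])
    refine ⟨r⁻¹ * ν, Or.inr ?_⟩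
    field_simp
    rw [sq r, ← hr]; ring

theorem exists_binary_eq_one [Fintype K] (hK : ringChar K ≠ 2) {ν : K} (hν : ν ≠ 0) :
    ∃ a b : K, a ^ 2 * ν + b ^ 2 * ν = 1 := by
  obtain ⟨a, b, h⟩ := FiniteField.exists_root_sum_quadratic (R := K)
    (f := C ν * Polynomial.X ^ 2) (g := C ν * Polynomial.X ^ 2 - C 1)
    (degree_C_mul_X_pow 2 hν)
    (by rw [degree_sub_C (by rw [degree_C_mul_X_pow 2 hν]; norm_num), degree_C_mul_X_pow 2 hν]; rfl)
    (FiniteField.odd_card_of_char_ne_two hK)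
  simp only [eval_mul, eval_C, eval_pow, eval_X, eval_sub] at h
  exact ⟨a, b, by linear_combination h⟩

theorem OddGen.add_perp {X : FormSpace K} {j : ℕ} {u u' : K} {v w : X.V} (hv : OddGen X j u v)
    (hw : OddGen X j u' w) (hvw : ∀ i, X.J ((X.y ^ i) v) w = 0) :
    OddGen X j (u + u') (v + w) := by
  refine ⟨hv.1, fun i => ?_⟩
  have hwv : X.J ((X.y ^ i) w) v = 0 := by rw [J_y_pow, X.symm, hvw, mul_zero]
  simp only [map_add, LinearMap.add_apply, hv.2, hw.2, hvw, hwv]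
  split_ifs <;> ring

theorem odd_level_subset [Fintype K] (hK : ringChar K ≠ 2) (a : K) {ν : K} (hν : ¬ IsSquare ν)
    (j d : ℕ) :
    classes (IsNil a (2 * j + 1) d) ⊆ classes (IsNil a (2 * j) d) ∪
      if 2 * j + 1 ≤ d then
        (oddCls a j 1 + classes (IsNil a (2 * j + 1) (d - (2 * j + 1)))) ∪
        (oddCls a j ν + classes (IsNil a (2 * j) (d - (2 * j + 1)))) else ∅ := by
  have hν0 : ν ≠ 0 := fun h => hν (h ▸ IsSquare.zero)
  rintro _ ⟨X, hX, rfl⟩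
  by_cases hy : X.y ^ (2 * j) = 0
  · exact Or.inl (mem_classes ⟨hX.scalar, hy, hX.dim_eq⟩)
  right
  have hsplit : ∀ {u : K} {v : X.V} (hu : u ≠ 0) (hv : OddGen X j u v), 2 * j + 1 ≤ d ∧
      (X.sub _ (hv.isBlock hX.scalar hu).perp).dim = d - (2 * j + 1) := by
    intro u v hu hv
    have hd := X.dim_split (hv.isBlock hX.scalar hu)
    have hd' : (X.sub _ (hv.isBlock hX.scalar hu)).dim = 2 * j + 1 := hv.finrank hu
    rw [hd', hX.dim_eq] at hd
    omega
  obtain ⟨u, v, hu, hv⟩ := exists_oddGen (Ring.two_ne_zero hK) X j hX.nil hy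
  by_cases h1 : ∃ v, OddGen X j 1 v
  · obtain ⟨v, hv⟩ := h1
    obtain ⟨hd, hd'⟩ := hsplit one_ne_zero hv
    rw [if_pos hd, X.cls_split (hv.isBlock hX.scalar one_ne_zero)]
    refine Or.inl (Set.add_mem_add ⟨X, hX.scalar, v, one_ne_zero, hv, rfl⟩ (mem_classes ?_))
    have := hX.sub (hv.isBlock hX.scalar one_ne_zero).perp
    rwa [hd'] at this
  · obtain ⟨s, hs | hs⟩ := exists_sq_mul_eq hν hu
    · exact absurd ⟨_, hs ▸ hv.smul s⟩ h1
    have hv := hs ▸ hv.smul s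
    set v := s • v
    obtain ⟨hd, hd'⟩ := hsplit hν0 hv
    rw [if_pos hd, X.cls_split (hv.isBlock hX.scalar hν0)]
    refine Or.inr (Set.add_mem_add ⟨X, hX.scalar, v, hν0, hv, rfl⟩ (mem_classes ?_))
    have h3 := hX.sub (hv.isBlock hX.scalar hν0).perp
    rw [hd'] at h3
    refine ⟨h3.scalar, ?_, h3.dim_eq⟩
    by_contra hne
    obtain ⟨u', w, hu', hw⟩ := exists_oddGen (Ring.two_ne_zero hK) _ j h3.nil hne
    have hwX : OddGen X j u' (X.incl _ (hv.isBlock hX.scalar hν0).perp w) := by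
      refine ⟨hX.nil, fun i => ?_⟩
      rw [← incl_y_pow, incl_J, hw.2]
    obtain ⟨s', hs' | hs'⟩ := exists_sq_mul_eq hν hu'
    · exact absurd ⟨_, hs' ▸ hwX.smul s'⟩ h1
    have hwX' := hs' ▸ hwX.smul s'
    obtain ⟨α, β, hαβ⟩ := exists_binary_eq_one hK hν0
    refine h1 ⟨_, hαβ ▸ (hv.smul α).add_perp (hwX'.smul β) fun i => ?_⟩
    have : (X.y ^ i) v ∈ LinearMap.range (orb X.y v) := ⟨Polynomial.X ^ i, by
      rw [orb_apply, map_pow, aeval_X]⟩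
    have := X.incl_mem _ (hv.isBlock hX.scalar hν0).perp w _ this
    rw [X.symm] at this
    simp [this]

theorem encard_isNil_le [Fintype K] (hK : ringChar K ≠ 2) (a : K) (k d : ℕ) :
    (classes (IsNil a k d)).encard ≤ nilBound k d := by
  obtain ⟨ν, hν⟩ := FiniteField.exists_nonsquare hK
  induction k generalizing d with
  | zero =>
    rw [nilBound]
    have hsub : ∀ X, IsNil a 0 d X → Subsingleton X.V := fun X hX => by
      refine ⟨fun v w => ?_⟩
      have h1 : ∀ v : X.V, v = 0 := fun v => congrArg (fun f => f v) hX.nil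
      rw [h1 v, h1 w]
    split_ifs with hd
    · exact encard_classes_dim_zero _ hsub
    · have : classes (IsNil a 0 d) = ∅ := by
        rw [Set.eq_empty_iff_forall_notMem]
        rintro _ ⟨X, hX, rfl⟩
        have := hsub X hX
        exact hd (hX.dim_eq ▸ Module.finrank_zero_of_subsingleton)
      simp [this]
  | succ k ihk =>
    induction d using Nat.strong_induction_on with
    | _ d ih =>
    rw [nilBound]
    rcases Nat.even_or_odd' k with ⟨j, rfl | rfl⟩
    · rw [if_neg (by simp)]
      refine (Set.encard_le_encard (odd_level_subset hK a hν j d)).trans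
        ((Set.encard_union_le _ _).trans ?_)
      rw [Nat.cast_add]
      refine add_le_add (ihk d) ?_
      split_ifs with hd
      · refine (Set.encard_union_le _ _).trans ?_
        rw [Nat.cast_add]
        refine add_le_add ((encard_add_le _ _).trans ?_) ((encard_add_le _ _).trans ?_)
        · exact (mul_le_mul' (encard_oddCls_le _ _ _) (ih _ (by omega))).trans (by simp)
        · exact (mul_le_mul' (encard_oddCls_le _ _ _) (ihk _)).trans (by simp)
      · simp
    · rw [if_pos (by rw [Nat.even_iff]; omega)]
      refine (Set.encard_le_encard (even_level_subset hK a j d)).trans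
        ((Set.encard_union_le _ _).trans ?_)
      rw [Nat.cast_add]
      refine add_le_add (ihk d) ?_
      have e : 2 * j + 1 + 1 = 2 * j + 2 := rfl
      rw [e]
      split_ifs with hd
      · refine (encard_add_le _ _).trans ?_
        exact (mul_le_mul' (encard_evenCls_le _ _) (ih _ (by omega))).trans (by simp)
      · simp

theorem nilBound_zero_zero : nilBound 0 0 = 1 := by simp [nilBound]

theorem nilBound_one_one : nilBound 1 1 = 2 := by simp [nilBound]

theorem nilBound_two_two : nilBound 2 2 = 2 := by simp [nilBound]

theorem nilBound_succ_self_of_lt {k d : ℕ} (h : d < k + 1) :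
    nilBound (k + 1) d = nilBound k d := by
  rw [nilBound]
  split_ifs <;> omega

theorem nilBound_zero_le (k : ℕ) : nilBound k 0 ≤ 1 := by
  induction k with
  | zero => simp [nilBound]
  | succ k ih => rwa [nilBound_succ_self_of_lt (by omega)]

theorem nilBound_one_le (k : ℕ) : nilBound k 1 ≤ 2 := by
  induction k with
  | zero => simp [nilBound]
  | succ k ih =>
    rcases Nat.eq_zero_or_pos k with rfl | hk
    · exact nilBound_one_one.le
    · rwa [nilBound_succ_self_of_lt (by omega)]

theorem nilBound_one (d : ℕ) : nilBound 1 d ≤ 2 := by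
  induction d with
  | zero => exact (nilBound_zero_le 1).trans one_le_two
  | succ d ih =>
    rcases Nat.eq_zero_or_pos d with rfl | hd
    · exact nilBound_one_one.le
    · have h0 : ∀ d ≠ 0, nilBound 0 d = 0 := fun d hd => by rw [nilBound, if_neg hd]
      rw [nilBound, h0 _ (by omega), if_neg (by simp), if_pos (by omega)]
      have e : d + 1 - (0 + 1) = d := rfl
      rw [e, h0 _ hd.ne', zero_add, zero_add, add_zero]
      exact ih

theorem nilBound_le_two_pow (k d : ℕ) : nilBound k d ≤ 2 ^ d := by
  induction d using Nat.strong_induction_on generalizing k with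
  | _ d ih =>
  rcases Nat.lt_or_ge d 2 with hd | hd
  · interval_cases d
    · exact nilBound_zero_le k
    · exact nilBound_one_le k
  have key : ∀ k, (nilBound (k + 1) d : ℚ) ≤ 2 + 2 ^ d * (1 / 2 -
      (if Even (k + 1) then 3 / 2 else 1) / 2 ^ (k + 1)) := by
    intro k
    induction k with
    | zero => simpa using (by exact_mod_cast nilBound_one d : (nilBound 1 d : ℚ) ≤ 2)
    | succ k ihk =>
      have hpow : ∀ i ≤ d, 1 ≤ i → ∀ j, (nilBound j (d - i) : ℚ) ≤ 2 ^ d / 2 ^ i := by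
        intro i hi h1 j
        have h : (nilBound j (d - i) : ℚ) ≤ 2 ^ (d - i) := by
          exact_mod_cast ih (d - i) (by omega) j
        rw [le_div_iff₀ (by positivity)]
        calc (nilBound j (d - i) : ℚ) * 2 ^ i ≤ 2 ^ (d - i) * 2 ^ i := by gcongr
          _ = 2 ^ d := by rw [← pow_add, Nat.sub_add_cancel hi]
      have hp : (0 : ℚ) < 2 ^ d := by positivity
      have hp1 : (0 : ℚ) < 2 ^ d / 2 ^ (k + 1 + 1) := by positivity
      have e1 : (2 : ℚ) ^ d * (1 / 2 ^ (k + 1)) = 2 * (2 ^ d / 2 ^ (k + 1 + 1)) := by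
        rw [pow_succ (2 : ℚ) (k + 1)]; field_simp
      have e2 : ∀ c : ℚ, (2 : ℚ) ^ d * (1 / 2 - c / 2 ^ (k + 1)) =
          2 ^ d / 2 - 2 * c * (2 ^ d / 2 ^ (k + 1 + 1)) := by
        intro c; linear_combination (-c) * e1
      have e3 : ∀ c : ℚ, (2 : ℚ) ^ d * (1 / 2 - c / 2 ^ (k + 1 + 1)) =
          2 ^ d / 2 - c * (2 ^ d / 2 ^ (k + 1 + 1)) := by
        intro c; ring
      rw [nilBound]
      rw [e2] at ihk
      rw [e3]
      by_cases hk : Even (k + 1)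
      · rw [if_pos hk] at ihk
        have hk' : ¬ Even (k + 1 + 1) := fun h => Nat.even_add_one.1 h hk
        simp only [if_neg hk']
        push_cast
        split_ifs with h
        · have h1 := hpow _ h (by omega) (k + 1 + 1)
          have h2 := hpow _ h (by omega) (k + 1)
          linarith
        · linarith
      · rw [if_neg hk] at ihk
        have hk' : Even (k + 1 + 1) := Nat.even_add_one.2 hk
        simp only [if_pos hk']
        push_cast
        split_ifs with h
        · have h1 := hpow _ h (by omega) (k + 1 + 1)
          have h2 : (2 : ℚ) ^ d / 2 ^ (2 * (k + 1 + 1)) ≤ 1 / 2 * (2 ^ d / 2 ^ (k + 1 + 1)) := by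
            rw [two_mul, pow_add, ← div_div, div_eq_mul_inv, mul_comm]
            gcongr
            rw [one_div]
            gcongr
            exact le_self_pow₀ (by norm_num) (by omega)
          linarith
        · linarith
  rcases Nat.eq_zero_or_pos k with rfl | hk
  · rw [nilBound, if_neg (by omega)]; exact Nat.zero_le _
  · obtain ⟨k, rfl⟩ := Nat.exists_eq_succ_of_ne_zero hk.ne'
    have h1 := key k
    have h2 : (0 : ℚ) ≤ 2 ^ d * ((if Even (k + 1) then 3 / 2 else 1) / 2 ^ (k + 1)) := by
      split_ifs <;> positivity
    have h3 : (4 : ℚ) ≤ 2 ^ d := by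
      calc (4 : ℚ) = 2 ^ 2 := by norm_num
        _ ≤ 2 ^ d := pow_le_pow_right₀ (by norm_num) hd
    have : (nilBound (k + 1) d : ℚ) ≤ 2 ^ d := by linarith
    exact_mod_cast this

/-- Existence of an automorphism of determinant `-1`. -/
def HasRefl (X : FormSpace K) : Prop :=
  ∃ f : Iso X X, LinearMap.det (f.e : X.V →ₗ[K] X.V) = -1

theorem Iso.hasRefl {X Y : FormSpace K} (g : Iso X Y) (h : HasRefl X) : HasRefl Y := by
  obtain ⟨f, hf⟩ := h
  refine ⟨(g.symm.trans f).trans g, ?_⟩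
  rw [← hf, ← LinearMap.det_conj (f.e : X.V →ₗ[K] X.V) g.e]
  rfl

theorem HasRefl.sum_left {X : FormSpace K} (h : HasRefl X) (Y : FormSpace K) :
    HasRefl (X.sum Y) := by
  obtain ⟨f, hf⟩ := h
  refine ⟨f.sum (Iso.refl Y), ?_⟩
  have : (((f.sum (Iso.refl Y)).e : (X.V × Y.V) ≃ₗ[K] (X.V × Y.V)) : (X.V × Y.V) →ₗ[K] (X.V × Y.V))
    = LinearMap.prodMap (f.e : X.V →ₗ[K] X.V) LinearMap.id := rfl
  exact (congrArg LinearMap.det this).trans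
    (by rw [LinearMap.det_prodMap, hf, LinearMap.det_id, mul_one])

/-- The automorphism `-1`. -/
def negIso (X : FormSpace K) : Iso X X where
  e := LinearEquiv.neg K
  map_J v w := by simp
  map_t v := by simp
  map_y v := by simp

theorem hasRefl_of_odd {X : FormSpace K} (h : Odd X.dim) : HasRefl X := by
  refine ⟨X.negIso, ?_⟩
  have : (X.negIso.e : X.V →ₗ[K] X.V) = -LinearMap.id := rfl
  rw [this, ← neg_one_smul K, LinearMap.det_smul, LinearMap.det_id, mul_one]
  exact Odd.neg_one_pow h

/-- The classes of spaces with an automorphism of determinant `-1`. -/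
def reflCls (K : Type) [Field K] : Set (Cls K) := classes HasRefl

theorem cls_mem_reflCls {X : FormSpace K} : cls X ∈ reflCls K ↔ HasRefl X := by
  refine ⟨?_, mem_classes⟩
  rintro ⟨Y, hY, h⟩
  obtain ⟨f⟩ := iso_of_cls_eq h
  exact f.hasRefl hY

theorem reflCls_add {a b : Cls K} (h : a ∈ reflCls K) : a + b ∈ reflCls K := by
  induction a using Quotient.inductionOn with | _ X =>
  induction b using Quotient.inductionOn with | _ Y =>
  have h : cls X ∈ reflCls K := h
  change cls (X.sum Y) ∈ reflCls K
  rw [cls_mem_reflCls] at h ⊢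
  exact h.sum_left Y

/-- The number of classes, those without automorphism of determinant `-1` counting twice. -/
def wt (S : Set (Cls K)) : ℕ∞ := S.encard + (S \ reflCls K).encard

theorem wt_mono {S T : Set (Cls K)} (h : S ⊆ T) : wt S ≤ wt T :=
  add_le_add (Set.encard_le_encard h) (Set.encard_le_encard (Set.sdiff_subset_sdiff_left h))

theorem wt_le (S : Set (Cls K)) : wt S ≤ 2 * S.encard := by
  rw [two_mul]
  exact add_le_add le_rfl (Set.encard_le_encard Set.sdiff_subset)

theorem wt_union_le (S T : Set (Cls K)) : wt (S ∪ T) ≤ wt S + wt T := by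
  unfold wt
  rw [Set.union_sdiff_distrib, add_add_add_comm]
  exact add_le_add (Set.encard_union_le _ _) (Set.encard_union_le _ _)

theorem wt_empty : wt (∅ : Set (Cls K)) = 0 := by simp [wt]

theorem wt_biUnion_le {α : Type*} (s : Finset α) (f : α → Set (Cls K)) :
    wt (⋃ i ∈ s, f i) ≤ ∑ i ∈ s, wt (f i) := by
  induction s using Finset.induction_on with
  | empty => simp [wt_empty]
  | insert a s ha ih =>
    rw [Finset.set_biUnion_insert, Finset.sum_insert ha]
    exact (wt_union_le _ _).trans (add_le_add le_rfl ih)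

theorem wt_add_le (S T : Set (Cls K)) : wt (S + T) ≤ wt S * T.encard := by
  rw [wt, wt, add_mul]
  refine add_le_add (encard_add_le _ _) (le_trans (Set.encard_le_encard ?_) (encard_add_le _ _))
  rintro _ ⟨⟨a, ha, b, hb, rfl⟩, h⟩
  exact ⟨a, ⟨ha, fun h' => h (reflCls_add h')⟩, b, hb, rfl⟩

theorem wt_eq_of_subset {S : Set (Cls K)} (h : S ⊆ reflCls K) : wt S = S.encard := by
  rw [wt, Set.sdiff_eq_empty.2 h]; simp

theorem encard_classes_le {L : Type} [Field L] {P : FormSpace K → Prop} {P' : FormSpace L → Prop}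
    (f : ∀ X, P X → FormSpace L) (hf : ∀ X hX, P' (f X hX))
    (hi : ∀ X Y hX hY, Iso (f X hX) (f Y hY) → Nonempty (Iso X Y)) :
    (classes P).encard ≤ (classes P').encard := by
  have h : ∀ c : Cls K, ∃ c' : Cls L, ∀ hc : c ∈ classes P, ∃ X hX, c = cls X ∧
      c' = cls (f X hX) := by
    intro c
    by_cases hc : c ∈ classes P
    · obtain ⟨X, hX, rfl⟩ := hc
      exact ⟨cls (f X hX), fun _ => ⟨X, hX, rfl, rfl⟩⟩
    · obtain ⟨X⟩ : Nonempty (FormSpace L) :=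
        ⟨{ V := PUnit, J := 0, t := 0, y := 0, symm := fun _ _ => rfl, nondeg := fun _ _ => rfl,
           t_adj := fun _ _ => rfl, y_adj := fun _ _ => by simp, comm := fun _ => rfl }⟩
      exact ⟨cls X, fun h => absurd h hc⟩
  choose g hg using h
  refine Set.encard_le_encard_of_injOn (f := g) ?_ ?_
  · intro c hc
    obtain ⟨X, hX, -, h⟩ := hg c hc
    exact h ▸ mem_classes (hf X hX)
  · intro c hc c' hc' he
    obtain ⟨X, hX, rfl, h⟩ := hg c hc
    obtain ⟨Y, hY, rfl, h'⟩ := hg c' hc'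
    obtain ⟨e⟩ := iso_of_cls_eq ((h.symm.trans he).trans h')
    obtain ⟨i⟩ := hi X Y hX hY e
    exact cls_eq i

theorem classes_diff_reflCls (P : FormSpace K → Prop) :
    classes P \ reflCls K = classes fun X => P X ∧ ¬ HasRefl X := by
  ext c
  constructor
  · rintro ⟨⟨X, hX, rfl⟩, h⟩
    exact mem_classes ⟨hX, fun h' => h (cls_mem_reflCls.2 h')⟩
  · rintro ⟨X, ⟨hX, h⟩, rfl⟩
    exact ⟨mem_classes hX, fun h' => h (cls_mem_reflCls.1 h')⟩

theorem wt_classes_le {P P' : FormSpace K → Prop}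
    (f : ∀ X, P X → FormSpace K) (hf : ∀ X hX, P' (f X hX))
    (hi : ∀ X Y hX hY, Iso (f X hX) (f Y hY) → Nonempty (Iso X Y))
    (hr : ∀ X hX, HasRefl (f X hX) → HasRefl X) :
    wt (classes P) ≤ wt (classes P') := by
  refine add_le_add (encard_classes_le f hf hi) ?_
  rw [classes_diff_reflCls, classes_diff_reflCls]
  exact encard_classes_le (fun X hX => f X hX.1) (fun X hX => ⟨hf X hX.1, fun h => hX.2 (hr X _ h)⟩)
    fun X Y hX hY => hi X Y hX.1 hY.1

/-- The spaces with `y ^ 2 = t ^ 2 - δ`, `y` nilpotent, of dimension `d`. -/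
structure IsBad (δ : K) (d : ℕ) (X : FormSpace K) : Prop where
  sq : ∀ v, X.y (X.y v) = X.t (X.t v) - δ • v
  nil : X.y ^ d = 0
  dim_eq : X.dim = d

/-- The spaces with `t ^ 2 = δ`, `y` nilpotent, of dimension `d`. -/
structure IsBadSemisimple (δ : K) (d : ℕ) (X : FormSpace K) : Prop where
  sq : ∀ v, X.t (X.t v) = δ • v
  nil : X.y ^ d = 0
  dim_eq : X.dim = d

/-- The space with `t` replaced by a power. -/
abbrev powT (Q : ℕ) (X : FormSpace K) : FormSpace K where
  V := X.V
  J := X.J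
  t := X.t ^ Q
  y := X.y
  symm := X.symm
  nondeg := X.nondeg
  t_adj v w := by
    have := X.J_aeval_t (Polynomial.X ^ Q) v w
    rwa [map_pow, aeval_X] at this
  y_adj := X.y_adj
  comm v := by
    have := X.y_aeval_t (Polynomial.X ^ Q) v
    rw [map_pow, aeval_X] at this
    exact this.symm

theorem aeval_intertwine {V W : Type} [AddCommGroup V] [Module K V] [AddCommGroup W] [Module K W]
    (f : V →ₗ[K] W) (a : Module.End K V) (b : Module.End K W) (h : ∀ v, f (a v) = b (f v))
    (P : K[X]) (v : V) : f (aeval a P v) = aeval b P (f v) := by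
  induction P using Polynomial.induction_on' generalizing v with
  | add p q hp hq => simp [hp, hq]
  | monomial n c =>
    have hn : ∀ v, f ((a ^ n) v) = (b ^ n) (f v) := by
      induction n with
      | zero => simp
      | succ n ih => intro v; rw [pow_succ, Module.End.mul_apply, ih, h]; rfl
    simp [hn]

/-- Recovering an isomorphism from one between the spaces with `t` replaced by a power. -/
def isoOfPowT {X Y : FormSpace K} {Q : ℕ} {P : K[X]}
    (hX : ∀ v, X.t v = aeval X.y P ((X.t ^ Q) v))
    (hY : ∀ v, Y.t v = aeval Y.y P ((Y.t ^ Q) v))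
    (f : Iso (X.powT Q) (Y.powT Q)) : Iso X Y where
  e := f.e
  map_J := f.map_J
  map_y := f.map_y
  map_t v := by
    have h1 : ∀ w, f.e (aeval X.y P w) = aeval Y.y P (f.e w) :=
      aeval_intertwine (f.e : X.V →ₗ[K] Y.V) X.y Y.y f.map_y P
    rw [hX v, h1, hY (f.e v)]
    exact congrArg _ (f.map_t v)

theorem isBad_powT [Fintype K] {δ : K} {d : ℕ}
    {X : FormSpace K} (hX : IsBad δ d X) : IsBadSemisimple δ d (X.powT (Fintype.card K ^ d)) := by
  refine ⟨?_, hX.nil, hX.dim_eq⟩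
  obtain ⟨p, hp, m, hpp, hm⟩ := FiniteField.card' K
  have := Fact.mk hpp
  have h1 : X.t ^ 2 = aeval X.y (Polynomial.X ^ 2 + C δ) := by
    refine LinearMap.ext fun v => ?_
    simp [pow_two, hX.sq, Algebra.algebraMap_eq_smul_one]
  have h2 : (X.t ^ Fintype.card K ^ d) ^ 2 = algebraMap K _ δ := by
    rw [← pow_mul, mul_comm, pow_mul, h1, ← map_pow]
    have hq : Fintype.card K ^ d = p ^ (m * d) := by rw [hm, pow_mul]
    rw [hq, add_pow_char_pow, ← hq, ← C_pow, FiniteField.pow_card_pow, map_add, map_pow, map_pow,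
      aeval_X, aeval_C, ← pow_mul]
    have hd : d ≤ 2 * Fintype.card K ^ d := by
      have := Nat.lt_pow_self (n := d) (Fintype.one_lt_card (α := K))
      omega
    rw [show X.y ^ (2 * Fintype.card K ^ d) = 0 from pow_eq_zero_of_le hd hX.nil, zero_add]
  intro v
  have := congrArg (fun f => f v) h2
  simpa [pow_two, Algebra.algebraMap_eq_smul_one] using this

theorem IsBad.t_eq [Fintype K] (hK : ringChar K ≠ 2) {δ : K} (hδ : δ ≠ 0) {d : ℕ}
    {X : FormSpace K} (hX : IsBad δ d X) (v : X.V) :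
    X.t v = aeval X.y (C δ⁻¹ * (Polynomial.X ^ 2 + C δ) ^ ((Fintype.card K ^ d + 1) / 2))
      ((X.t ^ Fintype.card K ^ d) v) := by
  have h1 : X.t ^ 2 = aeval X.y (Polynomial.X ^ 2 + C δ) := by
    refine LinearMap.ext fun v => ?_
    simp [pow_two, hX.sq, Algebra.algebraMap_eq_smul_one]
  have hodd : 2 * ((Fintype.card K ^ d + 1) / 2) = Fintype.card K ^ d + 1 := by
    have : Odd (Fintype.card K ^ d) :=
      (Nat.odd_iff.2 (FiniteField.odd_card_of_char_ne_two hK)).pow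
    obtain ⟨k, hk⟩ := this
    omega
  have h3 := (isBad_powT hX).sq
  rw [map_mul, map_pow, ← h1, ← pow_mul, hodd, aeval_C]
  have h4 : (X.t ^ (Fintype.card K ^ d + 1)) ((X.t ^ Fintype.card K ^ d) v) =
      (X.t ^ Fintype.card K ^ d) ((X.t ^ Fintype.card K ^ d) (X.t v)) := by
    rw [← Module.End.mul_apply, ← Module.End.mul_apply, ← Module.End.mul_apply, ← pow_add,
      mul_assoc, ← pow_succ, ← pow_add]
    congr 2
    omega
  have h5 : (X.t ^ Fintype.card K ^ d) ((X.t ^ Fintype.card K ^ d) (X.t v)) = δ • X.t v :=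
    h3 (X.t v)
  rw [Module.End.mul_apply, h4, h5]
  simp [Algebra.algebraMap_eq_smul_one, hδ]

theorem wt_isBad_le [Fintype K] (hK : ringChar K ≠ 2) {δ : K} (hδ : δ ≠ 0) (d : ℕ) :
    wt (classes (IsBad δ d)) ≤ wt (classes (IsBadSemisimple δ d)) := by
  refine wt_classes_le (fun X _ => X.powT (Fintype.card K ^ d)) (fun X hX => isBad_powT hX)
    (fun X Y hX hY f => ⟨isoOfPowT (hX.t_eq hK hδ) (hY.t_eq hK hδ) f⟩) ?_
  rintro X hX ⟨f, hf⟩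
  exact ⟨isoOfPowT (hX.t_eq hK hδ) (hX.t_eq hK hδ) f, hf⟩

theorem y_pow_dim {X : FormSpace K} (h : IsNilpotent X.y) : X.y ^ X.dim = 0 := by
  have := X.y.aeval_self_charpoly
  rwa [(LinearMap.isNilpotent_iff_charpoly X.y).1 h, map_pow, aeval_X] at this

theorem isBlock_ker {X : FormSpace K} (h2 : (2 : K) ≠ 0) {c : K} (hc : c ≠ 0)
    (hX : ∀ v, X.t (X.t v) = c ^ 2 • v) :
    X.IsBlock (LinearMap.ker (X.t - algebraMap K (Module.End K X.V) c)) where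
  t_mem v hv := by
    simp only [LinearMap.mem_ker, LinearMap.sub_apply, Module.algebraMap_end_apply, sub_eq_zero]
      at hv ⊢
    rw [hv, map_smul, hv]
  y_mem v hv := by
    simp only [LinearMap.mem_ker, LinearMap.sub_apply, Module.algebraMap_end_apply, sub_eq_zero]
      at hv ⊢
    rw [X.comm, hv, map_smul]
  nondeg v hv h := by
    simp only [LinearMap.mem_ker, LinearMap.sub_apply, Module.algebraMap_end_apply, sub_eq_zero]
      at hv h
    refine X.nondeg v fun w => ?_
    have := h (X.t w + c • w)
        (by rw [map_add, hX, map_smul, smul_add, smul_smul, pow_two, add_comm])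
    rw [map_add, ← X.t_adj, hv, map_smul, map_smul, LinearMap.smul_apply, ← two_smul K, smul_smul,
      smul_eq_zero] at this
    exact this.resolve_left (mul_ne_zero h2 hc)

theorem perp_ker {X : FormSpace K} {c : K}
    (hX : ∀ v, X.t (X.t v) = c ^ 2 • v) {v : X.V}
    (hv : v ∈ X.perp (LinearMap.ker (X.t - algebraMap K (Module.End K X.V) c))) :
    X.t v = (-c) • v := by
  rw [← sub_eq_zero, neg_smul, sub_neg_eq_add]
  refine X.nondeg _ fun w => ?_
  rw [map_add, LinearMap.add_apply, X.t_adj, map_smul, LinearMap.smul_apply, ← map_smul, ← map_add]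
  refine hv _ ?_
  rw [LinearMap.mem_ker, LinearMap.sub_apply, Module.algebraMap_end_apply, map_add, hX, map_smul,
    smul_add, smul_smul, pow_two, add_comm, sub_self]

theorem isBadSemisimple_subset (h2 : (2 : K) ≠ 0) {c : K} (hc : c ≠ 0) (d : ℕ) :
    classes (IsBadSemisimple (c ^ 2) d) ⊆ ⋃ i ∈ Finset.HasAntidiagonal.antidiagonal d,
      (classes (IsNil c i.1 i.1) + classes (IsNil (-c) i.2 i.2)) := by
  rintro _ ⟨X, hX, rfl⟩
  have hb := isBlock_ker h2 hc hX.sq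
  rw [X.cls_split hb, Set.mem_iUnion₂]
  have hd := X.dim_split hb
  rw [hX.dim_eq] at hd
  refine ⟨(_, _), Finset.HasAntidiagonal.mem_antidiagonal.2 hd.symm, Set.add_mem_add
      (mem_classes ⟨?_, ?_, rfl⟩)
    (mem_classes ⟨?_, ?_, rfl⟩)⟩
  · intro v
    have := X.incl_mem _ hb v
    rw [LinearMap.mem_ker, LinearMap.sub_apply, Module.algebraMap_end_apply, sub_eq_zero] at this
    exact X.incl_injective _ hb (by rw [incl_t, map_smul, this])
  · exact y_pow_dim ⟨d, sub_y_pow_eq_zero hb hX.nil⟩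
  · intro v
    exact X.incl_injective _ hb.perp (by
      rw [incl_t, map_smul, perp_ker hX.sq (X.incl_mem _ hb.perp v)])
  · exact y_pow_dim ⟨d, sub_y_pow_eq_zero hb.perp hX.nil⟩

theorem wt_isBad_sq_le [Fintype K] (hK : ringChar K ≠ 2) {c : K} (hc : c ≠ 0) (d : ℕ) :
    wt (classes (IsBad (c ^ 2) d)) ≤ ∑ i ∈ Finset.HasAntidiagonal.antidiagonal d,
      (if Odd i.1 then 1 else 2) * ((nilBound i.1 i.1 : ℕ) : ℕ∞) * (nilBound i.2 i.2 : ℕ) := by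
  refine (wt_isBad_le hK (pow_ne_zero 2 hc) d).trans ((wt_mono (isBadSemisimple_subset
    (Ring.two_ne_zero hK) hc d)).trans ((wt_biUnion_le _ _).trans
        (Finset.sum_le_sum fun i _ => ?_)))
  refine (wt_add_le _ _).trans (mul_le_mul' ?_ (encard_isNil_le hK _ _ _))
  split_ifs with h
  · rw [wt_eq_of_subset, one_mul]
    · exact encard_isNil_le hK _ _ _
    · exact classes_mono fun X hX => hasRefl_of_odd (hX.dim_eq ▸ h)
  · exact (wt_le _).trans (mul_le_mul' le_rfl (encard_isNil_le hK _ _ _))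

/-- The scalar action of the quadratic extension given by `t`. -/
abbrev quadModule {δ : K} (X : FormSpace K) (hX : ∀ v, X.t (X.t v) = δ • v) :
    Module (QuadraticAlgebra K δ 0) X.V where
  smul z v := z.re • v + z.im • X.t v
  one_smul v := by
    change (1 : K) • v + (0 : K) • X.t v = v
    rw [one_smul, zero_smul, add_zero]
  mul_smul z w v := by
    change (z * w).re • v + (z * w).im • X.t v =
      z.re • (w.re • v + w.im • X.t v) + z.im • X.t (w.re • v + w.im • X.t v)
    simp only [QuadraticAlgebra.re_mul, QuadraticAlgebra.im_mul, map_add, map_smul, hX]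
    module
  smul_zero z := by
    change z.re • (0 : X.V) + z.im • X.t 0 = 0
    simp
  smul_add z v w := by
    change z.re • (v + w) + z.im • X.t (v + w) = z.re • v + z.im • X.t v + (z.re • w + z.im • X.t w)
    rw [map_add]; module
  add_smul z w v := by
    change (z + w).re • v + (z + w).im • X.t v = z.re • v + z.im • X.t v + (w.re • v + w.im • X.t v)
    simp only [QuadraticAlgebra.re_add, QuadraticAlgebra.im_add]; module
  zero_smul v := by
    change (0 : K) • v + (0 : K) • X.t v = 0
    rw [zero_smul, zero_smul, add_zero]

theorem quad_smul_def {δ : K} (X : FormSpace K) (hX : ∀ v, X.t (X.t v) = δ • v)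
    (z : QuadraticAlgebra K δ 0) (v : X.V) :
    let := X.quadModule hX
    z • v = z.re • v + z.im • X.t v := rfl

theorem quad_isScalarTower {δ : K} (X : FormSpace K) (hX : ∀ v, X.t (X.t v) = δ • v) :
    let := X.quadModule hX
    IsScalarTower K (QuadraticAlgebra K δ 0) X.V := by
  let := X.quadModule hX
  refine ⟨fun r z v => ?_⟩
  rw [X.quad_smul_def hX, X.quad_smul_def hX]
  simp only [QuadraticAlgebra.re_smul, QuadraticAlgebra.im_smul, smul_eq_mul]
  module

/-- The space over the quadratic extension generated by `t`. -/
abbrev quad {δ : K} [Fact (∀ r : K, r ^ 2 ≠ δ + 0 * r)] (X : FormSpace K) (hδ : δ ≠ 0)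
    (hX : ∀ v, X.t (X.t v) = δ • v) :
    FormSpace (QuadraticAlgebra K δ 0) :=
  letI := X.quadModule hX
  haveI := X.quad_isScalarTower hX
  { V := X.V
    fin := Module.Finite.of_restrictScalars_finite K (QuadraticAlgebra K δ 0) X.V
    J := LinearMap.mk₂ (QuadraticAlgebra K δ 0) (fun v w => ⟨X.J v w, δ⁻¹ * X.J (X.t v) w⟩)
      (fun v w u => by
        ext <;> simp only [map_add, LinearMap.add_apply, QuadraticAlgebra.re_add,
          QuadraticAlgebra.im_add]
        ring)
      (fun z v w => by
        rw [X.quad_smul_def hX]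
        ext <;> simp only [map_add, LinearMap.add_apply, map_smul, LinearMap.smul_apply, hX,
          smul_eq_mul, QuadraticAlgebra.re_mul, QuadraticAlgebra.im_mul]
        · field_simp
        · field_simp; ring)
      (fun v w u => by
        ext <;> simp only [map_add, QuadraticAlgebra.re_add, QuadraticAlgebra.im_add]
        ring)
      (fun z v w => by
        rw [X.quad_smul_def hX]
        ext <;> simp only [map_add, map_smul, ← X.t_adj, hX, LinearMap.smul_apply,
          smul_eq_mul, QuadraticAlgebra.re_mul, QuadraticAlgebra.im_mul]
        · field_simp
        · field_simp; ring)
    t := 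
      { toFun := X.t
        map_add' := map_add X.t
        map_smul' := fun z v => by
          simp only [X.quad_smul_def hX, map_add, map_smul, RingHom.id_apply] }
    y := 
      { toFun := X.y
        map_add' := map_add X.y
        map_smul' := fun z v => by
          simp only [X.quad_smul_def hX, map_add, map_smul, RingHom.id_apply, X.comm] }
    symm := fun v w => by
      rw [LinearMap.mk₂_apply, LinearMap.mk₂_apply, X.symm v w, X.t_adj, X.symm v]
    nondeg := fun v hv => X.nondeg v fun w => congrArg QuadraticAlgebra.re (hv w)
    t_adj := fun v w => by
      simp only [LinearMap.mk₂_apply, LinearMap.coe_mk, AddHom.coe_mk, X.t_adj]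
    y_adj := fun v w => by
      simp only [LinearMap.mk₂_apply, LinearMap.coe_mk, AddHom.coe_mk, X.y_adj, X.comm]
      ext <;> simp
    comm := X.comm }

theorem quad_dim {δ : K} [Fact (∀ r : K, r ^ 2 ≠ δ + 0 * r)]
    (X : FormSpace K) (hδ : δ ≠ 0) (hX : ∀ v, X.t (X.t v) = δ • v) :
    2 * (X.quad hδ hX).dim = X.dim := by
  let := X.quadModule hX
  have := X.quad_isScalarTower hX
  have := Module.finrank_mul_finrank K (QuadraticAlgebra K δ 0) X.V
  rwa [QuadraticAlgebra.finrank_eq_two] at this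

/-- Restricting an isomorphism to the ground field. -/
def isoOfQuad {δ : K} [Fact (∀ r : K, r ^ 2 ≠ δ + 0 * r)] {X Y : FormSpace K} (hδ : δ ≠ 0)
    (hX : ∀ v, X.t (X.t v) = δ • v)
    (hY : ∀ v, Y.t (Y.t v) = δ • v) (f : Iso (X.quad hδ hX) (Y.quad hδ hY)) : Iso X Y where
  e :=
    { f.e.toEquiv with
      map_add' := map_add f.e
      map_smul' := fun r v => by
        let v' : (X.quad hδ hX).V := v
        have h := map_smul f.e (⟨r, 0⟩ : QuadraticAlgebra K δ 0) v'
        have h1 : (⟨r, 0⟩ : QuadraticAlgebra K δ 0) • v' = (r • v : X.V) :=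
          (X.quad_smul_def hX _ v).trans (by rw [zero_smul, add_zero])
        have h2 : (⟨r, 0⟩ : QuadraticAlgebra K δ 0) • (f.e v') =
            (r • (show Y.V from f.e v) : Y.V) :=
          (Y.quad_smul_def hY _ _).trans (by rw [zero_smul, add_zero])
        exact (congrArg f.e h1).symm.trans (h.trans h2) }
  map_J v w := congrArg QuadraticAlgebra.re (f.map_J v w)
  map_t v := f.map_t v
  map_y v := f.map_y v

theorem quad_y_pow {δ : K} [Fact (∀ r : K, r ^ 2 ≠ δ + 0 * r)]
    (X : FormSpace K) (hδ : δ ≠ 0) (hX : ∀ v, X.t (X.t v) = δ • v) (n : ℕ)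
    (v : X.V) : ((X.quad hδ hX).y ^ n) v = (X.y ^ n) v := by
  induction n generalizing v with
  | zero => rfl
  | succ n ih =>
    rw [pow_succ, pow_succ, Module.End.mul_apply, Module.End.mul_apply]
    exact ih (X.y v)

theorem isNil_quad {δ : K} [Fact (∀ r : K, r ^ 2 ≠ δ + 0 * r)]
    {m : ℕ} {X : FormSpace K} (hδ : δ ≠ 0) (hX : IsBadSemisimple δ (2 * m) X) :
    IsNil (⟨0, 1⟩ : QuadraticAlgebra K δ 0) m m (X.quad hδ hX.sq) := by
  have hd := X.quad_dim hδ hX.sq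
  rw [hX.dim_eq] at hd
  have hd : (X.quad hδ hX.sq).dim = m := by omega
  refine ⟨fun v => ?_, ?_, hd⟩
  · exact ((X.quad_smul_def hX.sq _ v).trans (by simp)).symm
  · have h := y_pow_dim (X := X.quad hδ hX.sq) ⟨2 * m, LinearMap.ext fun v => ?_⟩
    · rwa [hd] at h
    · exact (X.quad_y_pow hδ hX.sq _ v).trans (by rw [hX.nil]; rfl)

theorem wt_isBad_nonsq_le [Fintype K] {δ : K} (hK : ringChar K ≠ 2) (hδ : ¬ IsSquare δ) (m : ℕ) :
    wt (classes (IsBad δ (2 * m))) ≤ 2 * (nilBound m m : ℕ) := by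
  have hδ0 : δ ≠ 0 := fun h => hδ (h ▸ IsSquare.zero)
  have hf : Fact (∀ r : K, r ^ 2 ≠ δ + 0 * r) :=
    ⟨fun r h => hδ ⟨r, by rw [← pow_two, h]; ring⟩⟩
  have hL : ringChar (QuadraticAlgebra K δ 0) ≠ 2 := by
    rwa [← Algebra.ringChar_eq K (QuadraticAlgebra K δ 0)]
  let : Fintype (QuadraticAlgebra K δ 0) :=
    Fintype.ofEquiv _ (QuadraticAlgebra.equivProd δ (0 : K)).symm
  refine (wt_isBad_le hK hδ0 _).trans ((wt_le _).trans (mul_le_mul' le_rfl ?_))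
  refine le_trans ?_ (encard_isNil_le hL (⟨0, 1⟩ : QuadraticAlgebra K δ 0) m m)
  exact encard_classes_le (fun X hX => X.quad hδ0 hX.sq) (fun X hX => isNil_quad hδ0 hX)
    fun X Y hX hY f => ⟨isoOfQuad hδ0 hX.sq hY.sq f⟩

/-- The polynomial `X ^ 2 - δ`. -/
def quadPoly (δ : K) : K[X] := Polynomial.X ^ 2 - C δ

/-- The spaces with `y ^ 2 = t ^ 2 - δ` and injective `y`. -/
structure IsGood (δ : K) (X : FormSpace K) : Prop where
  sq : ∀ v, X.y (X.y v) = X.t (X.t v) - δ • v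
  inj : ∀ v, X.y v = 0 → v = 0

theorem IsGood.aeval_quadPoly {δ : K} {X : FormSpace K} (hX : IsGood δ X) (v : X.V) :
    aeval X.t (quadPoly δ) v = X.y (X.y v) := by
  rw [hX.sq, quadPoly]
  simp [pow_two, Algebra.algebraMap_eq_smul_one]

theorem IsGood.isCoprime {δ : K} {X : FormSpace K} (hX : IsGood δ X) :
    IsCoprime (minpoly K X.t) (quadPoly δ) := by
  rw [← EuclideanDomain.gcd_isUnit_iff]
  set g := EuclideanDomain.gcd (minpoly K X.t) (quadPoly δ)
  obtain ⟨h', hh'⟩ : g ∣ minpoly K X.t := EuclideanDomain.gcd_dvd_left _ _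
  obtain ⟨e, he⟩ : g ∣ quadPoly δ := EuclideanDomain.gcd_dvd_right _ _
  have h0 : minpoly K X.t ≠ 0 := minpoly.ne_zero (Algebra.IsIntegral.isIntegral _)
  have h1 : aeval X.t h' = 0 := by
    refine LinearMap.ext fun v => hX.inj _ (hX.inj _ ?_)
    have h2 : aeval X.t (e * minpoly K X.t) v = 0 := by
      rw [map_mul, minpoly.aeval, mul_zero, LinearMap.zero_apply]
    rw [← hX.aeval_quadPoly, he, ← Module.End.mul_apply, ← map_mul, ← h2, hh']
    congr 2; ring
  obtain ⟨k, hk⟩ := minpoly.dvd K X.t h1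
  refine IsUnit.of_mul_eq_one k ?_
  have : h' ≠ 0 := fun h => h0 (by rw [hh', h, mul_zero])
  refine mul_left_cancel₀ this ?_
  rw [mul_one]
  nth_rewrite 2 [hk]
  rw [hh']; ring

/-- The moments of a vector. -/
def moment (X : FormSpace K) (v : X.V) : K[X] →ₗ[K] K := (X.J.flip v).comp (orb X.t v)

theorem moment_apply (X : FormSpace K) (v : X.V) (e : K[X]) :
    X.moment v e = X.J (aeval X.t e v) v := rfl

theorem J_orb_t (X : FormSpace K) (v : X.V) (a b : K[X]) :
    X.J (orb X.t v a) (orb X.t v b) = X.moment v (a * b) := by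
  rw [orb_apply, orb_apply, ← J_aeval_t, moment_apply, ← Module.End.mul_apply, ← map_mul, mul_comm]

/-- Vectors with annihilator generated by `h` whose moments are nondegenerate. -/
structure GoodGen (X : FormSpace K) (h : K[X]) (v : X.V) : Prop where
  zero : aeval X.t h v = 0
  dvd : ∀ e, (∀ e', X.moment v (e * e') = 0) → h ∣ e

theorem GoodGen.orb_eq_zero {X : FormSpace K} {h : K[X]} {v : X.V} (hv : GoodGen X h v)
    (e : K[X]) : orb X.t v e = 0 ↔ h ∣ e := by
  constructor
  · intro he
    refine hv.dvd e fun e' => ?_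
    rw [← J_orb_t, he]; simp
  · rintro ⟨k, rfl⟩
    rw [orb_apply, mul_comm, map_mul, Module.End.mul_apply, hv.zero, map_zero]

theorem J_y_orb (h2 : (2 : K) ≠ 0) (X : FormSpace K) (v : X.V) (a b : K[X]) :
    X.J (X.y (orb X.t v a)) (orb X.t v b) = 0 := by
  have h0 : aeval X.t b (aeval X.t a v) = aeval X.t (b * a) v := by
    rw [map_mul, Module.End.mul_apply]
  rw [orb_apply, orb_apply, ← J_aeval_t, ← X.y_aeval_t, h0]
  set e := b * a
  have h1 : X.J (X.y (aeval X.t e v)) v = - X.J (X.y (aeval X.t e v)) v := by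
    conv_lhs => rw [X.y_adj, J_aeval_t, X.symm, ← X.y_aeval_t]
  have h3 : 2 * X.J (X.y (aeval X.t e v)) v = 0 := by linear_combination h1
  exact (mul_eq_zero.1 h3).resolve_left h2

/-- The presentation of the span of a vector. -/
def goodMap (X : FormSpace K) (v : X.V) : K[X] × K[X] →ₗ[K] X.V :=
  (orb X.t v).coprod (X.y.comp (orb X.t v))

theorem goodMap_apply (X : FormSpace K) (v : X.V) (m : K[X] × K[X]) :
    X.goodMap v m = orb X.t v m.1 + X.y (orb X.t v m.2) := rfl

theorem t_goodMap (X : FormSpace K) (v : X.V) (m : K[X] × K[X]) :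
    X.t (X.goodMap v m) = X.goodMap v (Polynomial.X * m.1, Polynomial.X * m.2) := by
  rw [goodMap_apply, goodMap_apply, map_add, X.comm, apply_orb, apply_orb]

theorem IsGood.y_y_orb {δ : K} {X : FormSpace K} (hX : IsGood δ X) (v : X.V) (e : K[X]) :
    X.y (X.y (orb X.t v e)) = orb X.t v (quadPoly δ * e) := by
  rw [← hX.aeval_quadPoly, orb_apply, orb_apply, map_mul, Module.End.mul_apply]

theorem y_goodMap {δ : K} {X : FormSpace K} (hX : IsGood δ X) (v : X.V) (m : K[X] × K[X]) :
    X.y (X.goodMap v m) = X.goodMap v (quadPoly δ * m.2, m.1) := by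
  rw [goodMap_apply, goodMap_apply, map_add, hX.y_y_orb, add_comm]

theorem J_goodMap (h2 : (2 : K) ≠ 0) {δ : K} {X : FormSpace K} (hX : IsGood δ X) (v : X.V)
    (m m' : K[X] × K[X]) : X.J (X.goodMap v m) (X.goodMap v m') =
      X.moment v (m.1 * m'.1) - X.moment v (quadPoly δ * m.2 * m'.2) := by
  have h1 : X.J (orb X.t v m.1) (X.y (orb X.t v m'.2)) = 0 := by rw [X.symm, J_y_orb h2]
  have h3 : X.J (X.y (orb X.t v m.2)) (X.y (orb X.t v m'.2)) =
      - X.moment v (quadPoly δ * m.2 * m'.2) := by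
    rw [← J_orb_t, ← hX.y_y_orb, X.y_adj (X.y _), neg_neg]
  rw [goodMap_apply, goodMap_apply, map_add, map_add, LinearMap.add_apply, LinearMap.add_apply,
    J_orb_t, J_y_orb h2, h1, h3]
  ring

theorem GoodGen.goodMap_eq_zero (h2 : (2 : K) ≠ 0) {δ : K} {X : FormSpace K} (hX : IsGood δ X)
    {h : K[X]} (hh : IsCoprime h (quadPoly δ)) {v : X.V} (hv : GoodGen X h v) {m : K[X] × K[X]}
    (hm : ∀ m', X.J (X.goodMap v m) (X.goodMap v m') = 0) : h ∣ m.1 ∧ h ∣ m.2 := by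
  constructor
  · refine hv.dvd _ fun e' => ?_
    have := hm (e', 0)
    rw [J_goodMap h2 hX] at this
    simpa using this
  · refine hh.dvd_of_dvd_mul_left (hv.dvd _ fun e' => ?_)
    have := hm (0, e')
    rw [J_goodMap h2 hX] at this
    simpa using this

theorem GoodGen.isBlock (h2 : (2 : K) ≠ 0) {δ : K} {X : FormSpace K} (hX : IsGood δ X)
    {h : K[X]} (hh : IsCoprime h (quadPoly δ)) {v : X.V} (hv : GoodGen X h v) :
    X.IsBlock (LinearMap.range (X.goodMap v)) := by
  refine isBlock_range _ _ _ (X.t_goodMap v) (y_goodMap hX v) fun m hm => ?_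
  obtain ⟨h1, h3⟩ := hv.goodMap_eq_zero h2 hX hh hm
  rw [goodMap_apply, (hv.orb_eq_zero _).2 h1, (hv.orb_eq_zero _).2 h3, map_zero, add_zero]

theorem GoodGen.finrank (h2 : (2 : K) ≠ 0) {δ : K} {X : FormSpace K} (hX : IsGood δ X)
    {h : K[X]} (hh : IsCoprime h (quadPoly δ)) {v : X.V} (hv : GoodGen X h v) :
    Module.finrank K (LinearMap.range (X.goodMap v)) = 2 * h.natDegree := by
  refine finrank_range_coprod _ _ hv.orb_eq_zero (fun e => ?_) fun a b hab => ?_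
  · rw [← hv.orb_eq_zero]
    exact ⟨fun h => hX.inj _ h, fun h => by rw [LinearMap.comp_apply, h, map_zero]⟩
  · refine (hv.orb_eq_zero _).2 (hv.goodMap_eq_zero h2 hX hh (m := (a, b)) fun m' => ?_).1
    rw [goodMap_apply]
    exact (congrArg (fun u => X.J u _) hab).trans (by simp)

theorem exists_J_self_ne_zero (h2 : (2 : K) ≠ 0) (X : FormSpace K) {e : K[X]}
    (he : aeval X.t e ≠ 0) : ∃ v, X.J (aeval X.t e v) v ≠ 0 := by
  by_contra! hc
  refine he (LinearMap.ext fun v => X.nondeg _ fun w => ?_)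
  have h1 := hc (v + w)
  have h3 : X.J (aeval X.t e w) v = X.J (aeval X.t e v) w := by
    rw [J_aeval_t, X.symm]
  simp only [map_add, LinearMap.add_apply, hc, h3, zero_add, add_zero] at h1
  have h4 : 2 * X.J (aeval X.t e v) w = 0 := by linear_combination h1
  exact (mul_eq_zero.1 h4).resolve_left h2

theorem moment_orb (X : FormSpace K) (v : X.V) (a e : K[X]) :
    X.moment (orb X.t v a) e = X.moment v (a * a * e) := by
  rw [moment_apply, orb_apply, ← Module.End.mul_apply, ← map_mul, ← orb_apply, ← orb_apply,
    J_orb_t]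
  congr 1; ring

theorem exists_goodGen_of_mul_eq_minpoly (h2 : (2 : K) ≠ 0) (X : FormSpace K) (h : K[X]) :
    ∀ h', h * h' = minpoly K X.t → IsCoprime h h' → ∃ v, GoodGen X h v := by
  have h0 : minpoly K X.t ≠ 0 := minpoly.ne_zero (Algebra.IsIntegral.isIntegral _)
  induction h using UniqueFactorizationMonoid.induction_on_coprime with
  | h0 =>
    intro h' hh'
    exact absurd (by rw [← hh', zero_mul]) h0
  | h1 hu =>
    intro h' _ _
    exact ⟨0, by simp, fun e _ => hu.dvd⟩
  | hpr k hp =>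
    rename_i p
    intro h' hh' hc
    rcases Nat.eq_zero_or_pos k with rfl | hk
    · exact ⟨0, by simp, fun e _ => by simp⟩
    obtain ⟨k, rfl⟩ := Nat.exists_eq_add_of_le' hk
    have hne : aeval X.t (p ^ k * h') ≠ 0 := by
      intro h
      obtain ⟨c, hc⟩ := minpoly.dvd K X.t h
      have h3 : p ^ k * h' ≠ 0 := by
        intro h
        refine h0 ?_
        rw [← hh', pow_succ, mul_right_comm, h, zero_mul]
      refine hp.not_isUnit (IsUnit.of_mul_eq_one c (mul_left_cancel₀ h3 ?_))
      rw [mul_one]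
      nth_rewrite 2 [hc]
      rw [← hh', pow_succ]; ring
    obtain ⟨v, hv⟩ := X.exists_J_self_ne_zero h2 hne
    refine ⟨orb X.t v h', ?_, fun e he => ?_⟩
    · rw [orb_apply, ← Module.End.mul_apply, ← map_mul, hh', minpoly.aeval, LinearMap.zero_apply]
    · by_contra hdvd
      have hp' : Irreducible p := hp.irreducible
      have he0 : e ≠ 0 := fun h => hdvd (h ▸ dvd_zero _)
      obtain ⟨i, e1, hpe1, rfl⟩ : ∃ i, ∃ e1, ¬ p ∣ e1 ∧ e = p ^ i * e1 :=
        WfDvdMonoid.max_power_factor he0 hp'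
      have hi : i ≤ k := by
        by_contra hi
        exact hdvd (Dvd.dvd.mul_right (pow_dvd_pow p (by omega)) _)
      have hc1 : IsCoprime (p ^ (k + 1)) (e1 * h') :=
        IsCoprime.mul_right (((hp'.coprime_iff_not_dvd).2 hpe1).pow_left) hc
      obtain ⟨r, s, hrs⟩ := hc1
      refine hv ?_
      have h3 := he (p ^ (k - i) * s)
      rw [moment_orb] at h3
      have e2 : h' * h' * (p ^ i * e1 * (p ^ (k - i) * s)) =
          p ^ k * h' - p ^ k * r * minpoly K X.t := by
        have e3 : p ^ i * p ^ (k - i) = p ^ k := by rw [← pow_add, Nat.add_sub_cancel' hi]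
        rw [← hh']
        linear_combination h' * h' * e1 * s * e3 + p ^ k * h' * hrs
      rw [e2, map_sub, moment_apply, moment_apply, map_mul (aeval X.t) (p ^ k * r), minpoly.aeval,
        mul_zero, LinearMap.zero_apply, map_zero, LinearMap.zero_apply, sub_zero] at h3
      exact h3
  | hcp hxy hx hy =>
    rename_i a b
    intro h' hh' hc
    have hab : IsCoprime a b := hxy.isCoprime
    obtain ⟨v, hv⟩ := hx (b * h') (by rw [← hh', mul_assoc]) (hab.mul_right hc.of_mul_left_left)
    obtain ⟨w, hw⟩ := hy (a * h') (by rw [← hh']; ring) (hab.symm.mul_right hc.of_mul_left_right)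
    obtain ⟨r, s, hrs⟩ := hab
    have hcross : ∀ e : K[X], X.J (aeval X.t e v) w = 0 := by
      intro e
      have h1 : e = r * e * a + s * e * b := by linear_combination (-e) * hrs
      have h3 : aeval X.t (r * e * a) v = 0 := by
        rw [map_mul, Module.End.mul_apply, hv.zero, map_zero]
      have h4 : aeval X.t (s * e * b) w = 0 := by
        rw [map_mul, Module.End.mul_apply, hw.zero, map_zero]
      rw [h1, map_add, LinearMap.add_apply, h3, zero_add, J_aeval_t, h4, map_zero]
    have hm : ∀ e, X.moment (v + w) e = X.moment v e + X.moment w e := by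
      intro e
      have h1 : X.J (aeval X.t e w) v = 0 := by rw [J_aeval_t, X.symm, hcross]
      simp only [moment_apply, map_add, LinearMap.add_apply, hcross, h1, zero_add, add_zero]
    have hzv : ∀ e, X.moment v (a * e) = 0 := fun e => by
      rw [← J_orb_t, orb_apply, hv.zero]; simp
    have hzw : ∀ e, X.moment w (b * e) = 0 := fun e => by
      rw [← J_orb_t, orb_apply, hw.zero]; simp
    refine ⟨v + w, ?_, fun e he => ?_⟩
    · rw [map_add, map_mul, Module.End.mul_apply, Module.End.mul_apply, hw.zero, map_zero, add_zero,
        ← Module.End.mul_apply, ← map_mul, mul_comm, map_mul, Module.End.mul_apply, hv.zero,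
        map_zero]
    · have hab : IsCoprime a b := ⟨r, s, hrs⟩
      refine hab.mul_dvd ?_ ?_
      · refine hab.dvd_of_dvd_mul_left (hv.dvd _ fun e' => ?_)
        have h1 := he (b * e')
        rw [hm, show e * (b * e') = b * (e * e') by ring, hzw, add_zero] at h1
        rw [← h1]; congr 1; ring
      · refine hab.symm.dvd_of_dvd_mul_left (hw.dvd _ fun e' => ?_)
        have h1 := he (a * e')
        rw [hm, show e * (a * e') = a * (e * e') by ring, hzv, zero_add] at h1
        rw [← h1]; congr 1; ring

theorem exists_goodGen (h2 : (2 : K) ≠ 0) (X : FormSpace K) :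
    ∃ v, GoodGen X (minpoly K X.t) v :=
  X.exists_goodGen_of_mul_eq_minpoly h2 _ 1 (mul_one _) isCoprime_one_right

theorem exists_norm_eq_irreducible [Fintype K] (hK : ringChar K ≠ 2) (Δ : K[X]) {p : K[X]}
    (hp : Irreducible p) (hc : ¬ p ∣ Δ) (u : K[X]) : ∃ α β, p ∣ α ^ 2 - Δ * β ^ 2 - u := by
  have : Fact (Irreducible p) := ⟨hp⟩
  have : Module.Finite K (AdjoinRoot p) := (AdjoinRoot.powerBasis hp.ne_zero).finite
  have : Finite (AdjoinRoot p) := Module.finite_of_finite K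
  let _ : Fintype (AdjoinRoot p) := Fintype.ofFinite _
  have h2 : (2 : AdjoinRoot p) ≠ 0 := by
    have h := (map_ne_zero (algebraMap K (AdjoinRoot p))).2 (Ring.two_ne_zero hK)
    rwa [map_ofNat] at h
  have hodd := FiniteField.odd_card_of_char_ne_two (F := AdjoinRoot p)
    fun h => h2 (by exact_mod_cast h ▸ ringChar.Nat.cast_ringChar (R := AdjoinRoot p))
  have hΔ : AdjoinRoot.mk p Δ ≠ 0 := by rwa [Ne, AdjoinRoot.mk_eq_zero]
  obtain ⟨a, b, hab⟩ := FiniteField.exists_root_sum_quadratic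
    (f := (Polynomial.X ^ 2 : (AdjoinRoot p)[X]))
    (g := C (-(AdjoinRoot.mk p Δ)) * Polynomial.X ^ 2
        + C 0 * Polynomial.X + C (-(AdjoinRoot.mk p u)))
    (by simp) (degree_quadratic (neg_ne_zero.2 hΔ)) hodd
  obtain ⟨α, rfl⟩ := AdjoinRoot.mk_surjective a
  obtain ⟨β, rfl⟩ := AdjoinRoot.mk_surjective b
  refine ⟨α, β, ?_⟩
  rw [← AdjoinRoot.mk_eq_zero]
  simp only [eval_add, eval_pow, eval_X, eval_mul, eval_C] at hab
  rw [map_sub, map_sub, map_mul, map_pow, map_pow]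
  linear_combination hab

/-- Every unit modulo `h` is a value of `x ^ 2 - Δ y ^ 2` when `Δ` is a unit modulo `h`. -/
theorem exists_norm_eq [Fintype K] (hK : ringChar K ≠ 2) (Δ h : K[X]) :
    h ≠ 0 → IsCoprime h Δ → ∀ u, IsCoprime h u → ∃ α β, h ∣ α ^ 2 - Δ * β ^ 2 - u := by
  induction h using UniqueFactorizationMonoid.induction_on_coprime with
  | h0 => exact fun h => absurd rfl h
  | h1 hu => exact fun _ _ _ _ => ⟨0, 0, hu.dvd⟩
  | hpr k hp =>
    rename_i p
    intro _ hc u hu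
    have hp' := hp.irreducible
    induction k with
    | zero => exact ⟨0, 0, by simp⟩
    | succ k ih =>
      rw [IsCoprime.pow_left_iff (Nat.succ_pos k)] at hc hu
      have hpΔ := (hp'.coprime_iff_not_dvd).1 hc
      have hpu := (hp'.coprime_iff_not_dvd).1 hu
      rcases Nat.eq_zero_or_pos k with rfl | hk
      · simpa using exists_norm_eq_irreducible hK Δ hp' hpΔ u
      obtain ⟨α, β, c, hcc⟩ := ih (pow_ne_zero _ hp.ne_zero) hc.pow_left hu.pow_left
      have h2 : IsCoprime p (2 : K[X]) := by
        have h3 : IsUnit (C (2 : K)) := isUnit_C.2 (Ring.two_ne_zero hK).isUnit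
        rw [map_ofNat] at h3
        exact isCoprime_one_right.of_isCoprime_of_dvd_right h3.dvd
      obtain ⟨k, rfl⟩ := Nat.exists_eq_add_of_le' hk
      by_cases hα : p ∣ α
      · have hβ : ¬ p ∣ β := by
          intro hβ
          refine hpu ?_
          have h3 : u = α ^ 2 - Δ * β ^ 2 - p ^ (k + 1) * c := by rw [← hcc]; ring
          rw [h3]
          refine dvd_sub (dvd_sub (hα.trans (dvd_pow_self _ two_ne_zero))
            (Dvd.dvd.mul_left (hβ.trans (dvd_pow_self _ two_ne_zero)) _)) ?_
          rw [pow_succ', mul_assoc]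
          exact dvd_mul_right _ _
        obtain ⟨r, s, hrs⟩ := h2.mul_right (hc.mul_right ((hp'.coprime_iff_not_dvd).2 hβ))
        refine ⟨α, β + p ^ (k + 1) * (c * s), c * r - Δ * p ^ k * (c * s) ^ 2, ?_⟩
        linear_combination hcc - p ^ (k + 1) * c * hrs
      · obtain ⟨r, s, hrs⟩ := h2.mul_right ((hp'.coprime_iff_not_dvd).2 hα)
        refine ⟨α - p ^ (k + 1) * (c * s), β, c * r + p ^ k * (c * s) ^ 2, ?_⟩
        linear_combination hcc - p ^ (k + 1) * c * hrs
  | hcp hxy hx hy =>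
    rename_i a b
    intro h0 hc u hu
    have hab : IsCoprime a b := hxy.isCoprime
    obtain ⟨α, β, c, h1⟩ := hx (left_ne_zero_of_mul h0) hc.of_mul_left_left u hu.of_mul_left_left
    obtain ⟨γ, ε, d, h2⟩ := hy (right_ne_zero_of_mul h0) hc.of_mul_left_right u hu.of_mul_left_right
    obtain ⟨r, s, hrs⟩ := hab
    have hab : IsCoprime a b := ⟨r, s, hrs⟩
    have e1 : s * b = 1 - r * a := by linear_combination hrs
    have e2 : r * a = 1 - s * b := by linear_combination hrs
    refine ⟨s * b * α + r * a * γ, s * b * β + r * a * ε, hab.mul_dvd ?_ ?_⟩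
    · rw [e1]
      refine ⟨c + r * ((γ - α) * (2 * α + r * a * (γ - α)) -
        Δ * (ε - β) * (2 * β + r * a * (ε - β))), ?_⟩
      linear_combination h1
    · rw [e2]
      refine ⟨d + s * ((α - γ) * (2 * γ + s * b * (α - γ)) -
        Δ * (β - ε) * (2 * ε + s * b * (β - ε))), ?_⟩
      linear_combination h2

theorem GoodGen.moment_mul {X : FormSpace K} {h : K[X]} {v : X.V} (hv : GoodGen X h v)
    (e : K[X]) : X.moment v (h * e) = 0 := by
  rw [← J_orb_t, orb_apply, hv.zero, map_zero, LinearMap.zero_apply]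

theorem GoodGen.exists_moment_eq {X : FormSpace K} {h : K[X]} (hm : h.Monic) {v : X.V}
    (hv : GoodGen X h v) (ψ : K[X] →ₗ[K] K) (hψ : ∀ e, ψ (h * e) = 0) :
    ∃ u, ∀ e, ψ e = X.moment v (u * e) := by
  set W := degreeLT K h.natDegree
  have : Module.Finite K W := Module.Finite.equiv (degreeLTEquiv K h.natDegree).symm
  have hmod : ∀ e, e %ₘ h ∈ W := fun e => by
    rw [mem_degreeLT, ← degree_eq_natDegree hm.ne_zero]
    exact degree_modByMonic_lt _ hm
  let L : W →ₗ[K] Module.Dual K W :=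
    LinearMap.mk₂ K (fun a b : W => X.moment v ((a : K[X]) * (b : K[X])))
      (fun a b c => by simp [add_mul]) (fun a b c => by simp)
      (fun a b c => by simp [mul_add]) (fun a b c => by simp)
  have hL : Function.Injective L := by
    rw [injective_iff_map_eq_zero]
    intro a ha
    have h1 : h ∣ (a : K[X]) := by
      refine hv.dvd _ fun e => ?_
      have h3 : X.moment v (a * (e %ₘ h)) = 0 := LinearMap.congr_fun ha ⟨_, hmod e⟩
      rw [← modByMonic_add_div e h, mul_add, map_add, h3, mul_left_comm, hv.moment_mul, add_zero]
    have h3 := mem_degreeLT.1 a.2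
    rw [← degree_eq_natDegree hm.ne_zero] at h3
    exact Subtype.ext (eq_zero_of_dvd_of_degree_lt h1 h3)
  obtain ⟨u, hu⟩ := (LinearMap.injective_iff_surjective_of_finrank_eq_finrank
    (Subspace.dual_finrank_eq (K := K) (V := W)).symm).1 hL (ψ.comp W.subtype)
  refine ⟨u, fun e => ?_⟩
  have h3 : X.moment v (u * (e %ₘ h)) = ψ (e %ₘ h) := LinearMap.congr_fun hu ⟨_, hmod e⟩
  have h4 := modByMonic_add_div e h
  rw [← h4, map_add, hψ, mul_add, map_add, h3, mul_left_comm, hv.moment_mul]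

theorem aeval_goodMap (X : FormSpace K) (v : X.V) (e : K[X]) (m : K[X] × K[X]) :
    aeval X.t e (X.goodMap v m) = X.goodMap v (e * m.1, e * m.2) := by
  rw [goodMap_apply, goodMap_apply, map_add, ← X.y_aeval_t]
  simp only [orb_apply, map_mul, Module.End.mul_apply]

theorem cls_sub_congr (X : FormSpace K) {C C' : Submodule K X.V} (h : C = C') (hC : X.IsBlock C)
    (hC' : X.IsBlock C') : cls (X.sub C hC) = cls (X.sub C' hC') := by
  subst h; rfl

theorem GoodGen.cls_sub_eq [Fintype K] (hK : ringChar K ≠ 2) {δ : K} {X Y : FormSpace K}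
    (hX : IsGood δ X) (hY : IsGood δ Y) {h : K[X]} (hm : h.Monic) (hh : IsCoprime h (quadPoly δ))
    {v : X.V} (hv : GoodGen X h v) {w : Y.V} (hw : GoodGen Y h w) :
    cls (X.sub _ (hv.isBlock (Ring.two_ne_zero hK) hX hh)) =
      cls (Y.sub _ (hw.isBlock (Ring.two_ne_zero hK) hY hh)) := by
  have h2 := Ring.two_ne_zero hK
  obtain ⟨u, hu⟩ := hv.exists_moment_eq hm (Y.moment w) hw.moment_mul
  have huc : IsCoprime h u := by
    rw [← EuclideanDomain.gcd_isUnit_iff]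
    set g := EuclideanDomain.gcd h u
    obtain ⟨h', hh'⟩ : g ∣ h := EuclideanDomain.gcd_dvd_left _ _
    obtain ⟨u', hu'⟩ : g ∣ u := EuclideanDomain.gcd_dvd_right _ _
    obtain ⟨k, hk⟩ : h ∣ h' := by
      refine hw.dvd _ fun e => ?_
      rw [hu, hu', show g * u' * (h' * e) = g * h' * (u' * e) by ring, ← hh', hv.moment_mul]
    refine IsUnit.of_mul_eq_one k (mul_left_cancel₀ hm.ne_zero ?_)
    have : h * (g * k) = g * (h * k) := by ring
    rw [this, ← hk, ← hh', mul_one]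
  obtain ⟨α, β, c, hc⟩ := exists_norm_eq hK (quadPoly δ) h hm.ne_zero hh u huc
  set v' := X.goodMap v (α, β)
  have hmom : ∀ e, X.moment v' e = Y.moment w e := by
    intro e
    rw [moment_apply, aeval_goodMap, J_goodMap h2 hX, hu, ← map_sub]
    have : e * α * α - quadPoly δ * (e * β) * β = u * e + h * (c * e) := by
      linear_combination e * hc
    simp only [this, map_add, hv.moment_mul, add_zero]
  have hv' : GoodGen X h v' := by
    refine ⟨?_, fun e he => hw.dvd e fun e' => by rw [← hmom, he]⟩
    rw [aeval_goodMap, goodMap_apply, (hv.orb_eq_zero _).2 (dvd_mul_right _ _),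
      (hv.orb_eq_zero _).2 (dvd_mul_right _ _), map_zero, add_zero]
  have hle : LinearMap.range (X.goodMap v') ≤ LinearMap.range (X.goodMap v) := by
    rintro _ ⟨m, rfl⟩
    rw [goodMap_apply, orb_apply, orb_apply, aeval_goodMap, aeval_goodMap, y_goodMap hX, ← map_add]
    exact ⟨_, rfl⟩
  have heq := Submodule.eq_of_le_of_finrank_eq hle
    (by rw [hv.finrank h2 hX hh, hv'.finrank h2 hX hh])
  rw [cls_sub_congr X heq.symm _ (hv'.isBlock h2 hX hh)]
  refine cls_range_eq (X.goodMap v') (Y.goodMap w) _ _ _ _ (X.t_goodMap v') (y_goodMap hX v')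
    (Y.t_goodMap w) (y_goodMap hY w) fun a b => ?_
  rw [J_goodMap h2 hX, J_goodMap h2 hY, hmom, hmom]

theorem encard_monic_le [Fintype K] (k : ℕ) :
    {p : K[X] | p.Monic ∧ p.natDegree = k}.encard ≤ ((Fintype.card K ^ k : ℕ) : ℕ∞) := by
  have h : (Set.univ : Set (Fin k → K)).encard = ((Fintype.card K ^ k : ℕ) : ℕ∞) := by
    rw [Set.encard_univ, ENat.card_eq_coe_fintype_card]; simp
  rw [← h]
  refine Set.encard_le_encard_of_injOn (f := fun p i => p.coeff i) (Set.mapsTo_univ _ _) ?_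
  rintro p ⟨hp, hpk⟩ r ⟨hr, hrk⟩ hpr
  ext i
  rcases lt_trichotomy i k with hi | rfl | hi
  · exact congrFun hpr ⟨i, hi⟩
  · have h1 := hp.coeff_natDegree
    have h2 := hr.coeff_natDegree
    rw [hpk] at h1
    rw [hrk] at h2
    rw [h1, h2]
  · rw [coeff_eq_zero_of_natDegree_lt (by omega), coeff_eq_zero_of_natDegree_lt (by omega)]

theorem Iso.minpoly_eq {X Y : FormSpace K} (f : Iso X Y) : minpoly K X.t = minpoly K Y.t := by
  refine eq_of_monic_of_associated (minpoly.monic (Algebra.IsIntegral.isIntegral _))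
    (minpoly.monic (Algebra.IsIntegral.isIntegral _)) (associated_of_dvd_dvd ?_ ?_)
  · refine minpoly.dvd _ _ (LinearMap.ext fun v => f.e.injective ?_)
    have := aeval_intertwine f.e.toLinearMap X.t Y.t f.map_t (minpoly K Y.t) v
    rw [minpoly.aeval] at this
    simpa using this
  · refine minpoly.dvd _ _ (LinearMap.ext fun v => ?_)
    have := aeval_intertwine f.e.toLinearMap X.t Y.t f.map_t (minpoly K X.t) (f.e.symm v)
    rw [minpoly.aeval] at this
    simpa using this.symm

/-- The minimal polynomial of `t` on a class. -/
def minpolyCls (c : Cls K) : K[X] := minpoly K (Quotient.out c).t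

theorem minpolyCls_cls (X : FormSpace K) : minpolyCls (cls X) = minpoly K X.t := by
  have h : cls (Quotient.out (cls X)) = cls X := Quotient.out_eq _
  obtain ⟨f⟩ := iso_of_cls_eq h
  exact f.minpoly_eq

theorem IsGood.sub {δ : K} {X : FormSpace K} (hX : IsGood δ X) {C : Submodule K X.V}
    (hC : X.IsBlock C) : IsGood δ (X.sub C hC) where
  sq v := by
    apply X.incl_injective C hC
    rw [map_sub, map_smul, incl_y, incl_y, incl_t, incl_t, hX.sq]
  inj v hv := by
    apply X.incl_injective C hC
    rw [map_zero]
    exact hX.inj _ (by rw [← incl_y, hv, map_zero])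

theorem minpoly_sub_dvd (X : FormSpace K) {C : Submodule K X.V} (hC : X.IsBlock C) :
    minpoly K (X.sub C hC).t ∣ minpoly K X.t := by
  refine minpoly.dvd _ _ (LinearMap.ext fun v => X.incl_injective C hC ?_)
  rw [aeval_intertwine (X.incl C hC) _ X.t (X.incl_t C hC), minpoly.aeval]
  simp

theorem minpoly_monic (X : FormSpace K) : (minpoly K X.t).Monic :=
  minpoly.monic (Algebra.IsIntegral.isIntegral _)

theorem IsGood.exists_split (hK : ringChar K ≠ 2) {δ : K} {X : FormSpace K} (hX : IsGood δ X) :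
    ∃ (v : X.V) (hv : GoodGen X (minpoly K X.t) v),
      X.dim = 2 * (minpoly K X.t).natDegree +
        (X.sub _ (hv.isBlock (Ring.two_ne_zero hK) hX hX.isCoprime).perp).dim := by
  obtain ⟨v, hv⟩ := X.exists_goodGen (Ring.two_ne_zero hK)
  refine ⟨v, hv, ?_⟩
  rw [X.dim_split (hv.isBlock (Ring.two_ne_zero hK) hX hX.isCoprime)]
  congr 1
  exact hv.finrank (Ring.two_ne_zero hK) hX hX.isCoprime

theorem dim_eq_zero_of_minpoly {X : FormSpace K} (h : (minpoly K X.t).natDegree = 0) :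
    X.dim = 0 := by
  have h1 : minpoly K X.t = 1 := (X.minpoly_monic).natDegree_eq_zero.1 h
  have h2 := minpoly.aeval K X.t
  rw [h1, map_one] at h2
  have : Subsingleton X.V := ⟨fun a b => by
    have ha := LinearMap.congr_fun h2 a
    have hb := LinearMap.congr_fun h2 b
    simp only [Module.End.one_apply, LinearMap.zero_apply] at ha hb
    rw [ha, hb]⟩
  exact Module.finrank_zero_of_subsingleton

theorem IsGood.even_dim (hK : ringChar K ≠ 2) {δ : K} :
    ∀ (N : ℕ) (X : FormSpace K), IsGood δ X → X.dim = N → Even N := by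
  intro N
  induction N using Nat.strong_induction_on with
  | _ N ih =>
    intro X hX hN
    rcases Nat.eq_zero_or_pos (minpoly K X.t).natDegree with h0 | h0
    · rw [← hN, dim_eq_zero_of_minpoly h0]; exact Even.zero
    obtain ⟨v, hv, h⟩ := hX.exists_split hK
    have hlt := h
    rw [hN] at hlt
    have := ih _ (by omega) _ (hX.sub (hv.isBlock (Ring.two_ne_zero hK) hX hX.isCoprime).perp) rfl
    rw [← hN, h]
    exact (even_two_mul _).add this

instance : Inhabited (FormSpace K) :=
  ⟨{ V := PUnit, J := 0, t := 0, y := 0, symm := fun _ _ => rfl, nondeg := fun _ _ => rfl,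
     t_adj := fun _ _ => rfl, y_adj := fun _ _ => by simp, comm := fun _ => rfl }⟩

theorem exists_cyc [Fintype K] (hK : ringChar K ≠ 2) (δ : K) : ∃ cyc : K[X] → Cls K,
    ∀ (X : FormSpace K) (hX : IsGood δ X) (v : X.V) (hv : GoodGen X (minpoly K X.t) v),
      cls (X.sub _ (hv.isBlock (Ring.two_ne_zero hK) hX hX.isCoprime)) = cyc (minpoly K X.t) := by
  have H : ∀ h : K[X], ∃ c : Cls K, ∀ (X : FormSpace K) (hX : IsGood δ X) (v : X.V)
      (hv : GoodGen X h v) (hh : h = minpoly K X.t),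
      cls (X.sub _ (hv.isBlock (Ring.two_ne_zero hK) hX (hh ▸ hX.isCoprime))) = c := by
    intro h
    by_cases hex : ∃ (X : FormSpace K) (_ : IsGood δ X) (v : X.V) (_ : GoodGen X h v),
        h = minpoly K X.t
    · obtain ⟨X, hX, v, hv, hh⟩ := hex
      refine ⟨cls (X.sub _ (hv.isBlock (Ring.two_ne_zero hK) hX (hh ▸ hX.isCoprime))), ?_⟩
      intro Y hY w hw _
      exact hw.cls_sub_eq hK hY hX (hh ▸ X.minpoly_monic) (hh ▸ hX.isCoprime) hv
    · exact ⟨cls default, fun X hX v hv hh => absurd ⟨X, hX, v, hv, hh⟩ hex⟩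
  choose f hf using H
  exact ⟨f, fun X hX v hv => hf _ X hX v hv rfl⟩

/-- Good spaces of dimension `2 N` whose minimal polynomial has degree `d`. -/
def IsGoodDeg (δ : K) (d N : ℕ) (X : FormSpace K) : Prop :=
  IsGood δ X ∧ (minpoly K X.t).natDegree = d ∧ X.dim = 2 * N

theorem classes_isGoodDeg_subset [Fintype K] (hK : ringChar K ≠ 2) (δ : K) (d N : ℕ) :
    ∃ f : K[X] × Cls K → Cls K, classes (IsGoodDeg δ d N) ⊆ ⋃ e ∈ Finset.range (d + 1),
      f '' ({p : K[X] | p.Monic ∧ p.natDegree = d - e} ×ˢ classes (IsGoodDeg δ e (N - d))) := by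
  obtain ⟨cyc, hcyc⟩ := exists_cyc hK δ
  refine ⟨fun p => cyc (p.1 * minpolyCls p.2) + p.2, ?_⟩
  rintro _ ⟨X, ⟨hX, hd, hN⟩, rfl⟩
  obtain ⟨v, hv, hdim⟩ := hX.exists_split hK
  have hB := hv.isBlock (Ring.two_ne_zero hK) hX hX.isCoprime
  set Z := X.sub _ hB.perp
  obtain ⟨r, hr⟩ : minpoly K Z.t ∣ minpoly K X.t := X.minpoly_sub_dvd hB.perp
  have hrm : r.Monic := (Z.minpoly_monic).of_mul_monic_left (hr ▸ X.minpoly_monic)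
  have hdeg : (minpoly K Z.t).natDegree + r.natDegree = d := by
    rw [← hd, hr, (Z.minpoly_monic).natDegree_mul hrm]
  simp only [Set.mem_iUnion]
  refine ⟨(minpoly K Z.t).natDegree, Finset.mem_range.2 (by omega), (r, cls Z),
    ⟨⟨hrm, by simp only; omega⟩, mem_classes ⟨hX.sub _, rfl, ?_⟩⟩, ?_⟩
  · rw [hN, hd] at hdim
    change _ = _ + Z.dim at hdim
    omega
  · simp only [minpolyCls_cls]
    rw [mul_comm, ← hr, ← hcyc X hX v hv]
    exact (X.cls_split hB).symm

/-- The number of compositions of `n`. -/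
def numCompositions (n : ℕ) : ℕ := if n = 0 then 1 else 2 ^ (n - 1)

theorem sum_numCompositions (n : ℕ) :
    ∑ i ∈ Finset.range (n + 1), numCompositions i = numCompositions (n + 1) := by
  induction n with
  | zero => simp [numCompositions]
  | succ n ih => rw [Finset.sum_range_succ, ih]; simp [numCompositions, pow_succ, mul_two]

/-- The number of chains of monic polynomials of total degree `N` and top degree `d`,
divided by `q ^ d`. -/
def chainFactor (d N : ℕ) : ℕ :=
  if d = 0 then (if N = 0 then 1 else 0) else if d ≤ N then numCompositions (N - d) else 0

theorem sum_chainFactor_le (d N : ℕ) :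
    ∑ e ∈ Finset.range (d + 1), chainFactor e N ≤ numCompositions N := by
  have h1 : ∑ e ∈ Finset.range (d + 1), chainFactor e N ≤
      ∑ e ∈ Finset.range (N + 1), chainFactor e N := by
    refine Finset.sum_le_sum_of_ne_zero fun e _ he => Finset.mem_range.2 ?_
    by_contra h
    refine he ?_
    rw [chainFactor, if_neg (by omega), if_neg (by omega)]
  refine h1.trans ?_
  rw [Finset.sum_range_succ']
  rcases N with _ | N
  · simp [chainFactor, numCompositions]
  · rw [← sum_numCompositions, ← Finset.sum_range_reflect numCompositions]
    simp only [chainFactor, if_true, Nat.succ_ne_zero, if_false, add_zero]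
    refine Finset.sum_le_sum fun i hi => ?_
    rw [if_pos (by have := Finset.mem_range.1 hi; omega)]
    exact le_of_eq (by congr 1; omega)

theorem encard_isGoodDeg_le [Fintype K] (hK : ringChar K ≠ 2) (δ : K) (N : ℕ) : ∀ d : ℕ,
    (classes (IsGoodDeg δ d N)).encard ≤ ((Fintype.card K ^ d * chainFactor d N : ℕ) : ℕ∞) := by
  induction N using Nat.strong_induction_on with
  | _ N ih =>
    intro d
    have hdN : ∀ X, IsGoodDeg δ d N X → d ≤ N := by
      rintro X ⟨hX, hd, hN⟩
      obtain ⟨v, hv, h⟩ := hX.exists_split hK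
      omega
    rcases Nat.eq_zero_or_pos d with rfl | hd
    · by_cases hN : N = 0
      · subst hN
        refine (encard_classes_dim_zero _ fun X hX => ?_).trans (by simp [chainFactor])
        exact Module.finrank_zero_iff.1 hX.2.2
      · have : classes (IsGoodDeg δ 0 N) = ∅ := by
          rw [Set.eq_empty_iff_forall_notMem]
          rintro _ ⟨X, ⟨hX, hd, hX'⟩, rfl⟩
          have := dim_eq_zero_of_minpoly hd
          omega
        rw [this]; simp
    by_cases hle : d ≤ N
    · obtain ⟨f, hf⟩ := classes_isGoodDeg_subset hK δ d N
      calc (classes (IsGoodDeg δ d N)).encard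
          ≤ ∑ e ∈ Finset.range (d + 1), (f '' ({p : K[X] | p.Monic ∧ p.natDegree = d - e} ×ˢ
              classes (IsGoodDeg δ e (N - d)))).encard :=
            (Set.encard_le_encard hf).trans (Finset.set_encard_biUnion_le _ _)
        _ ≤ ∑ e ∈ Finset.range (d + 1),
              ((Fintype.card K ^ d * chainFactor e (N - d) : ℕ) : ℕ∞) := by
            refine Finset.sum_le_sum fun e he => (Set.encard_image_le _ _).trans ?_
            rw [Set.encard_prod]
            refine (mul_le_mul' (encard_monic_le _) (ih (N - d) (by omega) e)).trans (le_of_eq ?_)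
            have he' := Finset.mem_range.1 he
            rw [← Nat.cast_mul, ← mul_assoc, ← pow_add, Nat.sub_add_cancel (by omega)]
        _ ≤ _ := by
            rw [← Nat.cast_sum, ← Finset.mul_sum, chainFactor, if_neg hd.ne', if_pos hle]
            exact_mod_cast Nat.mul_le_mul_left _ (sum_chainFactor_le _ _)
    · have : classes (IsGoodDeg δ d N) = ∅ := by
        rw [Set.eq_empty_iff_forall_notMem]
        rintro _ ⟨X, hX, rfl⟩
        exact hle (hdN X hX)
      rw [this]; simp

/-- A bound for the number of good classes of dimension `2 N`. -/
def goodBound (q N : ℕ) : ℕ := ∑ d ∈ Finset.range (N + 1), q ^ d * chainFactor d N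

theorem encard_isGood_le [Fintype K] (hK : ringChar K ≠ 2) (δ : K) (N : ℕ) :
    (classes fun X => IsGood δ X ∧ X.dim = 2 * N).encard ≤
      ((goodBound (Fintype.card K) N : ℕ) : ℕ∞) := by
  have h : (classes fun X : FormSpace K => IsGood δ X ∧ X.dim = 2 * N) ⊆
      ⋃ d ∈ Finset.range (N + 1), classes (IsGoodDeg δ d N) := by
    rintro _ ⟨X, ⟨hX, hN⟩, rfl⟩
    obtain ⟨v, hv, h⟩ := hX.exists_split hK
    simp only [Set.mem_iUnion]
    exact ⟨_, Finset.mem_range.2 (by omega), mem_classes ⟨hX, rfl, hN⟩⟩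
  refine ((Set.encard_le_encard h).trans (Finset.set_encard_biUnion_le _ _)).trans ?_
  rw [goodBound, Nat.cast_sum]
  exact Finset.sum_le_sum fun d _ => encard_isGoodDeg_le hK δ N d

theorem star_aeval_omega (δ : K) (p : K[X]) :
    star (aeval (QuadraticAlgebra.omega : QuadraticAlgebra K δ 0) p) =
      aeval (-QuadraticAlgebra.omega : QuadraticAlgebra K δ 0) p := by
  have h1 : star (QuadraticAlgebra.omega : QuadraticAlgebra K δ 0) = -QuadraticAlgebra.omega := by
    ext <;> simp
  have h2 : ∀ a : K, star (algebraMap K (QuadraticAlgebra K δ 0) a) = algebraMap K _ a := by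
    intro a
    ext <;> simp [QuadraticAlgebra.algebraMap_eq]
  induction p using Polynomial.induction_on' with
  | add p r hp hr => rw [map_add, map_add, star_add, hp, hr]
  | monomial n a => rw [aeval_monomial, aeval_monomial, star_mul', star_pow, h1, h2]

theorem det_sq_sub_smul {m : Type} [Fintype m] [DecidableEq m] (δ : K) (M : Matrix m m K) :
    (M * M - δ • (1 : Matrix m m K)).det =
      (aeval (QuadraticAlgebra.omega : QuadraticAlgebra K δ 0) M.charpoly).norm := by
  set w : QuadraticAlgebra K δ 0 := QuadraticAlgebra.omega
  have hw : w * w = algebraMap K (QuadraticAlgebra K δ 0) δ := by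
    rw [QuadraticAlgebra.omega_mul_omega_eq_mk]
    ext <;> simp [QuadraticAlgebra.algebraMap_eq]
  apply (algebraMap K (QuadraticAlgebra K δ 0)).injective
  rw [QuadraticAlgebra.algebraMap_norm_eq_mul_star, star_aeval_omega]
  set Q := (algebraMap K (QuadraticAlgebra K δ 0)).mapMatrix M
  have hx : ∀ x : QuadraticAlgebra K δ 0, aeval x M.charpoly = (Matrix.scalar m x - Q).det := by
    intro x
    change _ = (Matrix.scalar m x - M.map _).det
    rw [← Matrix.eval_charpoly, Matrix.charpoly_map, eval_map_algebraMap]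
  rw [hx, hx, ← Matrix.det_mul, RingHom.map_det]
  congr 1
  have h1 : (algebraMap K (QuadraticAlgebra K δ 0)).mapMatrix (δ • (1 : Matrix m m K)) =
      Matrix.scalar m w * Matrix.scalar m w := by
    rw [← map_mul, hw]
    refine Matrix.ext fun i j => ?_
    by_cases hij : i = j <;> simp [hij]
  have h2 := Matrix.scalar_commute w (fun r => mul_comm w r) Q
  rw [map_sub, map_mul, h1, map_neg]
  change Matrix.scalar m w * Q = Q * Matrix.scalar m w at h2
  rw [sub_mul, mul_sub, mul_sub, mul_neg, mul_neg, h2]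
  abel

/-- The form of `X` has Gram matrix `J` in some basis. -/
def HasGram {N : Type} [Fintype N] (J : Matrix N N K) (X : FormSpace K) : Prop :=
  ∃ f : (N → K) ≃ₗ[K] X.V, ∀ a b, X.J (f a) (f b) = a ⬝ᵥ J *ᵥ b

theorem HasGram.transpose_mul_mul {N m : Type} [Fintype N] {J : Matrix N N K} {X : FormSpace K}
    (hJ : HasGram J X) (e : m → X.V) :
    ∃ Φ : Matrix N m K, ∀ i j, (Φᵀ * J * Φ) i j = X.J (e i) (e j) := by
  obtain ⟨f, hf⟩ := hJ
  refine ⟨Matrix.of fun k j => f.symm (e j) k, fun i j => ?_⟩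
  rw [← f.apply_symm_apply (e i), ← f.apply_symm_apply (e j), hf, Matrix.mul_assoc,
    Matrix.mul_apply, dotProduct]
  simp [Matrix.mul_apply, mulVec, dotProduct]

theorem GoodGen.quadraticChar_norm [Fintype K] (hK : ringChar K ≠ 2) {δ : K} {X : FormSpace K}
    (hX : IsGood δ X) {h : K[X]} (hm : h.Monic) (hh : IsCoprime h (quadPoly δ)) {v : X.V}
    (hv : GoodGen X h v) {n : ℕ} (hn : h.natDegree = n)
    {J : Matrix (Fin n ⊕ Fin n) (Fin n ⊕ Fin n) K} (hJ : HasGram J X) :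
    quadraticChar K (aeval (QuadraticAlgebra.omega : QuadraticAlgebra K δ 0) h).norm =
      quadraticChar K ((-1) ^ n * J.det) := by
  subst hn
  have h2 := Ring.two_ne_zero hK
  let b : Module.Basis (Fin h.natDegree) K (AdjoinRoot h) :=
    (AdjoinRoot.powerBasis hm.ne_zero).basis
  have hb : ∀ i, b i = AdjoinRoot.mk h (Polynomial.X ^ (i : ℕ)) := fun i => by
    rw [map_pow, AdjoinRoot.mk_X]
    exact (AdjoinRoot.powerBasis hm.ne_zero).basis_eq_pow i
  let ψ : AdjoinRoot h →ₗ[K] K := (X.moment v).comp (AdjoinRoot.modByMonicHom hm)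
  have hψ : ∀ e, ψ (AdjoinRoot.mk h e) = X.moment v e := fun e => by
    have h1 : ψ (AdjoinRoot.mk h e) = X.moment v (e %ₘ h) :=
      congrArg (X.moment v) (AdjoinRoot.modByMonicHom_mk hm e)
    rw [h1]
    nth_rewrite 2 [← modByMonic_add_div e h]
    rw [map_add, hv.moment_mul, add_zero]
  set B : Matrix (Fin h.natDegree) (Fin h.natDegree) K := Matrix.of fun i j => ψ (b i * b j)
  set D := Algebra.leftMulMatrix b (AdjoinRoot.mk h (quadPoly δ))
  have hBD : ∀ i j, (B * D) i j = ψ (b i * (AdjoinRoot.mk h (quadPoly δ) * b j)) := by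
    intro i j
    rw [Matrix.mul_apply, ← b.sum_repr (AdjoinRoot.mk h (quadPoly δ) * b j), Finset.mul_sum,
      map_sum]
    refine Finset.sum_congr rfl fun k _ => ?_
    have h1 : D k j = b.repr (AdjoinRoot.mk h (quadPoly δ) * b j) k :=
      Algebra.leftMulMatrix_eq_repr_mul b _ k j
    rw [mul_smul_comm, map_smul, smul_eq_mul, mul_comm, ← h1]
    rfl
  have hD : D.det = (aeval (QuadraticAlgebra.omega : QuadraticAlgebra K δ 0) h).norm := by
    have h1 : D = Algebra.leftMulMatrix b (AdjoinRoot.root h) *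
        Algebra.leftMulMatrix b (AdjoinRoot.root h) - δ • 1 := by
      have h3 : AdjoinRoot.mk h (quadPoly δ) =
          AdjoinRoot.root h * AdjoinRoot.root h - δ • 1 := by
        rw [quadPoly, map_sub, map_pow, AdjoinRoot.mk_X, AdjoinRoot.mk_C, pow_two,
          Algebra.smul_def, mul_one]
        rfl
      change Algebra.leftMulMatrix b _ = _
      rw [h3, map_sub, map_mul, map_smul, map_one]
    have h3 : (Algebra.leftMulMatrix b (AdjoinRoot.root h)).charpoly = h :=
      (charpoly_leftMulMatrix (AdjoinRoot.powerBasis hm.ne_zero)).trans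
        (AdjoinRoot.minpoly_powerBasis_gen_of_monic hm)
    rw [h1, det_sq_sub_smul, h3]
  have hD0 : D.det ≠ 0 := by
    obtain ⟨r, s, hrs⟩ := hh
    have h1 : AdjoinRoot.mk h s * AdjoinRoot.mk h (quadPoly δ) = 1 := by
      rw [← map_mul, ← map_one (AdjoinRoot.mk h), ← hrs, map_add, map_mul _ r, AdjoinRoot.mk_self,
        mul_zero, zero_add]
    have h3 := congrArg (fun a => (Algebra.leftMulMatrix b a).det) h1
    simp only [map_mul, map_one, Matrix.det_mul, Matrix.det_one] at h3
    exact right_ne_zero_of_mul_eq_one h3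
  have hB0 : B.det ≠ 0 := by
    intro h0
    obtain ⟨c, hc0, hc⟩ := Matrix.exists_mulVec_eq_zero_iff.2 h0
    refine hc0 ?_
    set z := ∑ j, c j • b j
    have h1 : ∀ a, ψ (a * z) = 0 := by
      intro a
      rw [← b.sum_repr a, Finset.sum_mul, map_sum]
      refine Finset.sum_eq_zero fun i _ => ?_
      have h3 : ψ (b i * z) = 0 := by
        rw [Finset.mul_sum, map_sum]
        refine Eq.trans ?_ (congrFun hc i)
        refine Finset.sum_congr rfl fun j _ => ?_
        rw [mul_smul_comm, map_smul, smul_eq_mul, mul_comm]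
        rfl
      rw [smul_mul_assoc, map_smul, h3, smul_zero]
    obtain ⟨e, he⟩ := AdjoinRoot.mk_surjective z
    have hz : z = 0 := by
      rw [← he, AdjoinRoot.mk_eq_zero]
      refine hv.dvd e fun e' => ?_
      rw [← hψ, mul_comm, map_mul, he, h1]
    exact funext fun j => Fintype.linearIndependent_iff.1 b.linearIndependent c hz j
  obtain ⟨Φ, hΦ⟩ := hJ.transpose_mul_mul (Sum.elim
    (fun i : Fin h.natDegree => X.goodMap v (Polynomial.X ^ (i : ℕ), 0))
    (fun i : Fin h.natDegree => X.goodMap v (0, Polynomial.X ^ (i : ℕ))))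
  have hgram : Φᵀ * J * Φ = Matrix.fromBlocks B 0 0 (-(B * D)) := by
    refine Matrix.ext fun i j => ?_
    rw [hΦ]
    rcases i with i | i <;> rcases j with j | j <;>
      simp only [Sum.elim_inl, Sum.elim_inr, J_goodMap h2 hX, Matrix.fromBlocks_apply₁₁,
        Matrix.fromBlocks_apply₁₂, Matrix.fromBlocks_apply₂₁, Matrix.fromBlocks_apply₂₂,
        mul_zero, zero_mul, map_zero, sub_zero, zero_sub, Matrix.zero_apply,
        Matrix.neg_apply, hBD]
    · change _ = ψ (b i * b j)
      rw [hb, hb, ← map_mul, hψ]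
    · rw [hb, hb, ← map_mul, ← map_mul, hψ]
      congr 2; ring
  have hdet := congrArg Matrix.det hgram
  rw [Matrix.det_fromBlocks_zero₂₁, Matrix.det_mul, Matrix.det_mul, Matrix.det_transpose,
    Matrix.det_neg, Matrix.det_mul, Fintype.card_fin] at hdet
  have hΦ0 : Φ.det ≠ 0 := by
    intro h0
    rw [h0, zero_mul, zero_mul] at hdet
    have h3 : (-1 : K) ^ h.natDegree ≠ 0 := pow_ne_zero _ (neg_ne_zero.2 one_ne_zero)
    exact mul_ne_zero hB0 (mul_ne_zero h3 (mul_ne_zero hB0 hD0)) hdet.symm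
  rw [← hD]
  have h3 : (-1 : K) ^ h.natDegree * (-1) ^ h.natDegree = 1 := by
    rw [← mul_pow]; simp
  have h4 : B.det ^ 2 * D.det = Φ.det ^ 2 * ((-1) ^ h.natDegree * J.det) := by
    linear_combination (-(-1) ^ h.natDegree) * hdet + (- B.det ^ 2 * D.det) * h3
  have h5 := congrArg (quadraticChar K) h4
  rwa [map_mul, map_mul, quadraticChar_sq_one' hB0, quadraticChar_sq_one' hΦ0, one_mul,
    one_mul] at h5

/-- The pairs at which the form `x ^ 2 - δ y ^ 2` has quadratic character `ε`. -/
def normPairs [Fintype K] (δ : K) (ε : ℤ) : Finset (K × K) :=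
  Finset.univ.filter fun p => quadraticChar K (p.1 ^ 2 - δ * p.2 ^ 2) = ε

theorem two_mul_card_normPairs [Fintype K] (hK : ringChar K ≠ 2) {δ : K} (hδ : δ ≠ 0) {ε : ℤ}
    (hε : ε ^ 2 = 1) : 2 * ((normPairs δ ε).card : ℤ) =
      (Fintype.card K - quadraticChar K δ) * (Fintype.card K - 1) := by
  have hε' : ε = 1 ∨ ε = -1 := by simpa using hε
  have h1 : ∀ t : K, 2 * (if quadraticChar K t = ε then (1 : ℤ) else 0) =
      1 + ε * quadraticChar K t - if t = 0 then 1 else 0 := by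
    intro t
    by_cases ht : t = 0
    · have : ε ≠ 0 := by rintro rfl; simp at hε
      simp [ht, this.symm]
    · rw [if_neg ht]
      rcases hε' with rfl | rfl <;>
        rcases quadraticChar_dichotomy ht with h | h <;> rw [h] <;> norm_num
  have h3 : ((normPairs δ ε).card : ℤ) = ∑ t : K, (if quadraticChar K t = ε then (1 : ℤ) else 0) *
      ∑ x : K, ∑ y : K, (if 1 * x ^ 2 + (-δ) * y ^ 2 = t then (1 : ℤ) else 0) := by
    rw [normPairs, Finset.card_filter, Nat.cast_sum, ← Finset.univ_product_univ,
      Finset.sum_product]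
    simp only [Finset.mul_sum]
    conv_rhs => rw [Finset.sum_comm]
    refine Finset.sum_congr rfl fun x _ => ?_
    conv_rhs => rw [Finset.sum_comm]
    refine Finset.sum_congr rfl fun y _ => ?_
    simp only [one_mul, neg_mul, ← sub_eq_add_neg, mul_ite, mul_one, mul_zero, Finset.sum_ite_eq,
      Finset.mem_univ, if_true]
    push_cast; rfl
  have h4 : ∀ t : K, 2 * ((if quadraticChar K t = ε then (1 : ℤ) else 0) *
      ∑ x : K, ∑ y : K, (if 1 * x ^ 2 + (-δ) * y ^ 2 = t then (1 : ℤ) else 0)) =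
      (1 + ε * quadraticChar K t - if t = 0 then 1 else 0) *
        (Fintype.card K - quadraticChar K δ) := by
    intro t
    rw [← mul_assoc, h1, sum_binary_eq hK one_ne_zero (neg_ne_zero.2 hδ), one_mul, neg_neg]
    by_cases ht : t = 0
    · simp [ht]
    · simp [ht]
  rw [h3, Finset.mul_sum]
  simp only [h4]
  rw [← Finset.sum_mul, Finset.sum_sub_distrib, Finset.sum_add_distrib, ← Finset.mul_sum,
    quadraticChar_sum_zero hK]
  simp
  ring

theorem encard_monic_norm_le [Fintype K] (δ : K) (ε : ℤ) {n : ℕ} (hn : 2 ≤ n) :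
    {h : K[X] | (h.Monic ∧ h.natDegree = n) ∧ quadraticChar K
      (aeval (QuadraticAlgebra.omega : QuadraticAlgebra K δ 0) h).norm = ε}.encard ≤
      (((normPairs δ ε).card * Fintype.card K ^ (n - 2) : ℕ) : ℕ∞) := by
  set T : Finset ((K × K) × (Fin (n - 2) → K)) := normPairs δ ε ×ˢ Finset.univ
  have hT : (T : Set ((K × K) × (Fin (n - 2) → K))).encard =
      (((normPairs δ ε).card * Fintype.card K ^ (n - 2) : ℕ) : ℕ∞) := by
    rw [Set.encard_coe_eq_coe_finsetCard, Finset.card_product]; simp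
  rw [← hT]
  refine Set.encard_le_encard_of_injOn (f := fun h =>
    (((aeval (QuadraticAlgebra.omega : QuadraticAlgebra K δ 0) h).re,
      (aeval (QuadraticAlgebra.omega : QuadraticAlgebra K δ 0) h).im),
      fun i : Fin (n - 2) => h.coeff (i + 2))) ?_ ?_
  · rintro h ⟨_, hh⟩
    simp only [T, Finset.coe_product, Set.mem_prod, Finset.coe_univ, Set.mem_univ, and_true,
      normPairs, Finset.coe_filter, Finset.mem_univ, true_and, Set.mem_ofPred_eq]
    rw [← hh, QuadraticAlgebra.norm_def]
    congr 1; ring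
  · rintro h ⟨⟨hm, hd⟩, _⟩ g ⟨⟨gm, gd⟩, _⟩ hg
    simp only [Prod.mk.injEq] at hg
    obtain ⟨⟨h1, h2⟩, h3⟩ := hg
    have h4 : ∀ i, 2 ≤ i → (h - g).coeff i = 0 := by
      intro i hi
      rw [coeff_sub, sub_eq_zero]
      rcases lt_trichotomy i n with hin | rfl | hin
      · have := congrFun h3 ⟨i - 2, by omega⟩
        simpa only [Nat.sub_add_cancel hi] using this
      · have e1 := hm.coeff_natDegree
        have e2 := gm.coeff_natDegree
        rw [hd] at e1
        rw [gd] at e2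
        rw [e1, e2]
      · rw [coeff_eq_zero_of_natDegree_lt (by omega), coeff_eq_zero_of_natDegree_lt (by omega)]
    have h5 : h - g = C ((h - g).coeff 1) * Polynomial.X + C ((h - g).coeff 0) := by
      refine eq_X_add_C_of_natDegree_le_one (natDegree_le_iff_coeff_eq_zero.2 fun i hi => h4 i ?_)
      omega
    have h6 : aeval (QuadraticAlgebra.omega : QuadraticAlgebra K δ 0) (h - g) = 0 := by
      rw [map_sub, sub_eq_zero]
      exact QuadraticAlgebra.ext h1 h2
    rw [h5] at h6
    have h7 := congrArg QuadraticAlgebra.re h6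
    have h8 := congrArg QuadraticAlgebra.im h6
    simp [QuadraticAlgebra.algebraMap_eq] at h7 h8
    rw [← sub_eq_zero, h5, coeff_sub, coeff_sub, h7, h8]
    simp

theorem IsGoodDeg.cls_eq [Fintype K] (hK : ringChar K ≠ 2) {δ : K} {n : ℕ} {X Y : FormSpace K}
    (hX : IsGoodDeg δ n n X) (hY : IsGoodDeg δ n n Y) (h : minpoly K X.t = minpoly K Y.t) :
    cls X = cls Y := by
  have key : ∀ Z : FormSpace K, IsGoodDeg δ n n Z → ∀ hZ : IsGood δ Z, ∃ v,
      ∃ hv : GoodGen Z (minpoly K Z.t) v,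
      (Z.sub _ (hv.isBlock (Ring.two_ne_zero hK) hZ hZ.isCoprime).perp).dim = 0 := by
    rintro Z ⟨hZ, hd, hn⟩ _
    obtain ⟨v, hv, hdim⟩ := hZ.exists_split hK
    exact ⟨v, hv, by omega⟩
  obtain ⟨v, hv, h1⟩ := key X hX hX.1
  obtain ⟨w, hw, h2⟩ := key Y hY hY.1
  have h3 : (classes fun Z : FormSpace K => Z.dim = 0).encard ≤ 1 :=
    encard_classes_dim_zero _ fun Z hZ => Module.finrank_zero_iff.1 hZ
  rw [X.cls_split (hv.isBlock (Ring.two_ne_zero hK) hX.1 hX.1.isCoprime),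
    Y.cls_split (hw.isBlock (Ring.two_ne_zero hK) hY.1 hY.1.isCoprime)]
  obtain ⟨cyc, hcyc⟩ := exists_cyc hK δ
  refine congrArg₂ _ ((hcyc X hX.1 v hv).trans ((congrArg cyc h).trans (hcyc Y hY.1 w hw).symm)) ?_
  exact Set.encard_le_one_iff.1 h3 _ _ (mem_classes h1) (mem_classes h2)

theorem encard_cyclic_le [Fintype K] (hK : ringChar K ≠ 2) (δ : K) {n : ℕ} (hn : 2 ≤ n)
    (J : Matrix (Fin n ⊕ Fin n) (Fin n ⊕ Fin n) K) :
    (classes fun X => IsGoodDeg δ n n X ∧ HasGram J X).encard ≤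
      (((normPairs δ (quadraticChar K ((-1) ^ n * J.det))).card *
        Fintype.card K ^ (n - 2) : ℕ) : ℕ∞) := by
  refine (Set.encard_le_encard_of_injOn (f := minpolyCls) ?_ ?_).trans
    (encard_monic_norm_le δ _ hn)
  · rintro _ ⟨X, ⟨hX, hJ⟩, rfl⟩
    obtain ⟨v, hv, _⟩ := hX.1.exists_split hK
    rw [minpolyCls_cls]
    exact ⟨⟨X.minpoly_monic, hX.2.1⟩,
      hv.quadraticChar_norm hK hX.1 X.minpoly_monic hX.1.isCoprime hX.2.1 hJ⟩
  · rintro _ ⟨X, ⟨hX, _⟩, rfl⟩ _ ⟨Y, ⟨hY, _⟩, rfl⟩ h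
    rw [minpolyCls_cls, minpolyCls_cls] at h
    exact hX.cls_eq hK hY h

/-- Symmetry of the orthogonal sum. -/
def sumComm (X Y : FormSpace K) : Iso (X.sum Y) (Y.sum X) where
  e := LinearEquiv.prodComm K X.V Y.V
  map_J v w := by
    rw [sum_J, sum_J, add_comm]
    rfl
  map_t _ := rfl
  map_y _ := rfl

/-- The range of a high power of `y` is a block. -/
theorem isBlock_range_y_pow (X : FormSpace K) : X.IsBlock (LinearMap.range (X.y ^ X.dim)) := by
  refine isBlock_range (X.y ^ X.dim) X.t X.y (fun m => ?_) (fun m => ?_) fun m hm => ?_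
  · have := X.t_aeval_y (Polynomial.X ^ X.dim) m
    rwa [aeval_X_pow] at this
  · rw [← Module.End.mul_apply, ← Module.End.mul_apply, ← pow_succ', pow_succ]
  · have h : (X.y ^ (X.dim + X.dim)) m = 0 := by
      refine X.nondeg _ fun w => ?_
      rw [pow_add, Module.End.mul_apply, J_y_pow, hm, mul_zero]
    have := Module.End.ker_pow_eq_ker_pow_finrank_of_le (f := X.y) (m := X.dim + X.dim)
      (Nat.le_add_left _ _)
    exact (SetLike.ext_iff.1 this m).1 h

theorem mem_perp_range_y_pow (X : FormSpace K) (n : ℕ) {v : X.V} :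
    v ∈ X.perp (LinearMap.range (X.y ^ n)) ↔ (X.y ^ n) v = 0 := by
  constructor
  · intro h
    refine X.nondeg _ fun w => ?_
    rw [J_y_pow, h _ ⟨w, rfl⟩, mul_zero]
  · rintro h _ ⟨w, rfl⟩
    have h' := J_y_pow X n v w
    rw [h, map_zero, LinearMap.zero_apply] at h'
    have h1 : ((-1 : K) ^ n) ≠ 0 := pow_ne_zero _ (neg_ne_zero.2 one_ne_zero)
    exact (mul_eq_zero.1 h'.symm).resolve_left h1

/-- Every space is the sum of a good one and a bad one. -/
theorem exists_fitting (hK : ringChar K ≠ 2) {δ : K} {X : FormSpace K}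
    (hX : ∀ v, X.y (X.y v) = X.t (X.t v) - δ • v) {n : ℕ} (hn : X.dim = 2 * n) :
    ∃ (A B : FormSpace K) (m : ℕ), m ≤ n ∧ IsBad δ (2 * m) A ∧ IsGood δ B ∧ B.dim = 2 * (n - m) ∧
      X.cls = A.cls + B.cls ∧ (m = 0 → IsGood δ X) := by
  have h := isBlock_range_y_pow X
  set C := LinearMap.range (X.y ^ X.dim) with hC
  have hsub : ∀ {D : Submodule K X.V} (hD : X.IsBlock D) (v : (X.sub D hD).V),
      (X.sub D hD).y ((X.sub D hD).y v) = (X.sub D hD).t ((X.sub D hD).t v) - δ • v := by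
    intro D hD v
    apply X.incl_injective D hD
    rw [map_sub, map_smul, incl_y, incl_y, incl_t, incl_t, hX]
  have hgood : IsGood δ (X.sub C h) := by
    refine ⟨hsub h, fun v hv => ?_⟩
    apply X.incl_injective C h
    rw [map_zero]
    have h1 : X.y (X.incl C h v) = 0 := by rw [← incl_y, hv, map_zero]
    obtain ⟨w, hw⟩ := X.incl_mem C h v
    have h2 : (X.y ^ (X.dim + 1)) w = 0 := by rw [pow_succ', Module.End.mul_apply, hw, h1]
    rw [← hw]
    have := Module.End.ker_pow_eq_ker_pow_finrank_of_le (f := X.y) (m := X.dim + 1)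
      (Nat.le_succ _)
    exact (SetLike.ext_iff.1 this w).1 h2
  obtain ⟨k, hk⟩ := hgood.even_dim hK _ _ rfl
  have hdim := X.dim_split h
  have hbd : (X.sub (X.perp C) h.perp).dim = 2 * (n - k) := by omega
  refine ⟨X.sub (X.perp C) h.perp, X.sub C h, n - k, Nat.sub_le _ _, ⟨hsub h.perp, ?_, hbd⟩, hgood,
    by omega, ?_, fun h0 => ⟨hX, fun v hv => ?_⟩⟩
  · rw [← hbd]
    refine y_pow_dim ⟨X.dim, LinearMap.ext fun v => ?_⟩
    apply X.incl_injective _ h.perp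
    rw [incl_y_pow, LinearMap.zero_apply, map_zero]
    exact (X.mem_perp_range_y_pow X.dim).1 (X.incl_mem _ h.perp v)
  · rw [X.cls_split h, ← cls_sum, ← cls_sum]
    exact cls_eq (sumComm _ _)
  · have h3 : (X.sub (X.perp C) h.perp).dim = 0 := by omega
    rcases Nat.eq_zero_or_pos X.dim with hd | hd
    · have : Subsingleton X.V := Module.finrank_zero_iff.1 hd
      exact Subsingleton.elim _ _
    have hv' : v ∈ X.perp C := (X.mem_perp_range_y_pow X.dim).2 (by
      obtain ⟨k, hk⟩ := Nat.exists_eq_succ_of_ne_zero hd.ne'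
      rw [hk, pow_succ, Module.End.mul_apply, hv, map_zero])
    have : Subsingleton (X.sub (X.perp C) h.perp).V := Module.finrank_zero_iff.1 h3
    obtain ⟨w, rfl⟩ := X.exists_incl _ h.perp hv'
    rw [Subsingleton.elim w 0, map_zero]

/-- The weighted number of spaces with a given Gram matrix. -/
theorem wt_classes_hasGram_le [Fintype K] (hK : ringChar K ≠ 2) (δ : K) {n : ℕ} (hn : 2 ≤ n)
    (J : Matrix (Fin n ⊕ Fin n) (Fin n ⊕ Fin n) K) :
    wt (classes fun X => (∀ v, X.y (X.y v) = X.t (X.t v) - δ • v) ∧ HasGram J X) ≤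
      2 * (((normPairs δ (quadraticChar K ((-1) ^ n * J.det))).card *
        Fintype.card K ^ (n - 2) : ℕ) : ℕ∞) +
      ∑ d ∈ Finset.Ico 1 n, 2 * ((Fintype.card K ^ d * chainFactor d n : ℕ) : ℕ∞) +
      ∑ m ∈ Finset.Icc 1 n, wt (classes (IsBad δ (2 * m))) *
        ((goodBound (Fintype.card K) (n - m) : ℕ) : ℕ∞) := by
  have key : (classes fun X => (∀ v, X.y (X.y v) = X.t (X.t v) - δ • v) ∧ HasGram J X) ⊆
      (classes (fun X => IsGoodDeg δ n n X ∧ HasGram J X) ∪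
        ⋃ d ∈ Finset.Ico 1 n, classes (IsGoodDeg δ d n)) ∪
      ⋃ m ∈ Finset.Icc 1 n, (classes (IsBad δ (2 * m)) +
        classes fun X => IsGood δ X ∧ X.dim = 2 * (n - m)) := by
    rintro _ ⟨X, ⟨hsq, hJ⟩, rfl⟩
    have hdim : X.dim = 2 * n := by
      obtain ⟨f, -⟩ := hJ
      rw [dim, ← f.finrank_eq]
      simp [two_mul]
    obtain ⟨A, B, m, hm, hA, hB, hBd, hc, h0⟩ := exists_fitting hK hsq hdim
    rcases Nat.eq_zero_or_pos m with rfl | hm0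
    · left
      have hg := h0 rfl
      obtain ⟨v, hv, h⟩ := hg.exists_split hK
      have hd0 : (minpoly K X.t).natDegree ≠ 0 := fun h =>
        absurd (dim_eq_zero_of_minpoly h) (by omega)
      rcases (show (minpoly K X.t).natDegree ≤ n by omega).eq_or_lt with hd | hd
      · exact Or.inl (mem_classes ⟨⟨hg, hd, hdim⟩, hJ⟩)
      · right
        simp only [Set.mem_iUnion]
        exact ⟨_, Finset.mem_Ico.2 ⟨by omega, hd⟩, mem_classes ⟨hg, rfl, hdim⟩⟩
    · right
      simp only [Set.mem_iUnion]
      exact ⟨m, Finset.mem_Icc.2 ⟨hm0, hm⟩, hc ▸ Set.add_mem_add (mem_classes hA)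
        (mem_classes ⟨hB, hBd⟩)⟩
  refine (wt_mono key).trans ((wt_union_le _ _).trans (add_le_add ((wt_union_le _ _).trans
    (add_le_add ?_ ?_)) ?_))
  · exact (wt_le _).trans (mul_le_mul_right (encard_cyclic_le hK δ hn J) 2)
  · refine (wt_biUnion_le _ _).trans (Finset.sum_le_sum fun d _ => ?_)
    exact (wt_le _).trans (mul_le_mul_right (encard_isGoodDeg_le hK δ n d) 2)
  · refine (wt_biUnion_le _ _).trans (Finset.sum_le_sum fun m _ => ?_)
    exact (wt_add_le _ _).trans (mul_le_mul_right (encard_isGood_le hK δ (n - m)) _)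

theorem card_le_wt {α : Type*} (s : Finset α) (f : α → Cls K) (S : Set (Cls K))
    (hS : ∀ a ∈ s, f a ∈ S)
    (h1 : ∀ a ∈ s, ∀ b ∈ s, f a = f b → f a ∈ reflCls K → a = b)
    (h2 : ∀ a ∈ s, ∀ b ∈ s, ∀ c ∈ s, f a = f b → f a = f c → a = b ∨ a = c ∨ b = c) :
    (s.card : ℕ∞) ≤ wt S := by
  set u := s.filter fun a => f a ∈ reflCls K
  set v := s.filter fun a => f a ∉ reflCls K
  have hu : (u.card : ℕ∞) ≤ (S ∩ reflCls K).encard := by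
    rw [← Finset.card_image_of_injOn (f := f) (s := u), ← Set.encard_coe_eq_coe_finsetCard]
    · refine Set.encard_le_encard fun x hx => ?_
      obtain ⟨a, ha, rfl⟩ := Finset.mem_image.1 (Finset.mem_coe.1 hx)
      exact ⟨hS a (Finset.mem_filter.1 ha).1, (Finset.mem_filter.1 ha).2⟩
    · intro a ha b hb hab
      have ha := Finset.mem_filter.1 (Finset.mem_coe.1 ha)
      have hb := Finset.mem_filter.1 (Finset.mem_coe.1 hb)
      exact h1 a ha.1 b hb.1 hab ha.2
  have hv : (v.card : ℕ∞) ≤ 2 * (S \ reflCls K).encard := by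
    have h3 : v.card ≤ 2 * (v.image f).card := by
      refine Finset.card_le_mul_card_image _ _ fun x _ => ?_
      by_contra! hlt
      obtain ⟨a, b, c, ha, hb, hc, hab, hac, hbc⟩ := Finset.two_lt_card_iff.1 hlt
      simp only [Finset.mem_filter, v] at ha hb hc
      rcases h2 a ha.1.1 b hb.1.1 c hc.1.1 (ha.2.trans hb.2.symm) (ha.2.trans hc.2.symm) with
        h | h | h
      exacts [hab h, hac h, hbc h]
    calc (v.card : ℕ∞) ≤ ((2 * (v.image f).card : ℕ) : ℕ∞) := by exact_mod_cast h3
      _ = 2 * ((v.image f : Finset (Cls K)) : Set (Cls K)).encard := by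
        rw [Set.encard_coe_eq_coe_finsetCard]; push_cast; rfl
      _ ≤ 2 * (S \ reflCls K).encard := by
        refine mul_le_mul_right (Set.encard_le_encard fun x hx => ?_) 2
        obtain ⟨a, ha, rfl⟩ := Finset.mem_image.1 (Finset.mem_coe.1 hx)
        exact ⟨hS a (Finset.mem_filter.1 ha).1, (Finset.mem_filter.1 ha).2⟩
  have huv : u.card + v.card = s.card := Finset.card_filter_add_card_filter_not _
  rw [← huv, Nat.cast_add, wt, ← Set.encard_sdiff_add_encard_inter S (reflCls K)]
  calc (u.card : ℕ∞) + v.card ≤ (S ∩ reflCls K).encard + 2 * (S \ reflCls K).encard :=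
        add_le_add hu hv
    _ = _ := by rw [two_mul]; abel

variable {N : Type} [Fintype N] [DecidableEq N]

theorem transpose_mul_of_similitude {J : Matrix N N K} {g : GL N K} {c : Kˣ}
    (h : (g : Matrix N N K)ᵀ * J * (g : Matrix N N K) = (c : K) • J) :
    (g : Matrix N N K)ᵀ * J = (c : K) • (J * ((g⁻¹ : GL N K) : Matrix N N K)) := by
  rw [← Matrix.smul_mul, ← h, Matrix.mul_assoc _ (g : Matrix N N K), ← Units.val_mul,
      mul_inv_cancel, Units.val_one, Matrix.mul_one]

theorem transpose_inv_mul_of_similitude {J : Matrix N N K} (hs : Jᵀ = J) {g : GL N K} {c : Kˣ}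
    (h : (g : Matrix N N K)ᵀ * J * (g : Matrix N N K) = (c : K) • J) :
    (c : K) • (((g⁻¹ : GL N K) : Matrix N N K)ᵀ * J) = J * (g : Matrix N N K) := by
  have := congrArg Matrix.transpose (transpose_mul_of_similitude h)
  rw [transpose_mul, transpose_transpose, transpose_smul, transpose_mul, hs] at this
  exact this.symm

theorem toLinearMap₂'_mulVec_left (J A B : Matrix N N K) (h : Aᵀ * J = J * B) (v w : N → K) :
    Matrix.toLinearMap₂' K J (A *ᵥ v) w = Matrix.toLinearMap₂' K J v (B *ᵥ w) := by
  rw [toLinearMap₂'_apply', toLinearMap₂'_apply', mulVec_mulVec, ← h, ← mulVec_mulVec,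
    dotProduct_mulVec v, vecMul_transpose]

/-- The space attached to a similitude. -/
abbrev ofSimilitude (J : Matrix N N K) (hJ : IsUnit J) (hs : Jᵀ = J) (g : GL N K) (c : Kˣ)
    (h : (g : Matrix N N K)ᵀ * J * (g : Matrix N N K) = (c : K) • J) : FormSpace K where
  V := N → K
  J := Matrix.toLinearMap₂' K J
  t := Matrix.toLin' ((g : Matrix N N K) + (c : K) • ((g⁻¹ : GL N K) : Matrix N N K))
  y := Matrix.toLin' ((g : Matrix N N K) - (c : K) • ((g⁻¹ : GL N K) : Matrix N N K))
  symm v w := by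
    rw [toLinearMap₂'_apply', toLinearMap₂'_apply', dotProduct_mulVec, ← mulVec_transpose, hs,
      dotProduct_comm]
  nondeg v hv := by
    have h0 : J *ᵥ v = 0 := by
      refine dotProduct_eq_zero _ fun w => ?_
      rw [← hv w, toLinearMap₂'_apply', dotProduct_mulVec, ← mulVec_transpose, hs]
    exact (mulVec_injective_of_isUnit hJ) (h0.trans (mulVec_zero J).symm)
  t_adj v w := by
    rw [toLin'_apply, toLin'_apply]
    refine toLinearMap₂'_mulVec_left _ _ _ ?_ v w
    rw [transpose_add, transpose_smul, Matrix.add_mul, Matrix.smul_mul,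
      transpose_mul_of_similitude h, transpose_inv_mul_of_similitude hs h, Matrix.mul_add,
      Matrix.mul_smul, add_comm]
  y_adj v w := by
    rw [toLin'_apply, toLin'_apply, ← map_neg, ← neg_mulVec]
    refine toLinearMap₂'_mulVec_left _ _ _ ?_ v w
    rw [transpose_sub, transpose_smul, Matrix.sub_mul, Matrix.smul_mul,
      transpose_mul_of_similitude h, transpose_inv_mul_of_similitude hs h, Matrix.mul_neg,
      Matrix.mul_sub, Matrix.mul_smul, neg_sub]
  comm v := by
    rw [toLin'_apply, toLin'_apply, toLin'_apply, toLin'_apply, mulVec_mulVec, mulVec_mulVec]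
    congr 1
    have h1 : (g : Matrix N N K) * ((g⁻¹ : GL N K) : Matrix N N K) = 1 := g.mul_inv
    have h2 : ((g⁻¹ : GL N K) : Matrix N N K) * (g : Matrix N N K) = 1 := g.inv_mul
    simp only [Matrix.add_mul, Matrix.mul_add, Matrix.sub_mul, Matrix.mul_sub, Matrix.smul_mul,
      Matrix.mul_smul, h1, h2]
    module

theorem ofSimilitude_mem (J : Matrix N N K) (hJ : IsUnit J) (hs : Jᵀ = J) (g : GL N K) (c : Kˣ)
    (h : (g : Matrix N N K)ᵀ * J * (g : Matrix N N K) = (c : K) • J) :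
    (∀ v, (ofSimilitude J hJ hs g c h).y ((ofSimilitude J hJ hs g c h).y v) =
      (ofSimilitude J hJ hs g c h).t ((ofSimilitude J hJ hs g c h).t v) - (4 * (c : K)) • v) ∧
      HasGram J (ofSimilitude J hJ hs g c h) := by
  refine ⟨fun v => ?_, LinearEquiv.refl K _, fun a b => toLinearMap₂'_apply' J a b⟩
  change Matrix.toLin' _ (Matrix.toLin' _ v) = Matrix.toLin' _ (Matrix.toLin' _ v) - _
  rw [toLin'_apply, toLin'_apply, toLin'_apply, toLin'_apply, mulVec_mulVec, mulVec_mulVec]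
  have h1 : (g : Matrix N N K) * ((g⁻¹ : GL N K) : Matrix N N K) = 1 := g.mul_inv
  have h2 : ((g⁻¹ : GL N K) : Matrix N N K) * (g : Matrix N N K) = 1 := g.inv_mul
  have h3 : (4 * (c : K)) • v = ((4 * (c : K)) • (1 : Matrix N N K)) *ᵥ v := by
    rw [smul_mulVec, one_mulVec]
  rw [h3, ← sub_mulVec]
  congr 1
  simp only [Matrix.add_mul, Matrix.mul_add, Matrix.sub_mul, Matrix.mul_sub, Matrix.smul_mul,
    Matrix.mul_smul, h1, h2]
  module

theorem det_ofSimilitude_iso {J : Matrix N N K} {hJ : IsUnit J} {hs : Jᵀ = J} {g g' : GL N K}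
    {c c' : Kˣ} {h : (g : Matrix N N K)ᵀ * J * (g : Matrix N N K) = (c : K) • J}
    {h' : (g' : Matrix N N K)ᵀ * J * (g' : Matrix N N K) = (c' : K) • J}
    (f : Iso (ofSimilitude J hJ hs g c h) (ofSimilitude J hJ hs g' c' h')) :
    (LinearMap.toMatrix' (f.e : (N → K) →ₗ[K] (N → K)))ᵀ * J *
      LinearMap.toMatrix' (f.e : (N → K) →ₗ[K] (N → K)) = J ∧
    ((LinearMap.toMatrix' (f.e : (N → K) →ₗ[K] (N → K))).det = 1 ∨
      (LinearMap.toMatrix' (f.e : (N → K) →ₗ[K] (N → K))).det = -1) := by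
  set A := LinearMap.toMatrix' (f.e : (N → K) →ₗ[K] (N → K)) with hA
  have hfA : ∀ v : N → K, f.e v = A *ᵥ v := fun v => (LinearMap.toMatrix'_mulVec _ v).symm
  have h1 : Aᵀ * J * A = J := by
    apply (Matrix.toLinearMap₂' K : Matrix N N K ≃ₗ[K] (N → K) →ₗ[K] (N → K) →ₗ[K] K).injective
    refine LinearMap.ext₂ fun v w => ?_
    have := f.map_J v w
    rw [hfA, hfA] at this
    change Matrix.toLinearMap₂' K J (A *ᵥ v) (A *ᵥ w) = Matrix.toLinearMap₂' K J v w at this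
    rw [← this, toLinearMap₂'_apply', toLinearMap₂'_apply', ← mulVec_mulVec, ← mulVec_mulVec,
      dotProduct_mulVec v, vecMul_transpose]
  refine ⟨h1, ?_⟩
  have h2 := congrArg Matrix.det h1
  rw [det_mul, det_mul, det_transpose] at h2
  have h3 : J.det ≠ 0 := ((Matrix.isUnit_iff_isUnit_det J).1 hJ).ne_zero
  have h4 : A.det ^ 2 = 1 := by
    apply mul_right_cancel₀ h3
    linear_combination h2
  simpa using h4

theorem isConj_of_iso (h2 : (2 : K) ≠ 0) {J : Matrix N N K} {m : ℕ} {hJ : IsUnit J} {hs : Jᵀ = J}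
    {g g' : connSimilitudeGroup J m} {c c' : Kˣ}
    {h : ((g : GL N K) : Matrix N N K)ᵀ * J * ((g : GL N K) : Matrix N N K) = (c : K) • J}
    {h' : ((g' : GL N K) : Matrix N N K)ᵀ * J * ((g' : GL N K) : Matrix N N K) = (c' : K) • J}
    (f : Iso (ofSimilitude J hJ hs g c h) (ofSimilitude J hJ hs g' c' h'))
    (hf : LinearMap.det (f.e : (N → K) →ₗ[K] (N → K)) = 1) : IsConj g g' := by
  have h1 := (det_ofSimilitude_iso f).1
  set A := LinearMap.toMatrix' (f.e : (N → K) →ₗ[K] (N → K)) with hA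
  have hfA : ∀ v : N → K, f.e v = A *ᵥ v := fun v => (LinearMap.toMatrix'_mulVec _ v).symm
  have hdet : A.det = 1 := by rw [hA, LinearMap.det_toMatrix', hf]
  set u : GL N K := Matrix.GeneralLinearGroup.mkOfDetNeZero A (by rw [hdet]; exact one_ne_zero)
  have hu : (u : Matrix N N K) = A := rfl
  refine isConj_iff.2 ⟨⟨u, 1, by rw [hu, h1, Units.val_one, one_smul], by simp [hu, hdet]⟩, ?_⟩
  rw [mul_inv_eq_iff_eq_mul]
  apply Subtype.ext
  apply Units.ext
  change A * ((g : GL N K) : Matrix N N K) = ((g' : GL N K) : Matrix N N K) * A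
  apply Matrix.toLin'.injective
  refine LinearMap.ext fun v => ?_
  have ht := f.map_t v
  have hy := f.map_y v
  change f.e (Matrix.toLin' _ v) = Matrix.toLin' _ (f.e v) at ht hy
  rw [toLin'_apply, toLin'_apply, hfA, hfA] at ht hy
  rw [toLin'_apply, toLin'_apply, ← mulVec_mulVec, ← mulVec_mulVec]
  rw [add_mulVec, add_mulVec, mulVec_add] at ht
  rw [sub_mulVec, sub_mulVec, mulVec_sub] at hy
  have := congrArg₂ (· + ·) ht hy
  simp only [add_add_sub_cancel] at this
  have h5 : (2 : K) • (A *ᵥ ((g : GL N K) : Matrix N N K) *ᵥ v) =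
      (2 : K) • (((g' : GL N K) : Matrix N N K) *ᵥ A *ᵥ v) := by
    rw [two_smul, two_smul]; exact this
  exact smul_right_injective _ h2 h5

/-- Conjugacy classes of the connected similitude group are counted by weighted classes of
spaces. -/
theorem card_conjClasses_le [Fintype K] (h2 : (2 : K) ≠ 0) (J : Matrix N N K) (m : ℕ)
    (hJ : IsUnit J) (hs : Jᵀ = J) :
    (Nat.card (ConjClasses (connSimilitudeGroup J m)) : ℕ∞) ≤ ∑ c : Kˣ,
      wt (classes fun X => (∀ v, X.y (X.y v) = X.t (X.t v) - (4 * (c : K)) • v) ∧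
        HasGram J X) := by
  set rep : ConjClasses (connSimilitudeGroup J m) → connSimilitudeGroup J m := Quotient.out
  have hrep : ∀ κ κ', IsConj (rep κ) (rep κ') → κ = κ' := by
    intro κ κ' h
    have := ConjClasses.mk_eq_mk_iff_isConj.2 h
    have e : ∀ κ, ConjClasses.mk (rep κ) = κ := fun κ => Quotient.out_eq κ
    rwa [e, e] at this
  have hmul : ∀ κ, ∃ c : Kˣ, ((rep κ : GL N K) : Matrix N N K)ᵀ * J *
      ((rep κ : GL N K) : Matrix N N K) = (c : K) • J := fun κ => by
    obtain ⟨c, hc, -⟩ := (rep κ).2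
    exact ⟨c, hc⟩
  choose μ hμ using hmul
  rw [Nat.card_eq_fintype_card, ← Finset.card_univ, Finset.card_eq_sum_card_fiberwise (f := μ)
      (t := Finset.univ)
    (fun _ _ => Finset.mem_coe.2 (Finset.mem_univ _)), Nat.cast_sum]
  refine Finset.sum_le_sum fun c _ => ?_
  set f : ConjClasses (connSimilitudeGroup J m) → FormSpace K := fun κ =>
    ofSimilitude J hJ hs (rep κ) (μ κ) (hμ κ) with hf
  have hconj : ∀ a b, ∀ e : Iso (f a) (f b),
      LinearMap.det (e.e : (N → K) →ₗ[K] (N → K)) = 1 → a = b :=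
    fun a b e he => hrep a b (isConj_of_iso h2 e he)
  refine card_le_wt _ (fun κ => (f κ).cls) _ ?_ ?_ ?_
  · intro a ha
    obtain rfl := (Finset.mem_filter.1 ha).2
    exact mem_classes (ofSimilitude_mem J hJ hs _ _ _)
  · intro a _ b _ hab hr
    obtain ⟨e⟩ := iso_of_cls_eq hab
    obtain ⟨r, hr⟩ := cls_mem_reflCls.1 hr
    rcases (det_ofSimilitude_iso e).2 with hd | hd
    · rw [LinearMap.det_toMatrix'] at hd
      exact hconj a b e hd
    · rw [LinearMap.det_toMatrix'] at hd
      refine hconj a b (r.trans e) ?_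
      change LinearMap.det ((e.e : (N → K) →ₗ[K] (N → K)) ∘ₗ (r.e : (N → K) →ₗ[K] (N → K))) = 1
      rw [LinearMap.det_comp, hd, hr, neg_mul_neg, one_mul]
  · intro a _ b _ c' _ hab hac
    obtain ⟨e⟩ := iso_of_cls_eq hab
    obtain ⟨e'⟩ := iso_of_cls_eq hac
    rcases (det_ofSimilitude_iso e).2 with hd | hd
    · rw [LinearMap.det_toMatrix'] at hd
      exact Or.inl (hconj a b e hd)
    rcases (det_ofSimilitude_iso e').2 with hd' | hd'
    · rw [LinearMap.det_toMatrix'] at hd'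
      exact Or.inr (Or.inl (hconj a c' e' hd'))
    right; right
    refine hconj b c' (e.symm.trans e') ?_
    rw [LinearMap.det_toMatrix'] at hd hd'
    change LinearMap.det ((e'.e : (N → K) →ₗ[K] (N → K)) ∘ₗ
      (e.e.symm : (N → K) →ₗ[K] (N → K))) = 1
    have h3 : LinearMap.det (e.e : (N → K) →ₗ[K] (N → K)) *
        LinearMap.det (e.e.symm : (N → K) →ₗ[K] (N → K)) = 1 := LinearEquiv.det_mul_det_symm e.e
    rw [LinearMap.det_comp, hd', ← hd, h3]

end FormSpace

namespace FormSpace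

variable {K : Type} [Field K]

open Polynomial
open scoped Pointwise

theorem nilBound_three_three : nilBound 3 3 ≤ 4 := by
  simp [nilBound, show ¬ Even 3 by decide]

theorem nilBound_four_four : nilBound 4 4 ≤ 7 := by
  simp [nilBound, show ¬ Even 3 by decide, show Even 4 by decide]

/-- A bound for the weighted number of bad spaces. -/
def badWeight (s : Prop) (m : ℕ) : ℕ :=
  if s then ∑ i ∈ Finset.HasAntidiagonal.antidiagonal (2 * m),
    (if Odd i.1 then 1 else 2) * nilBound i.1 i.1 * nilBound i.2 i.2
  else 2 * nilBound m m

theorem wt_isBad_le_badWeight [Fintype K] (hK : ringChar K ≠ 2) {δ : K} (hδ : δ ≠ 0) (m : ℕ) :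
    wt (classes (IsBad δ (2 * m))) ≤ (badWeight (IsSquare δ) m : ℕ) := by
  rw [badWeight]
  split_ifs with h
  · obtain ⟨c, rfl⟩ := h
    rw [← pow_two] at hδ ⊢
    refine (wt_isBad_sq_le hK (ne_zero_pow two_ne_zero hδ) (2 * m)).trans_eq ?_
    push_cast
    refine Finset.sum_congr rfl fun i _ => ?_
    split_ifs <;> simp
  · exact_mod_cast wt_isBad_nonsq_le hK h m

theorem badWeight_le (s : Prop) (m : ℕ) : badWeight s m ≤ 2 * (2 * m + 1) * 4 ^ m := by
  rw [badWeight]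
  split_ifs with h
  · have h4 : (4 : ℕ) ^ m = 2 ^ (2 * m) := by rw [pow_mul]; norm_num
    calc _ ≤ ∑ i ∈ Finset.HasAntidiagonal.antidiagonal (2 * m), 2 * 4 ^ m := by
          refine Finset.sum_le_sum fun i hi => ?_
          rw [h4, ← Finset.HasAntidiagonal.mem_antidiagonal.1 hi, pow_add, ← mul_assoc]
          refine Nat.mul_le_mul (Nat.mul_le_mul ?_ (nilBound_le_two_pow _ _))
            (nilBound_le_two_pow _ _)
          split_ifs <;> norm_num
      _ = _ := by
          rw [Finset.sum_const, Finset.Nat.card_antidiagonal, smul_eq_mul]; ring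
  · calc _ ≤ 2 * 1 * 4 ^ m := by
          rw [mul_one]
          exact Nat.mul_le_mul le_rfl ((nilBound_le_two_pow m m).trans
            (Nat.pow_le_pow_left (by norm_num) m))
      _ ≤ _ := by gcongr; omega

theorem badWeight_one_le (s : Prop) : badWeight s 1 ≤ if s then 12 else 4 := by
  rw [badWeight]
  split_ifs
  · rw [Finset.Nat.sum_antidiagonal_eq_sum_range_succ_mk]
    simp [Finset.sum_range_succ, nilBound_zero_zero, nilBound_one_one, nilBound_two_two,
      show ¬ Odd 2 by decide]
  · simp [nilBound_one_one]

theorem badWeight_two_le (s : Prop) : badWeight s 2 ≤ if s then 52 else 4 := by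
  rw [badWeight]
  split_ifs
  · rw [Finset.Nat.sum_antidiagonal_eq_sum_range_succ_mk]
    have h3' := nilBound_three_three
    have h4' := nilBound_four_four
    simp [Finset.sum_range_succ, nilBound_zero_zero, nilBound_one_one, nilBound_two_two,
      show ¬ Odd 2 by decide, show ¬ Odd 4 by decide, show Odd 3 by decide]
    omega
  · simp [nilBound_two_two]

/-- A bound for the number of conjugacy classes of given multiplier. -/
def classBound (q n P : ℕ) (s : Prop) : ℕ :=
  P * q ^ (n - 2) + ∑ d ∈ Finset.Ico 1 n, 2 * (q ^ d * chainFactor d n) +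
    ∑ m ∈ Finset.Icc 1 n, badWeight s m * goodBound q (n - m)

theorem wt_classes_le_classBound [Fintype K] (hK : ringChar K ≠ 2) {δ : K} (hδ : δ ≠ 0) {n : ℕ}
    (hn : 2 ≤ n) (J : Matrix (Fin n ⊕ Fin n) (Fin n ⊕ Fin n) K) (hJ : J.det ≠ 0) :
    ∃ P : ℕ, (P : ℝ) = (Fintype.card K - if IsSquare δ then 1 else -1) * (Fintype.card K - 1) ∧
      wt (classes fun X => (∀ v, X.y (X.y v) = X.t (X.t v) - δ • v) ∧ HasGram J X) ≤
        (classBound (Fintype.card K) n P (IsSquare δ) : ℕ) := by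
  set ε := quadraticChar K ((-1) ^ n * J.det) with hε
  have hε2 : ε ^ 2 = 1 := quadraticChar_sq_one
    (mul_ne_zero (pow_ne_zero _ (neg_ne_zero.2 one_ne_zero)) hJ)
  refine ⟨2 * (normPairs δ ε).card, ?_, ?_⟩
  · have h := two_mul_card_normPairs hK hδ hε2
    have h' : quadraticChar K δ = if IsSquare δ then 1 else -1 := by
      split_ifs with hs
      · exact (quadraticChar_one_iff_isSquare hδ).2 hs
      · exact quadraticChar_neg_one_iff_not_isSquare.2 hs
    rw [h'] at h
    have := congrArg (Int.cast : ℤ → ℝ) h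
    push_cast at this ⊢
    rw [this]
  · refine (wt_classes_hasGram_le hK δ hn J).trans ?_
    rw [classBound]
    push_cast
    refine add_le_add (add_le_add ?_ le_rfl) (Finset.sum_le_sum fun m _ => ?_)
    · rw [mul_assoc]
    · exact mul_le_mul_left (wt_isBad_le_badWeight hK hδ m) _

theorem goodBound_zero (q : ℕ) : goodBound q 0 = 1 := by simp [goodBound, chainFactor]

theorem goodBound_one (q : ℕ) : goodBound q 1 = q := by
  simp [goodBound, chainFactor, Finset.sum_range_succ, numCompositions]

theorem sum_pow_mul_chainFactor_le (q : ℕ) (hq : 3 ≤ q) (n : ℕ) :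
    ((q : ℝ) - 2) * ∑ d ∈ Finset.Ico 1 n, (q : ℝ) ^ d * chainFactor d n ≤ (q : ℝ) ^ n := by
  have hq' : (3 : ℝ) ≤ q := by exact_mod_cast hq
  have h := geom_sum₂_mul (q : ℝ) 2 n
  have h1 : ∑ d ∈ Finset.Ico 1 n, (q : ℝ) ^ d * chainFactor d n ≤
      ∑ i ∈ Finset.range n, (q : ℝ) ^ i * 2 ^ (n - 1 - i) := by
    calc _ = ∑ d ∈ Finset.Ico 1 n, (q : ℝ) ^ d * 2 ^ (n - 1 - d) := by
          refine Finset.sum_congr rfl fun d hd => ?_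
          obtain ⟨h1, h2⟩ := Finset.mem_Ico.1 hd
          rw [chainFactor, if_neg (by omega), if_pos h2.le, numCompositions, if_neg (by omega),
            Nat.sub_right_comm]
          push_cast; rfl
      _ ≤ _ := by
          refine Finset.sum_le_sum_of_subset_of_nonneg (fun d hd => ?_) fun i _ _ => by positivity
          exact Finset.mem_range.2 (Finset.mem_Ico.1 hd).2
  calc _ ≤ ((q : ℝ) - 2) * ∑ i ∈ Finset.range n, (q : ℝ) ^ i * 2 ^ (n - 1 - i) :=
        mul_le_mul_of_nonneg_left h1 (by linarith)
    _ = (q : ℝ) ^ n - 2 ^ n := by rw [mul_comm, h]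
    _ ≤ _ := by have : (0 : ℝ) ≤ 2 ^ n := by positivity
                linarith

theorem goodBound_le (q : ℕ) (hq : 3 ≤ q) (n : ℕ) :
    ((q : ℝ) - 1) ^ 2 * goodBound q n ≤ (q : ℝ) ^ (n + 2) := by
  have hq' : (3 : ℝ) ≤ q := by exact_mod_cast hq
  have h1 : ((q : ℝ) - 2) * goodBound q n ≤ (q : ℝ) ^ n * (q - 1) := by
    rcases Nat.eq_zero_or_pos n with rfl | hn
    · rw [goodBound_zero, Nat.cast_one, pow_zero]; linarith
    have h := sum_pow_mul_chainFactor_le q hq n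
    have e : (goodBound q n : ℝ) = q ^ n + ∑ d ∈ Finset.Ico 1 n, (q : ℝ) ^ d * chainFactor d n := by
      rw [goodBound, Finset.sum_range_succ, Finset.range_eq_Ico, Finset.sum_eq_sum_Ico_succ_bot hn]
      simp [chainFactor, hn.ne', numCompositions, add_comm]
    rw [e, mul_add]
    linarith
  have h2 : (0 : ℝ) < q - 2 := by linarith
  refine le_of_mul_le_mul_left ?_ h2
  calc ((q : ℝ) - 2) * (((q : ℝ) - 1) ^ 2 * goodBound q n)
      = ((q : ℝ) - 1) ^ 2 * (((q : ℝ) - 2) * goodBound q n) := by ring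
    _ ≤ ((q : ℝ) - 1) ^ 2 * ((q : ℝ) ^ n * (q - 1)) := by gcongr
    _ = (q : ℝ) ^ n * (q - 1) ^ 3 := by ring
    _ ≤ (q : ℝ) ^ n * ((q - 2) * q ^ 2) := by
        gcongr
        nlinarith
    _ = _ := by ring

theorem two_mul_four_pow_le_choose {n m : ℕ} (hm : 2 ≤ m) (hmn : m ≤ n) (hn : 3 ≤ n) :
    2 * (2 * m + 1) * 4 ^ m ≤ (2 * n ^ 2 + 2).choose m := by
  induction m, hm using Nat.le_induction with
  | base =>
    have h20 : (20 : ℕ).choose 2 ≤ (2 * n ^ 2 + 2).choose 2 := Nat.choose_le_choose 2 (by nlinarith)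
    have : (20 : ℕ).choose 2 = 190 := by decide
    omega
  | succ m hm ih =>
    have ih := ih (by omega)
    set M := 2 * n ^ 2 + 2 with hM
    have hMm : 6 * (m + 1) ≤ M - m := by
      have : 7 * m + 6 ≤ M := by
        obtain ⟨k, rfl⟩ := Nat.exists_eq_add_of_le hn
        nlinarith
      omega
    have h := Nat.choose_succ_right_eq M m
    refine Nat.le_of_mul_le_mul_right ?_ (Nat.succ_pos m)
    rw [Nat.succ_eq_add_one, h]
    calc 2 * (2 * (m + 1) + 1) * 4 ^ (m + 1) * (m + 1)
        = 2 * 4 ^ m * (m + 1) * (8 * m + 12) := by ring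
      _ ≤ 2 * 4 ^ m * (m + 1) * (6 * (2 * m + 1)) := by gcongr; omega
      _ = (2 * (2 * m + 1) * 4 ^ m) * (6 * (m + 1)) := by ring
      _ ≤ _ := Nat.mul_le_mul ih hMm

theorem badWeight_le_choose (s : Prop) {n m : ℕ} (hm : 1 ≤ m) (hmn : m ≤ n) (hn : 3 ≤ n) :
    badWeight s m + (if m = 1 then 1 else 0) ≤ (2 * n ^ 2 + 2).choose m := by
  rcases hm.eq_or_lt with rfl | hm
  · have := badWeight_one_le s
    have h2 : badWeight s 1 ≤ 12 := this.trans (by split_ifs <;> norm_num)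
    rw [Nat.choose_one_right]
    simp only [if_true]
    nlinarith
  · rw [if_neg (by omega), add_zero]
    exact (badWeight_le s m).trans (two_mul_four_pow_le_choose hm hmn hn)

theorem classBound_le_of_three_le {q n P : ℕ} (s : Prop) (hq : 3 ≤ q) (hn : 3 ≤ n)
    (hP : (P : ℝ) ≤ (q + 1) * (q - 1)) :
    ((q : ℝ) - 1) ^ 2 * classBound q n P s * q ^ (2 * n ^ 2 - n) ≤ (q + 1) ^ (2 * n ^ 2 + 2) := by
  have hq' : (3 : ℝ) ≤ q := by exact_mod_cast hq
  have hnn : n + 2 ≤ 2 * n ^ 2 := by nlinarith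
  have hA : ((q : ℝ) - 1) ^ 2 * (P * q ^ (n - 2) +
      2 * ∑ d ∈ Finset.Ico 1 n, (q : ℝ) ^ d * chainFactor d n) ≤ q ^ (n + 1) * (q + 1) := by
    set T := ∑ d ∈ Finset.Ico 1 n, (q : ℝ) ^ d * chainFactor d n
    have hT : ((q : ℝ) - 2) * T ≤ q ^ n := sum_pow_mul_chainFactor_le q hq n
    have h2 : (0 : ℝ) < q - 2 := by linarith
    obtain ⟨k, rfl⟩ := Nat.exists_eq_add_of_le' (show 2 ≤ n by omega)
    rw [Nat.add_sub_cancel]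
    refine le_of_mul_le_mul_left ?_ h2
    set r : ℝ := (q : ℝ) with hr
    calc (r - 2) * ((r - 1) ^ 2 * (P * r ^ k + 2 * T))
        = (r - 1) ^ 2 * ((r - 2) * P * r ^ k + 2 * ((r - 2) * T)) := by ring
      _ ≤ (r - 1) ^ 2 * ((r - 2) * ((r + 1) * (r - 1)) * r ^ k + 2 * r ^ (k + 2)) := by gcongr
      _ = r ^ k * ((r - 1) ^ 2 * ((r - 2) * (r ^ 2 - 1) + 2 * r ^ 2)) := by ring
      _ ≤ r ^ k * ((r - 2) * (r ^ 3 * (r + 1))) := by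
          refine mul_le_mul_of_nonneg_left ?_ (by positivity)
          obtain ⟨x, hx⟩ : ∃ x : ℝ, r = x + 3 := ⟨r - 3, by ring⟩
          have hx0 : 0 ≤ x := by linarith
          rw [hx, ← sub_nonneg]
          ring_nf
          positivity
      _ = _ := by ring
  have hB : ((q : ℝ) - 1) ^ 2 * ∑ m ∈ Finset.Icc 1 n, (badWeight s m : ℝ) * goodBound q (n - m) ≤
      ∑ m ∈ Finset.Icc 1 n, (badWeight s m : ℝ) * q ^ (n - m + 2) := by
    rw [Finset.mul_sum]
    refine Finset.sum_le_sum fun m _ => ?_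
    calc _ = (badWeight s m : ℝ) * (((q : ℝ) - 1) ^ 2 * goodBound q (n - m)) := by ring
      _ ≤ _ := mul_le_mul_of_nonneg_left (goodBound_le q hq _) (Nat.cast_nonneg _)
  have hC : ((q : ℝ) - 1) ^ 2 * classBound q n P s ≤ q ^ (n + 1) * (q + 1) +
      ∑ m ∈ Finset.Icc 1 n, (badWeight s m : ℝ) * q ^ (n - m + 2) := by
    rw [classBound]
    push_cast
    rw [← Finset.mul_sum, mul_add]
    exact add_le_add hA hB
  calc _ ≤ (q ^ (n + 1) * (q + 1) +
      ∑ m ∈ Finset.Icc 1 n, (badWeight s m : ℝ) * q ^ (n - m + 2)) *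
          q ^ (2 * n ^ 2 - n) := by gcongr
    _ = q ^ (2 * n ^ 2 + 2) + ∑ m ∈ Finset.Icc 1 n,
        ((badWeight s m + (if m = 1 then 1 else 0) : ℕ) : ℝ) * q ^ (2 * n ^ 2 + 2 - m) := by
      have e1 : ∑ m ∈ Finset.Icc 1 n, ((if m = 1 then 1 else 0 : ℕ) : ℝ) * q ^ (2 * n ^ 2 + 2 - m)
          = q ^ (2 * n ^ 2 + 1) := by
        rw [Finset.sum_eq_single 1]
        · simp
        · intro m _ hm
          simp [hm]
        · intro h
          exact absurd (Finset.mem_Icc.2 ⟨le_rfl, by omega⟩) h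
      simp only [Nat.cast_add, add_mul, Finset.sum_add_distrib, e1]
      rw [Finset.sum_mul]
      have e2 : ∀ m ∈ Finset.Icc 1 n, (badWeight s m : ℝ) * q ^ (n - m + 2) * q ^ (2 * n ^ 2 - n) =
          (badWeight s m : ℝ) * q ^ (2 * n ^ 2 + 2 - m) := by
        intro m hm
        have := Finset.mem_Icc.1 hm
        rw [mul_assoc, ← pow_add]
        congr 2
        omega
      rw [Finset.sum_congr rfl e2]
      have e3 : (q : ℝ) ^ (n + 1) * (q + 1) * q ^ (2 * n ^ 2 - n) =
          q ^ (2 * n ^ 2 + 2) + q ^ (2 * n ^ 2 + 1) := by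
        have : 2 * n ^ 2 + 1 = n + 1 + (2 * n ^ 2 - n) := by omega
        rw [show 2 * n ^ 2 + 2 = 2 * n ^ 2 + 1 + 1 from rfl, pow_succ _ (2 * n ^ 2 + 1), this,
          pow_add]
        ring
      rw [e3]
      ring
    _ ≤ q ^ (2 * n ^ 2 + 2) + ∑ m ∈ Finset.Icc 1 n,
        ((2 * n ^ 2 + 2).choose m : ℝ) * q ^ (2 * n ^ 2 + 2 - m) := by
      gcongr with m hm
      have := Finset.mem_Icc.1 hm
      exact badWeight_le_choose s this.1 this.2 hn
    _ ≤ ∑ m ∈ Finset.range (2 * n ^ 2 + 2 + 1),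
        ((2 * n ^ 2 + 2).choose m : ℝ) * q ^ (2 * n ^ 2 + 2 - m) := by
      have e := Finset.sum_Ico_add' (fun m : ℕ =>
        ((2 * n ^ 2 + 2).choose m : ℝ) * (q : ℝ) ^ (2 * n ^ 2 + 2 - m)) 0 (2 * n ^ 2 + 2) 1
      rw [Finset.sum_range_succ', Finset.range_eq_Ico, e, Nat.choose_zero_right, Nat.sub_zero,
        Nat.cast_one, one_mul, add_comm]
      gcongr
      intro m hm
      have := Finset.mem_Icc.1 hm
      exact Finset.mem_Ico.2 ⟨by omega, by omega⟩
    _ = _ := by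
      rw [add_comm (q : ℝ) 1, add_pow]
      refine Finset.sum_congr rfl fun m _ => ?_
      rw [one_pow, one_mul, mul_comm]

theorem classBound_two_le {q P : ℕ} (s : Prop) (hq : 3 ≤ q)
    (hP : (P : ℝ) = (q - if s then 1 else -1) * (q - 1)) :
    ((q : ℝ) - 1) ^ 2 * classBound q 2 P s * q ^ (2 * 2 ^ 2 - 2) ≤ (q + 1) ^ (2 * 2 ^ 2 + 2) := by
  have hq' : (3 : ℝ) ≤ q := by exact_mod_cast hq
  have hc : classBound q 2 P s = P + 2 * q + (badWeight s 1 * q + badWeight s 2) := by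
    simp [classBound, Finset.sum_Icc_succ_top, goodBound_zero, goodBound_one, chainFactor,
      numCompositions]
  have h1 := badWeight_one_le s
  have h2 := badWeight_two_le s
  have hb : (classBound q 2 P s : ℝ) ≤ if s then ((q : ℝ) - 1) ^ 2 + 14 * q + 52
      else (q : ℝ) ^ 2 + 6 * q + 4 := by
    rw [hc]
    push_cast
    rw [hP]
    split_ifs at h1 h2 ⊢ with hs
    · have h1 : (badWeight s 1 : ℝ) ≤ 12 := by exact_mod_cast h1
      have h2 : (badWeight s 2 : ℝ) ≤ 52 := by exact_mod_cast h2
      nlinarith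
    · have h1 : (badWeight s 1 : ℝ) ≤ 4 := by exact_mod_cast h1
      have h2 : (badWeight s 2 : ℝ) ≤ 4 := by exact_mod_cast h2
      nlinarith
  refine (mul_le_mul_of_nonneg_right (mul_le_mul_of_nonneg_left hb (sq_nonneg _))
    (by positivity)).trans ?_
  obtain ⟨x, hx⟩ : ∃ x : ℝ, (q : ℝ) = x + 3 := ⟨q - 3, by ring⟩
  have hx0 : 0 ≤ x := by linarith
  split_ifs
  all_goals
    rw [hx, ← sub_nonneg]
    ring_nf
    positivity

end FormSpace

theorem card_connSimilitudeGroup_le_pow {F : Type} [Field F] [Fintype F] (hF : ringChar F ≠ 2)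
    {n : ℕ} (hn : 2 ≤ n) (J : Matrix (Fin n ⊕ Fin n) (Fin n ⊕ Fin n) F) (hJ : IsUnit J)
    (hs : Jᵀ = J) :
    (Fintype.card (connSimilitudeGroup J n) : ℝ) ≤
      ((Fintype.card F : ℝ) - 1) * (Fintype.card F : ℝ) ^ (2 * n ^ 2 - n) := by
  have : Nonempty (Fin n ⊕ Fin n) := ⟨Sum.inl ⟨0, by omega⟩⟩
  have h1 := card_connSimilitudeGroup_le (Ring.two_ne_zero hF) J hJ hs n
  obtain ⟨m, rfl⟩ := Nat.exists_eq_add_of_le' hn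
  have h2 := card_isometries_le hF (m + 1) (by simp; ring) J hJ hs
  set q := Fintype.card F
  have hq : 1 < q := Fintype.one_lt_card
  have hq' : (1 : ℝ) < q := by exact_mod_cast hq
  have h1' : 2 * (Fintype.card (connSimilitudeGroup J (m + 2)) : ℝ) ≤
      ((q : ℝ) - 1) * (isometries J).card := by
    have := (Nat.cast_le (α := ℝ)).2 h1
    rw [Nat.cast_mul, Nat.cast_mul, Nat.cast_sub hq.le] at this
    exact_mod_cast this
  have h2' : ((isometries J).card : ℝ) ≤ 2 * ((q : ℝ) ^ (m + 1 + 1) + 1) *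
      ∏ i ∈ Finset.range (m + 1), (q : ℝ) ^ (2 * (i + 1)) * ((q : ℝ) ^ (2 * (i + 1)) - 1) := by
    exact_mod_cast h2
  have h3 : ((q : ℝ) ^ (m + 1 + 1) + 1) *
      ∏ i ∈ Finset.range (m + 1), (q : ℝ) ^ (2 * (i + 1)) * ((q : ℝ) ^ (2 * (i + 1)) - 1) ≤
      (q : ℝ) ^ (2 * (m + 2) ^ 2 - (m + 2)) := by
    have h0 : ∀ k, ∑ i ∈ Finset.range k, 4 * (i + 1 + 1) = 2 * k * (k + 3) := by
      intro k
      induction k with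
      | zero => rfl
      | succ k ih => rw [Finset.sum_range_succ, ih]; ring
    have h4 : ∏ i ∈ Finset.range m, (q : ℝ) ^ (2 * (i + 1 + 1)) * ((q : ℝ) ^ (2 * (i + 1 + 1)) - 1)
        ≤ (q : ℝ) ^ (2 * m * (m + 3)) := by
      calc _ ≤ ∏ i ∈ Finset.range m, (q : ℝ) ^ (4 * (i + 1 + 1)) := by
            refine Finset.prod_le_prod (fun i _ => ?_) fun i _ => ?_
            · exact mul_nonneg (by positivity) (sub_nonneg.2 (one_le_pow₀ hq'.le))
            · have : (q : ℝ) ^ (4 * (i + 1 + 1)) =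
                  q ^ (2 * (i + 1 + 1)) * q ^ (2 * (i + 1 + 1)) := by
                rw [← pow_add]; congr 1; ring
              rw [this]
              gcongr
              linarith
        _ = _ := by
            rw [Finset.prod_pow_eq_pow_sum]
            rw [h0]
    have h5 : ((q : ℝ) ^ (m + 1 + 1) + 1) * ((q : ℝ) ^ 2 - 1) ≤ (q : ℝ) ^ (m + 4) := by
      have : (q : ℝ) ^ 2 ≤ (q : ℝ) ^ (m + 2) := pow_le_pow_right₀ hq'.le (by omega)
      have e : (q : ℝ) ^ (m + 4) = q ^ (m + 2) * q ^ 2 := by rw [← pow_add]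
      rw [e]
      linarith
    have e : 2 * (m + 2) ^ 2 - (m + 2) = 2 * m * (m + 3) + 2 + (m + 4) := by
      have : 2 * (m + 2) ^ 2 = 2 * m * (m + 3) + 2 + (m + 4) + (m + 2) := by ring
      omega
    rw [Finset.prod_range_succ', e, pow_add _ (2 * m * (m + 3) + 2),
      pow_add _ (2 * m * (m + 3))]
    calc _ = ((∏ i ∈ Finset.range m, (q : ℝ) ^ (2 * (i + 1 + 1)) *
          ((q : ℝ) ^ (2 * (i + 1 + 1)) - 1)) * q ^ 2) *
          (((q : ℝ) ^ (m + 1 + 1) + 1) * ((q : ℝ) ^ 2 - 1)) := by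
          rw [zero_add, mul_one]; ring
      _ ≤ _ := by
          refine mul_le_mul (mul_le_mul_of_nonneg_right h4 (by positivity)) h5 ?_ (by positivity)
          exact mul_nonneg (by positivity) (sub_nonneg.2 (one_le_pow₀ hq'.le))
  have h6 : ((q : ℝ) - 1) * (isometries J).card ≤
      ((q : ℝ) - 1) * (2 * (q : ℝ) ^ (2 * (m + 2) ^ 2 - (m + 2))) := by
    refine mul_le_mul_of_nonneg_left (h2'.trans ?_) (by linarith)
    rw [mul_assoc]
    linarith
  linarith

theorem card_connSimilitudeGroup_one_le {F : Type} [Field F] [Fintype F] (hF : ringChar F ≠ 2)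
    (J : Matrix (Fin 1 ⊕ Fin 1) (Fin 1 ⊕ Fin 1) F) (hJ : IsUnit J) (hs : Jᵀ = J) :
    (Fintype.card (connSimilitudeGroup J 1) : ℝ) ≤
      ((Fintype.card F : ℝ) - 1) * ((Fintype.card F : ℝ) + 1) := by
  have h1 := card_connSimilitudeGroup_le (Ring.two_ne_zero hF) J hJ hs 1
  have h2 := card_isometries_le hF 0 (by simp) J hJ hs
  set q := Fintype.card F
  have hq : 1 < q := Fintype.one_lt_card
  have hq' : (1 : ℝ) < q := by exact_mod_cast hq
  have h1' : 2 * (Fintype.card (connSimilitudeGroup J 1) : ℝ) ≤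
      ((q : ℝ) - 1) * (isometries J).card := by
    have := (Nat.cast_le (α := ℝ)).2 h1
    rw [Nat.cast_mul, Nat.cast_mul, Nat.cast_sub hq.le] at this
    exact_mod_cast this
  have h2' : ((isometries J).card : ℝ) ≤ 2 * ((q : ℝ) + 1) := by
    have : ((isometries J).card : ℤ) ≤ 2 * ((q : ℤ) + 1) := by simpa using h2
    exact_mod_cast this
  nlinarith

theorem card_conjClasses_connSimilitudeGroup_le {F : Type} [Field F] [Fintype F]
    (hF : ringChar F ≠ 2) {n : ℕ} (hn : 2 ≤ n) (J : Matrix (Fin n ⊕ Fin n) (Fin n ⊕ Fin n) F)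
    (hJ : IsUnit J) (hs : Jᵀ = J) :
    ((Fintype.card F : ℝ) - 1) * Nat.card (ConjClasses (connSimilitudeGroup J n)) *
        (Fintype.card F : ℝ) ^ (2 * n ^ 2 - n) ≤
      ((Fintype.card F : ℝ) + 1) ^ (2 * n ^ 2 + 2) := by
  have h2 : (2 : F) ≠ 0 := Ring.two_ne_zero hF
  have hdet : J.det ≠ 0 := ((Matrix.isUnit_iff_isUnit_det J).1 hJ).ne_zero
  have hq3 : 3 ≤ Fintype.card F := by
    have h1 : 1 < Fintype.card F := Fintype.one_lt_card
    have h3 : Fintype.card F % 2 = 1 := FiniteField.odd_card_of_char_ne_two hF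
    omega
  have hδ : ∀ c : Fˣ, (4 * (c : F)) ≠ 0 := fun c => by
    rw [show (4 : F) = 2 * 2 by norm_num]
    exact mul_ne_zero (mul_ne_zero h2 h2) c.ne_zero
  choose P hP hwt using fun c : Fˣ => FormSpace.wt_classes_le_classBound hF (hδ c) hn J hdet
  have h := (FormSpace.card_conjClasses_le h2 J n hJ hs).trans
    (Finset.sum_le_sum fun c _ => hwt c)
  set q := Fintype.card F
  have hq' : (3 : ℝ) ≤ q := by exact_mod_cast hq3
  have h' : Nat.card (ConjClasses (connSimilitudeGroup J n)) ≤
      ∑ c : Fˣ, FormSpace.classBound q n (P c) (IsSquare (4 * (c : F))) := by exact_mod_cast h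
  have h'' : (Nat.card (ConjClasses (connSimilitudeGroup J n)) : ℝ) ≤
      ∑ c : Fˣ, (FormSpace.classBound q n (P c) (IsSquare (4 * (c : F))) : ℝ) := by
    exact_mod_cast h'
  have hb : ∀ c : Fˣ, ((q : ℝ) - 1) ^ 2 * FormSpace.classBound q n (P c) (IsSquare (4 * (c : F))) *
      q ^ (2 * n ^ 2 - n) ≤ (q + 1) ^ (2 * n ^ 2 + 2) := by
    intro c
    rcases hn.eq_or_lt with rfl | hn
    · exact FormSpace.classBound_two_le _ hq3 (by convert hP c)
    · refine FormSpace.classBound_le_of_three_le _ hq3 hn ?_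
      rw [hP c]
      split_ifs <;> nlinarith
  have hcard : (Fintype.card Fˣ : ℝ) = q - 1 := by
    rw [Fintype.card_units, Nat.cast_sub (by omega), Nat.cast_one]
  have hq1 : (0 : ℝ) < q - 1 := by linarith
  refine le_of_mul_le_mul_left ?_ hq1
  calc ((q : ℝ) - 1) * (((q : ℝ) - 1) * Nat.card (ConjClasses (connSimilitudeGroup J n)) *
        (q : ℝ) ^ (2 * n ^ 2 - n))
      ≤ ((q : ℝ) - 1) * (((q : ℝ) - 1) * (∑ c : Fˣ,
        (FormSpace.classBound q n (P c) (IsSquare (4 * (c : F))) : ℝ)) *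
        (q : ℝ) ^ (2 * n ^ 2 - n)) := by gcongr
    _ = ∑ c : Fˣ, ((q : ℝ) - 1) ^ 2 * FormSpace.classBound q n (P c) (IsSquare (4 * (c : F))) *
      q ^ (2 * n ^ 2 - n) := by
        rw [← Finset.sum_mul, ← Finset.mul_sum]; ring
    _ ≤ ∑ c : Fˣ, ((q : ℝ) + 1) ^ (2 * n ^ 2 + 2) := Finset.sum_le_sum fun c _ => hb c
    _ = _ := by rw [Finset.sum_const, Finset.card_univ, nsmul_eq_mul, hcard]

theorem stmt_19 (n : ℕ) (hn : 1 ≤ n) (q : ℕ) (hq : ∃ p r : ℕ, p.Prime ∧ Odd p ∧ 0 < r ∧ q = p ^ r)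
    (F : Type) [Field F] [Fintype F] [DecidableEq F] (hF : Fintype.card F = q)
    (J : Matrix (Fin n ⊕ Fin n) (Fin n ⊕ Fin n) F) (hJunit : IsUnit J) (hJsymm : Jᵀ = J)
    (ι : Type) [Fintype ι] (R : ι → FDRep ℂ ↥(connSimilitudeGroup J n))
    (hsimple : ∀ i, Simple (R i))
    (hdistinct : ∀ i j : ι, Nonempty (R i ≅ R j) → i = j)
    (hcomplete : ∀ ρ : FDRep ℂ ↥(connSimilitudeGroup J n), Simple ρ → ∃ i, Nonempty (ρ ≅ R i)) :
    ∑ i : ι, (Module.finrank ℂ (R i) : ℝ) ≤ ((q : ℝ) + 1) ^ (n ^ 2 + 1) := by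
  obtain ⟨p, r, hp, hodd, hr, hqp⟩ := hq
  have hchar : ringChar F ≠ 2 := by
    intro h2
    have heven := FiniteField.even_card_of_char_two h2
    rw [hF, hqp, ← Nat.even_iff] at heven
    exact Nat.not_even_iff_odd.2 (hodd.pow) heven
  have hrep := sum_finrank_sq_le R hsimple hdistinct
  refine (pow_le_pow_iff_left₀ (by positivity) (by positivity) two_ne_zero).1 ?_
  rcases hn.eq_or_lt with rfl | hn
  · have hG := card_connSimilitudeGroup_one_le hchar J hJunit hJsymm
    have hk : (Nat.card (ConjClasses (connSimilitudeGroup J 1)) : ℝ) ≤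
        Fintype.card (connSimilitudeGroup J 1) := by
      rw [← Nat.card_eq_fintype_card]
      exact_mod_cast Nat.card_le_card_of_surjective _ ConjClasses.mk_surjective
    rw [hF] at hG
    have hq0 : (0 : ℝ) ≤ q := Nat.cast_nonneg q
    refine hrep.trans ?_
    have hG' : (Fintype.card (connSimilitudeGroup J 1) : ℝ) ≤ ((q : ℝ) + 1) ^ 2 := by nlinarith
    calc _ ≤ ((q : ℝ) + 1) ^ 2 * ((q : ℝ) + 1) ^ 2 :=
          mul_le_mul (hk.trans hG') hG' (Nat.cast_nonneg _) (by positivity)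
      _ = _ := by ring
  · have hG := card_connSimilitudeGroup_le_pow hchar hn J hJunit hJsymm
    have hk := card_conjClasses_connSimilitudeGroup_le hchar hn J hJunit hJsymm
    rw [hF] at hG hk
    calc _ ≤ _ := hrep
      _ ≤ (Nat.card (ConjClasses (connSimilitudeGroup J n)) : ℝ) *
          (((q : ℝ) - 1) * (q : ℝ) ^ (2 * n ^ 2 - n)) := by gcongr
      _ = ((q : ℝ) - 1) * (Nat.card (ConjClasses (connSimilitudeGroup J n)) : ℝ) *
          (q : ℝ) ^ (2 * n ^ 2 - n) := by ring
      _ ≤ _ := hk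
      _ = _ := by rw [← pow_mul]; congr 1; ring

end
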